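/- arXiv:2411.08183 — 2 statements merged into one kernel-verified Lean document; each statement's English description precedes it below -/
import Mathlib

section
/- For every pair of positive integers d and k and all δ, κ ∈ (0,1], there exist constants c₀ = c₀(d,k,δ,κ) and T = T(d,k,δ,κ) with the following property. For every c ≥ c₀, every n and m, every d-local function f : {0,1}^m → {0,1}^n, and every Ψ ⊆ {0,1,…,n} containing an element s with |s − n/2| ≤ n/c, there exists a partition of {0,1}^m into subcubes, each labeled Type I, Type II, or Type III, such that: (1) for each Type-I subcube C there is a set S_C ⊆ [n] with |S_C| ≤ T such that f(U(C)) is k-wise independent on [n]∖S_C; (2) if the union W of the Type-II subcubes is nonempty, then dTV(f(U(W)), D_Ψ) > 1 − κ; and (3) the total probability mass under U^m of the Type-III subcubes is at most δ. -/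
open Finset

noncomputable section

/-- Hamming weight of a Boolean string. -/
def hw {n : ℕ} (x : Fin n → Bool) : ℕ := (Finset.univ.filter fun i => x i = true).card

/-- Uniform distribution on a finite set `C` (zero if `C` is empty). -/
def unifOn {α : Type} [Fintype α] [DecidableEq α] (C : Finset α) : α → ℝ :=
  fun x => if x ∈ C then (C.card : ℝ)⁻¹ else 0

/-- Total variation distance between two (mass functions of) distributions. -/
def tvd {α : Type} [Fintype α] (A B : α → ℝ) : ℝ := (∑ x, |A x - B x|) / 2

/-- Pushforward of a distribution along `f`. -/
def pushf {α β : Type} [Fintype α] [DecidableEq β] (f : α → β) (A : α → ℝ) : β → ℝ :=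
  fun y => ∑ x ∈ Finset.univ.filter (fun x => f x = y), A x

/-- `f` is `d`-local: each output coordinate depends on at most `d` input coordinates. -/
def IsLocal {m n : ℕ} (d : ℕ) (f : (Fin m → Bool) → (Fin n → Bool)) : Prop :=
  ∀ i : Fin n, ∃ T : Finset (Fin m), T.card ≤ d ∧
    ∀ x y : Fin m → Bool, (∀ j ∈ T, x j = y j) → f x i = f y i

/-- `D_Ψ`: uniform distribution on strings whose Hamming weight lies in `Ψ`. -/
def DPsi (n : ℕ) (Ψ : Finset ℕ) : (Fin n → Bool) → ℝ :=
  unifOn (Finset.univ.filter fun x => hw x ∈ Ψ)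

/-- The weight distribution of `A`: probability that the Hamming weight equals `k`. -/
def wd {n : ℕ} (A : (Fin n → Bool) → ℝ) (k : ℕ) : ℝ :=
  ∑ x ∈ Finset.univ.filter (fun x => hw x = k), A x

/-- Total variation distance between the weight distributions of `A` and `B`. -/
def tvW {n : ℕ} (A B : (Fin n → Bool) → ℝ) : ℝ :=
  (∑ k ∈ Finset.range (n + 1), |wd A k - wd B k|) / 2

/-- Symmetrization of the distribution `A`. -/
def symA {n : ℕ} (A : (Fin n → Bool) → ℝ) : (Fin n → Bool) → ℝ :=
  fun x => wd A (hw x) / (n.choose (hw x))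

/-- `D` is `k`-wise independent on the coordinate set `T`. -/
def KWiseOn {n : ℕ} (k : ℕ) (D : (Fin n → Bool) → ℝ) (T : Finset (Fin n)) : Prop :=
  ∀ T' ⊆ T, T'.card ≤ k → ∀ z : Fin n → Bool,
    (∑ y ∈ Finset.univ.filter (fun y : Fin n → Bool => ∀ i ∈ T', y i = z i), D y)
      = ((2 : ℝ) ^ T'.card)⁻¹

/-- The subcube of `{0,1}^m` described by the partial assignment `ρ`. -/
def cube {m : ℕ} (ρ : Fin m → Option Bool) : Finset (Fin m → Bool) :=
  Finset.univ.filter fun x => ∀ j : Fin m, ∀ b : Bool, ρ j = some b → x j = b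

theorem mem_cube {m : ℕ} {ρ : Fin m → Option Bool} {x : Fin m → Bool} :
    x ∈ cube ρ ↔ ∀ j : Fin m, ∀ b : Bool, ρ j = some b → x j = b := by
  simp [cube]

theorem cube_nonempty {m : ℕ} (ρ : Fin m → Option Bool) : (cube ρ).Nonempty :=
  ⟨fun j => (ρ j).getD false, mem_cube.2 fun j b h => by simp [h]⟩

theorem card_cube_pos {m : ℕ} (ρ : Fin m → Option Bool) : (0 : ℝ) < (cube ρ).card := by
  exact_mod_cast (cube_nonempty ρ).card_pos

theorem cube_none {m : ℕ} : cube (fun _ : Fin m => none) = univ := by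
  ext x; simp [mem_cube]

theorem mem_cube_update {m : ℕ} {ρ : Fin m → Option Bool} {j : Fin m} (hj : ρ j = none)
    (b : Bool) {x : Fin m → Bool} :
    x ∈ cube (Function.update ρ j (some b)) ↔ x ∈ cube ρ ∧ x j = b := by
  simp only [mem_cube]
  constructor
  · intro h
    refine ⟨fun i c hi => h i c ?_, h j b (by simp)⟩
    rwa [Function.update_of_ne]
    rintro rfl
    simp [hj] at hi
  · rintro ⟨h, hb⟩ i c hi
    by_cases hij : i = j
    · subst hij
      simp at hi
      rw [hb, hi]
    · rw [Function.update_of_ne hij] at hi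
      exact h i c hi

theorem filter_cube_eq_cube_update {m : ℕ} {ρ : Fin m → Option Bool} {j : Fin m}
    (hj : ρ j = none) (b : Bool) :
    (cube ρ).filter (fun x => x j = b) = cube (Function.update ρ j (some b)) := by
  ext x
  simp [mem_cube_update hj]

/-- Splitting a count over a cube along a free coordinate. -/
theorem card_filter_cube_split {m : ℕ} {ρ : Fin m → Option Bool} {j : Fin m} (hj : ρ j = none)
    (b : Bool) (p : (Fin m → Bool) → Prop) [DecidablePred p] :
    ((cube ρ).filter p).card = ((cube (Function.update ρ j (some b))).filter p).card
      + ((cube (Function.update ρ j (some (!b)))).filter p).card := by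
  rw [← filter_cube_eq_cube_update hj, ← filter_cube_eq_cube_update hj,
    ← card_filter_add_card_filter_not (s := (cube ρ).filter p) (fun x => x j = b)]
  congr 2
  · ext x; simp; tauto
  · ext x
    simp only [mem_filter]
    cases x j <;> cases b <;> simp

theorem card_cube_update {m : ℕ} {ρ : Fin m → Option Bool} {j : Fin m} (hj : ρ j = none)
    (b : Bool) : (cube (Function.update ρ j (some b))).card * 2 = (cube ρ).card := by
  have h1 : (cube (Function.update ρ j (some b))).card
      = (cube (Function.update ρ j (some (!b)))).card := by
    refine card_nbij' (fun x => Function.update x j (!b)) (fun x => Function.update x j b)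
      ?_ ?_ ?_ ?_
    · intro x hx
      simp only [SetLike.mem_coe, mem_cube] at hx ⊢
      intro i c hi
      by_cases hij : i = j
      · subst hij; simpa using hi
      · rw [Function.update_of_ne hij] at hi ⊢
        exact hx i c (by rwa [Function.update_of_ne hij])
    · intro x hx
      simp only [SetLike.mem_coe, mem_cube] at hx ⊢
      intro i c hi
      by_cases hij : i = j
      · subst hij; simpa using hi
      · rw [Function.update_of_ne hij] at hi ⊢
        exact hx i c (by rwa [Function.update_of_ne hij])
    · intro x hx
      have := ((mem_cube_update hj b).1 hx).2
      simp [← this]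
    · intro x hx
      have := ((mem_cube_update hj _).1 hx).2
      simp [← this]
  have h2 := card_filter_cube_split hj b (fun _ => True)
  simp only [filter_true] at h2
  omega

theorem piecewise_mem_cube {m : ℕ} {ρ : Fin m → Option Bool} (X : Finset (Fin m))
    {x y : Fin m → Bool} (hx : x ∈ cube ρ) (hy : y ∈ cube ρ) : X.piecewise x y ∈ cube ρ := by
  rw [mem_cube] at *
  intro j b h
  by_cases hj : j ∈ X
  · simpa [hj] using hx j b h
  · simpa [hj] using hy j b h

/-- Functions of disjoint sets of coordinates are independent on a cube. -/
theorem sum_mul_cube_of_indep {m : ℕ} (ρ : Fin m → Option Bool) (X : Finset (Fin m))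
    (g h : (Fin m → Bool) → ℝ)
    (hg : ∀ x ∈ cube ρ, ∀ y ∈ cube ρ, (∀ j ∈ X, x j = y j) → g x = g y)
    (hh : ∀ x ∈ cube ρ, ∀ y ∈ cube ρ, (∀ j ∉ X, x j = y j) → h x = h y) :
    (∑ x ∈ cube ρ, g x * h x) * (cube ρ).card = (∑ x ∈ cube ρ, g x) * ∑ x ∈ cube ρ, h x := by
  have h1 : (∑ x ∈ cube ρ, g x * h x) * (cube ρ).card
      = ∑ p ∈ cube ρ ×ˢ cube ρ, g p.1 * h p.1 := by
    rw [sum_product, sum_mul]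
    refine sum_congr rfl fun x _ => ?_
    simp [mul_comm]
  rw [h1, sum_mul_sum, ← sum_product']
  refine sum_nbij' (fun p => (X.piecewise p.1 p.2, X.piecewise p.2 p.1))
    (fun p => (X.piecewise p.1 p.2, X.piecewise p.2 p.1)) ?_ ?_ ?_ ?_ ?_
  · rintro ⟨x, y⟩ hp
    rw [mem_product] at hp ⊢
    exact ⟨piecewise_mem_cube X hp.1 hp.2, piecewise_mem_cube X hp.2 hp.1⟩
  · rintro ⟨x, y⟩ hp
    rw [mem_product] at hp ⊢
    exact ⟨piecewise_mem_cube X hp.1 hp.2, piecewise_mem_cube X hp.2 hp.1⟩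
  · rintro ⟨x, y⟩ _
    ext j <;> by_cases hj : j ∈ X <;> simp [hj]
  · rintro ⟨x, y⟩ _
    ext j <;> by_cases hj : j ∈ X <;> simp [hj]
  · rintro ⟨x, y⟩ hp
    rw [mem_product] at hp
    have e1 : g x = g (X.piecewise x y) :=
      hg _ hp.1 _ (piecewise_mem_cube X hp.1 hp.2) fun j hj => by simp [hj]
    have e2 : h x = h (X.piecewise y x) :=
      hh _ hp.1 _ (piecewise_mem_cube X hp.2 hp.1) fun j hj => by simp [hj]
    simp only [e1, e2]

theorem card_agree_mul {n : ℕ} (I : Finset (Fin n)) (z : Fin n → Bool) :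
    (univ.filter fun y : Fin n → Bool => ∀ i ∈ I, y i = z i).card * 2 ^ I.card = 2 ^ n := by
  have key : ∀ I : Finset (Fin n), (univ.filter fun y : Fin n → Bool => ∀ i ∈ I, y i = z i)
      = cube (fun i => if i ∈ I then some (z i) else none) := by
    intro I
    ext y
    simp [mem_cube]
  induction I using Finset.induction_on with
  | empty => simp
  | insert i I hi ih =>
    rw [key] at ih ⊢
    have : (fun j => if j ∈ insert i I then some (z j) else none)
        = Function.update (fun j => if j ∈ I then some (z j) else none) i (some (z i)) := by
      ext1 j
      by_cases hj : j = i
      · subst hj; simp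
      · simp [hj]
    rw [card_insert_of_notMem hi, pow_succ', ← mul_assoc, this,
      card_cube_update (by simp [hi]), ih]

theorem sum_pushf_unifOn {α β : Type} [Fintype α] [DecidableEq α] [Fintype β] [DecidableEq β]
    (f : α → β) (C : Finset α) (p : β → Prop) [DecidablePred p] :
    ∑ y ∈ univ.filter p, pushf f (unifOn C) y
      = ((C.filter fun x => p (f x)).card : ℝ) / C.card := by
  have h : ∀ y, pushf f (unifOn C) y
      = ∑ x ∈ C, if f x = y then (C.card : ℝ)⁻¹ else 0 := by
    intro y
    simp only [pushf, unifOn]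
    rw [sum_filter, ← sum_filter_add_sum_filter_not univ (fun x => x ∈ C)]
    rw [add_comm, sum_eq_zero, zero_add]
    · refine sum_congr (by ext; simp) fun x hx => ?_
      simp [hx] 
    · intro x hx
      simp at hx
      simp [hx]
  simp_rw [h]
  rw [sum_comm, card_filter, Nat.cast_sum, sum_div]
  refine sum_congr rfl fun x _ => ?_
  rw [sum_ite_eq]
  by_cases hp : p (f x) <;> simp [hp]

theorem pushf_unifOn_apply {α β : Type} [Fintype α] [DecidableEq α] [Fintype β] [DecidableEq β]
    (f : α → β) (C : Finset α) (y : β) :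
    pushf f (unifOn C) y = ((C.filter fun x => f x = y).card : ℝ) / C.card := by
  rw [← sum_pushf_unifOn f C (fun y' => y' = y), filter_eq' univ y]
  simp

theorem tvd_eq_one_sub {α : Type} [Fintype α] {A B : α → ℝ} (hA : ∑ x, A x = 1)
    (hB : ∑ x, B x = 1) : tvd A B = 1 - ∑ x, min (A x) (B x) := by
  have h : ∀ x, |A x - B x| = A x + B x - 2 * min (A x) (B x) := by
    intro x
    rcases le_total (A x) (B x) with h | h
    · rw [min_eq_left h, abs_of_nonpos (by linarith)]; ring
    · rw [min_eq_right h, abs_of_nonneg (by linarith)]; ring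
  simp only [tvd, h, sum_sub_distrib, sum_add_distrib, hA, hB, ← mul_sum]
  ring

/-- Passing to marginals can only increase the overlap of two distributions. -/
theorem sum_min_le_marginal {n : ℕ} (A B : (Fin n → Bool) → ℝ) (I : Finset (Fin n)) :
    ∑ y, min (A y) (B y) ≤ 2 ^ I.card / 2 ^ n *
      ∑ z : Fin n → Bool, min (∑ y ∈ univ.filter (fun y : Fin n → Bool => ∀ i ∈ I, y i = z i), A y)
        (∑ y ∈ univ.filter (fun y : Fin n → Bool => ∀ i ∈ I, y i = z i), B y) := by
  have h1 : ∑ z : Fin n → Bool, ∑ y ∈ univ.filter (fun y : Fin n → Bool => ∀ i ∈ I, y i = z i),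
      min (A y) (B y) ≤ ∑ z : Fin n → Bool,
      min (∑ y ∈ univ.filter (fun y : Fin n → Bool => ∀ i ∈ I, y i = z i), A y)
        (∑ y ∈ univ.filter (fun y : Fin n → Bool => ∀ i ∈ I, y i = z i), B y) := by
    refine sum_le_sum fun z _ => le_min ?_ ?_
    · exact sum_le_sum fun y _ => min_le_left _ _
    · exact sum_le_sum fun y _ => min_le_right _ _
  have h2 : ∑ z : Fin n → Bool, ∑ y ∈ univ.filter (fun y : Fin n → Bool => ∀ i ∈ I, y i = z i),
      min (A y) (B y) = ∑ y, min (A y) (B y) * (2 ^ n / 2 ^ I.card) := by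
    simp_rw [sum_filter]
    rw [sum_comm]
    refine sum_congr rfl fun y _ => ?_
    rw [← sum_filter, sum_const, nsmul_eq_mul, mul_comm]
    congr 1
    rw [eq_div_iff (by positivity)]
    have := card_agree_mul I y
    simp_rw [eq_comm (a := y _)]
    exact_mod_cast this
  rw [h2, ← sum_mul] at h1
  calc ∑ y, min (A y) (B y)
      = 2 ^ I.card / 2 ^ n * ((∑ y, min (A y) (B y)) * (2 ^ n / 2 ^ I.card)) := by
        field_simp
    _ ≤ _ := by gcongr

/-- The probability that `f` agrees with `z` on `I` under the uniform distribution on a cube. -/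
def marg {m n : ℕ} (f : (Fin m → Bool) → (Fin n → Bool)) (ρ : Fin m → Option Bool)
    (I : Finset (Fin n)) (z : Fin n → Bool) : ℝ :=
  (((cube ρ).filter fun x => ∀ i ∈ I, f x i = z i).card : ℝ) / (cube ρ).card

/-- The Bhattacharyya coefficient between the marginal of `f` on `I` and the uniform
distribution. -/
def affinity {m n : ℕ} (f : (Fin m → Bool) → (Fin n → Bool)) (ρ : Fin m → Option Bool)
    (I : Finset (Fin n)) : ℝ :=
  (∑ z, √(marg f ρ I z * 2 ^ I.card)) / 2 ^ n

/-- The unfixed input coordinates that the outputs in `I` read. -/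
def freeNbhd {m n : ℕ} (nb : Fin n → Finset (Fin m)) (ρ : Fin m → Option Bool)
    (I : Finset (Fin n)) : Finset (Fin m) :=
  (I.biUnion nb).filter fun j => ρ j = none

section Local

variable {m n : ℕ} {f : (Fin m → Bool) → (Fin n → Bool)} {nb : Fin n → Finset (Fin m)}

theorem marg_nonneg (f : (Fin m → Bool) → (Fin n → Bool)) (ρ : Fin m → Option Bool)
    (I : Finset (Fin n)) (z : Fin n → Bool) : 0 ≤ marg f ρ I z := by
  unfold marg; positivity

theorem marg_congr (ρ : Fin m → Option Bool) {I : Finset (Fin n)} {z w : Fin n → Bool}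
    (h : ∀ i ∈ I, z i = w i) : marg f ρ I z = marg f ρ I w := by
  unfold marg
  congr 3
  refine filter_congr fun x _ => forall₂_congr fun i hi => ?_
  rw [h i hi]

theorem apply_eq_of_eq_on_freeNbhd
    (hf : ∀ i x y, (∀ j ∈ nb i, x j = y j) → f x i = f y i) {ρ : Fin m → Option Bool}
    {I : Finset (Fin n)} {x y : Fin m → Bool} (hx : x ∈ cube ρ) (hy : y ∈ cube ρ)
    (h : ∀ j ∈ freeNbhd nb ρ I, x j = y j) {i : Fin n} (hi : i ∈ I) : f x i = f y i := by
  refine hf i x y fun j hj => ?_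
  rcases hρ : ρ j with _ | b
  · exact h j (by simp only [freeNbhd, mem_filter, mem_biUnion]; exact ⟨⟨i, hi, hj⟩, hρ⟩)
  · rw [mem_cube.1 hx j b hρ, mem_cube.1 hy j b hρ]

theorem marg_union (hf : ∀ i x y, (∀ j ∈ nb i, x j = y j) → f x i = f y i)
    {ρ : Fin m → Option Bool} {I J : Finset (Fin n)}
    (hIJ : Disjoint (freeNbhd nb ρ I) (freeNbhd nb ρ J)) (z : Fin n → Bool) :
    marg f ρ (I ∪ J) z = marg f ρ I z * marg f ρ J z := by
  have h := sum_mul_cube_of_indep ρ (freeNbhd nb ρ I)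
    (fun x => if ∀ i ∈ I, f x i = z i then 1 else 0)
    (fun x => if ∀ i ∈ J, f x i = z i then 1 else 0) ?_ ?_
  · have e : ∀ x, ((if ∀ i ∈ I, f x i = z i then 1 else 0) *
        (if ∀ i ∈ J, f x i = z i then 1 else 0) : ℝ)
        = if ∀ i ∈ I ∪ J, f x i = z i then 1 else 0 := by
      intro x
      simp only [mem_union, or_imp, forall_and]
      rw [ite_and]
      split_ifs <;> simp
    simp only [e, sum_boole] at h
    have hc := (card_cube_pos ρ).ne'
    unfold marg
    field_simp
    linarith
  · intro x hx y hy hxy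
    congr 1
    refine propext (forall₂_congr fun i hi => ?_)
    rw [apply_eq_of_eq_on_freeNbhd hf hx hy hxy hi]
  · intro x hx y hy hxy
    congr 1
    refine propext (forall₂_congr fun i hi => ?_)
    rw [apply_eq_of_eq_on_freeNbhd hf hx hy
      (fun j hj => hxy j (disjoint_right.1 hIJ hj)) hi]

theorem affinity_union (hf : ∀ i x y, (∀ j ∈ nb i, x j = y j) → f x i = f y i)
    {ρ : Fin m → Option Bool} {I J : Finset (Fin n)} (hd : Disjoint I J)
    (hIJ : Disjoint (freeNbhd nb ρ I) (freeNbhd nb ρ J)) :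
    affinity f ρ (I ∪ J) = affinity f ρ I * affinity f ρ J := by
  have h := sum_mul_cube_of_indep (fun _ : Fin n => none) I
    (fun z => √(marg f ρ I z * 2 ^ I.card)) (fun z => √(marg f ρ J z * 2 ^ J.card)) ?_ ?_
  · rw [cube_none] at h
    have e : ∀ z, √(marg f ρ I z * 2 ^ I.card) * √(marg f ρ J z * 2 ^ J.card)
        = √(marg f ρ (I ∪ J) z * 2 ^ (I ∪ J).card) := by
      intro z
      rw [← Real.sqrt_mul (mul_nonneg (marg_nonneg f ρ I z) (by positivity)),
        marg_union hf hIJ, card_union_of_disjoint hd, pow_add]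
      congr 1
      ring
    simp only [e, card_univ, Fintype.card_fun, Fintype.card_bool, Fintype.card_fin] at h
    push_cast at h
    unfold affinity
    rw [div_mul_div_comm, ← h, mul_div_mul_right _ _ (by positivity)]
  · intro z _ w _ hzw
    simp only [marg_congr ρ hzw]
  · intro z _ w _ hzw
    simp only [marg_congr ρ (fun i hi => hzw i (disjoint_right.1 hd hi))]

theorem affinity_empty (ρ : Fin m → Option Bool) : affinity f ρ ∅ = 1 := by
  have := (card_cube_pos ρ).ne'
  simp [affinity, marg, this]

theorem affinity_nonneg (ρ : Fin m → Option Bool) (I : Finset (Fin n)) :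
    0 ≤ affinity f ρ I := by
  unfold affinity; positivity

theorem freeNbhd_biUnion_subset {ρ : Fin m → Option Bool} (F : Finset (Finset (Fin n))) :
    freeNbhd nb ρ (F.biUnion id) ⊆ F.biUnion (freeNbhd nb ρ) := by
  intro j hj
  simp only [freeNbhd, mem_filter, mem_biUnion, id] at hj ⊢
  obtain ⟨⟨i, ⟨A, hA, hi⟩, hj⟩, hρ⟩ := hj
  exact ⟨A, hA, ⟨i, hi, hj⟩, hρ⟩

theorem affinity_biUnion_le (hf : ∀ i x y, (∀ j ∈ nb i, x j = y j) → f x i = f y i)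
    {ρ : Fin m → Option Bool} {b : ℝ} (hb : 0 ≤ b) (F : Finset (Finset (Fin n)))
    (hF : ∀ A ∈ F, affinity f ρ A ≤ b)
    (hd : ∀ A ∈ F, ∀ B ∈ F, A ≠ B → Disjoint A B)
    (hN : ∀ A ∈ F, ∀ B ∈ F, A ≠ B → Disjoint (freeNbhd nb ρ A) (freeNbhd nb ρ B)) :
    affinity f ρ (F.biUnion id) ≤ b ^ F.card := by
  induction F using Finset.induction_on with
  | empty => simp [affinity_empty]
  | insert A F hA ih =>
    have hne : ∀ B ∈ F, A ≠ B := by rintro B hB rfl; exact hA hB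
    rw [biUnion_insert, id, affinity_union hf, card_insert_of_notMem hA, pow_succ']
    · refine mul_le_mul (hF A (mem_insert_self _ _)) (ih ?_ ?_ ?_) (affinity_nonneg _ _) hb
      · exact fun B hB => hF B (mem_insert_of_mem hB)
      · exact fun B hB C hC => hd B (mem_insert_of_mem hB) C (mem_insert_of_mem hC)
      · exact fun B hB C hC => hN B (mem_insert_of_mem hB) C (mem_insert_of_mem hC)
    · rw [disjoint_biUnion_right]
      exact fun B hB => hd A (mem_insert_self _ _) B (mem_insert_of_mem hB) (hne B hB)
    · refine disjoint_of_subset_right (freeNbhd_biUnion_subset F) ?_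
      rw [disjoint_biUnion_right]
      exact fun B hB => hN A (mem_insert_self _ _) B (mem_insert_of_mem hB) (hne B hB)

/-- An event depending on the coordinates in `X` has probability a multiple of `2 ^ (-|X|)`. -/
theorem exists_card_filter_cube_mul_eq (X : Finset (Fin m)) (p : (Fin m → Bool) → Prop)
    [DecidablePred p] (ρ : Fin m → Option Bool)
    (hp : ∀ x ∈ cube ρ, ∀ y ∈ cube ρ, (∀ j ∈ X, x j = y j) → (p x ↔ p y)) :
    ∃ a : ℕ, ((cube ρ).filter p).card * 2 ^ X.card = a * (cube ρ).card := by
  induction X using Finset.induction_on generalizing ρ with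
  | empty =>
    obtain ⟨x₀, hx₀⟩ := cube_nonempty ρ
    by_cases h : p x₀
    · refine ⟨1, ?_⟩
      rw [filter_true_of_mem fun x hx => (hp x₀ hx₀ x hx (by simp)).1 h]
      simp
    · refine ⟨0, ?_⟩
      rw [filter_false_of_mem fun x hx hpx => h ((hp x₀ hx₀ x hx (by simp)).2 hpx)]
      simp
  | insert j X hj ih =>
    rw [card_insert_of_notMem hj]
    rcases hρ : ρ j with _ | b
    · have key : ∀ b, ∃ a : ℕ, ((cube (Function.update ρ j (some b))).filter p).card * 2 ^ X.card
          = a * (cube (Function.update ρ j (some b))).card := by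
        intro b
        refine ih _ fun x hx y hy h => ?_
        rw [mem_cube_update hρ] at hx hy
        refine hp x hx.1 y hy.1 fun i hi => ?_
        rcases mem_insert.1 hi with rfl | hi
        · rw [hx.2, hy.2]
        · exact h i hi
      obtain ⟨a, ha⟩ := key true
      obtain ⟨a', ha'⟩ := key false
      refine ⟨a + a', ?_⟩
      rw [card_filter_cube_split hρ true, pow_succ]
      have h1 := card_cube_update hρ true
      have h2 := card_cube_update hρ false
      simp only [Bool.not_true]
      calc _ = ((cube (Function.update ρ j (some true))).filter p).card * 2 ^ X.card * 2
            + ((cube (Function.update ρ j (some false))).filter p).card * 2 ^ X.card * 2 := by ring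
        _ = _ := by rw [ha, ha', mul_assoc, mul_assoc, h1, h2]; ring
    · obtain ⟨a, ha⟩ := ih ρ fun x hx y hy h => hp x hx y hy fun i hi => by
        rcases mem_insert.1 hi with rfl | hi
        · rw [mem_cube.1 hx i b hρ, mem_cube.1 hy i b hρ]
        · exact h i hi
      exact ⟨a * 2, by rw [pow_succ, ← mul_assoc, ha]; ring⟩

theorem sum_marg (ρ : Fin m → Option Bool) (I : Finset (Fin n)) :
    ∑ z, marg f ρ I z * 2 ^ I.card = 2 ^ n := by
  have hc := (card_cube_pos ρ).ne'
  simp only [marg, card_filter, Nat.cast_sum]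
  rw [← sum_mul, ← sum_div, sum_comm]
  have h : ∀ x ∈ cube ρ, ∑ z : Fin n → Bool, (((if ∀ i ∈ I, f x i = z i then 1 else 0 : ℕ)) : ℝ)
      = 2 ^ n / 2 ^ I.card := by
    intro x _
    rw [eq_div_iff (by positivity)]
    have := card_agree_mul I (f x)
    simp_rw [eq_comm (a := f x _)]
    rw [← Nat.cast_sum, ← card_filter]
    exact_mod_cast this
  rw [sum_congr rfl h, sum_const, nsmul_eq_mul]
  field_simp

/-- A non-uniform marginal of bounded locality has affinity bounded away from one. -/
theorem affinity_le_of_marg_ne (hf : ∀ i x y, (∀ j ∈ nb i, x j = y j) → f x i = f y i)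
    {ρ : Fin m → Option Bool} {I : Finset (Fin n)} {k h : ℕ} (hk : I.card ≤ k)
    (hh : (freeNbhd nb ρ I).card ≤ h) {z₀ : Fin n → Bool}
    (hz : marg f ρ I z₀ * 2 ^ I.card ≠ 1) :
    affinity f ρ I ≤ 1 - (4 * (2 ^ k + 1) * 2 ^ k * 4 ^ h : ℝ)⁻¹ := by
  have hc := card_cube_pos ρ
  set q : (Fin n → Bool) → ℝ := fun z => marg f ρ I z * 2 ^ I.card with hq
  have hq0 : ∀ z, 0 ≤ q z := fun z => mul_nonneg (marg_nonneg f ρ I z) (by positivity)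
  have hpk : (2 : ℝ) ^ I.card ≤ 2 ^ k := pow_le_pow_right₀ (by norm_num) hk
  have hqk : q z₀ ≤ 2 ^ k := by
    have : marg f ρ I z₀ ≤ 1 := by
      unfold marg
      rw [div_le_one hc]
      exact_mod_cast card_filter_le _ _
    calc q z₀ ≤ 1 * 2 ^ I.card := by simp only [hq]; gcongr
      _ ≤ _ := by rw [one_mul]; exact hpk
  have hgap : 1 ≤ (2 ^ h : ℝ) * |q z₀ - 1| := by
    obtain ⟨a, ha⟩ := exists_card_filter_cube_mul_eq (freeNbhd nb ρ I)
      (fun x => ∀ i ∈ I, f x i = z₀ i) ρ fun x hx y hy hxy =>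
        forall₂_congr fun i hi => by rw [apply_eq_of_eq_on_freeNbhd hf hx hy hxy hi]
    have ha' : marg f ρ I z₀ * 2 ^ (freeNbhd nb ρ I).card = a := by
      unfold marg
      rw [div_mul_eq_mul_div, div_eq_iff hc.ne']
      exact_mod_cast ha
    have hint : (2 ^ (freeNbhd nb ρ I).card : ℝ) * (q z₀ - 1)
        = ((a * 2 ^ I.card - 2 ^ (freeNbhd nb ρ I).card : ℤ) : ℝ) := by
      push_cast
      rw [← ha']
      simp only [hq]
      ring
    have hne : (a * 2 ^ I.card - 2 ^ (freeNbhd nb ρ I).card : ℤ) ≠ 0 := by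
      intro h0
      rw [h0] at hint
      simp only [Int.cast_zero, mul_eq_zero, pow_eq_zero_iff', OfNat.ofNat_ne_zero, false_and,
        false_or] at hint
      exact hz (by linarith)
    have h1 : (1 : ℝ) ≤ |(2 ^ (freeNbhd nb ρ I).card : ℝ) * (q z₀ - 1)| := by
      rw [hint]
      exact_mod_cast Int.one_le_abs hne
    rw [abs_mul, abs_of_pos (by positivity)] at h1
    refine h1.trans ?_
    gcongr
    norm_num
  have hsq : ((2 * (2 ^ k + 1)) * 4 ^ h : ℝ)⁻¹ ≤ (√(q z₀) - 1) ^ 2 := by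
    have hs := Real.sq_sqrt (hq0 z₀)
    have hs0 := Real.sqrt_nonneg (q z₀)
    set s := √(q z₀)
    rw [inv_le_iff_one_le_mul₀ (by positivity)]
    have h4 : (4 : ℝ) ^ h = 2 ^ h * 2 ^ h := by rw [← mul_pow]; norm_num
    have h5 : 1 ≤ (2 ^ h * 2 ^ h : ℝ) * (q z₀ - 1) ^ 2 := by
      have := mul_le_mul hgap hgap (by norm_num) (by positivity)
      rw [← sq_abs (q z₀ - 1)]
      nlinarith
    have h6 : (q z₀ - 1) ^ 2 ≤ (s - 1) ^ 2 * (2 * (2 ^ k + 1)) := by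
      have e : (q z₀ - 1) ^ 2 = (s - 1) ^ 2 * (s + 1) ^ 2 := by rw [← hs]; ring
      rw [e]
      refine mul_le_mul_of_nonneg_left ?_ (sq_nonneg _)
      nlinarith [sq_nonneg (s - 1)]
    rw [h4]
    have h7 : (0 : ℝ) ≤ 2 ^ h * 2 ^ h := by positivity
    nlinarith [mul_le_mul_of_nonneg_left h6 h7]
  have hsum : (2 ^ n / 2 ^ I.card : ℝ) * ((2 * (2 ^ k + 1)) * 4 ^ h : ℝ)⁻¹
      ≤ ∑ z, (√(q z) - 1) ^ 2 := by
    have e : (2 ^ n / 2 ^ I.card : ℝ)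
        = (univ.filter fun y : Fin n → Bool => ∀ i ∈ I, y i = z₀ i).card := by
      rw [div_eq_iff (by positivity)]
      exact_mod_cast (card_agree_mul I z₀).symm
    rw [e, ← nsmul_eq_mul, ← sum_const]
    calc _ ≤ ∑ z ∈ univ.filter fun y : Fin n → Bool => ∀ i ∈ I, y i = z₀ i,
          (√(q z) - 1) ^ 2 := by
          refine sum_le_sum fun z hz => ?_
          have : q z = q z₀ := by
            simp only [hq]
            rw [marg_congr ρ (mem_filter.1 hz).2]
          rw [this]
          exact hsq
      _ ≤ _ := sum_le_sum_of_subset_of_nonneg (filter_subset _ _) fun _ _ _ => sq_nonneg _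
  have hexp : ∑ z, (√(q z) - 1) ^ 2 = 2 * 2 ^ n - 2 * ∑ z, √(q z) := by
    have e : ∀ z, (√(q z) - 1) ^ 2 = q z + 1 - 2 * √(q z) := by
      intro z
      nlinarith [Real.sq_sqrt (hq0 z)]
    simp only [e, sum_sub_distrib, sum_add_distrib, ← mul_sum]
    rw [sum_marg]
    simp
    ring
  have haff : affinity f ρ I = (∑ z, √(q z)) / 2 ^ n := rfl
  rw [haff, div_le_iff₀ (by positivity)]
  have hle : (2 ^ n : ℝ) * (2 * (4 * (2 ^ k + 1) * 2 ^ k * 4 ^ h : ℝ)⁻¹)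
      ≤ (2 ^ n / 2 ^ I.card : ℝ) * ((2 * (2 ^ k + 1)) * 4 ^ h : ℝ)⁻¹ := by
    have e : (2 ^ n : ℝ) * (2 * (4 * (2 ^ k + 1) * 2 ^ k * 4 ^ h : ℝ)⁻¹)
        = (2 ^ n / 2 ^ k : ℝ) * ((2 * (2 ^ k + 1)) * 4 ^ h : ℝ)⁻¹ := by
      field_simp
      norm_num
    rw [e]
    gcongr
  nlinarith

/-- Many independent non-uniform marginals make the overlap with any distribution having
nearly uniform marginals small. -/
theorem sum_min_pushf_le (hf : ∀ i x y, (∀ j ∈ nb i, x j = y j) → f x i = f y i)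
    {ρ : Fin m → Option Bool} {b : ℝ} (hb : 0 ≤ b) (F : Finset (Finset (Fin n)))
    (hF : ∀ A ∈ F, affinity f ρ A ≤ b)
    (hd : ∀ A ∈ F, ∀ B ∈ F, A ≠ B → Disjoint A B)
    (hN : ∀ A ∈ F, ∀ B ∈ F, A ≠ B → Disjoint (freeNbhd nb ρ A) (freeNbhd nb ρ B))
    {D : (Fin n → Bool) → ℝ}
    (hD : ∀ z : Fin n → Bool,
      (∑ y ∈ univ.filter (fun y : Fin n → Bool => ∀ i ∈ F.biUnion id, y i = z i), D y)
        * 2 ^ (F.biUnion id).card ≤ 3) :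
    ∑ y, min (pushf f (unifOn (cube ρ)) y) (D y) ≤ 3 * b ^ F.card := by
  set I := F.biUnion id with hI
  refine (sum_min_le_marginal _ _ I).trans ?_
  refine le_trans ?_ (mul_le_mul_of_nonneg_left (affinity_biUnion_le hf hb F hF hd hN)
    (by norm_num : (0 : ℝ) ≤ 3))
  rw [← hI]
  unfold affinity
  rw [div_mul_eq_mul_div, mul_sum, mul_div_assoc', mul_sum]
  refine div_le_div_of_nonneg_right (sum_le_sum fun z _ => ?_) (by positivity)
  have e := sum_pushf_unifOn f (cube ρ) (fun y => ∀ i ∈ I, y i = z i)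
  rw [e]
  change 2 ^ I.card * min (marg f ρ I z) _ ≤ _
  set q := marg f ρ I z * 2 ^ I.card with hq
  have hq0 : 0 ≤ q := mul_nonneg (marg_nonneg f ρ I z) (by positivity)
  have h1 : 2 ^ I.card * min (marg f ρ I z)
      (∑ y ∈ univ.filter (fun y : Fin n → Bool => ∀ i ∈ I, y i = z i), D y) ≤ min q 3 := by
    refine le_min ?_ ?_
    · rw [hq, mul_comm]; gcongr; exact min_le_left _ _
    · refine le_trans ?_ (hD z)
      rw [mul_comm]; gcongr; exact min_le_right _ _
  refine h1.trans ?_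
  have hs := Real.sq_sqrt hq0
  have hs0 := Real.sqrt_nonneg q
  rcases le_total (√q) 1 with h | h
  · refine (min_le_left _ _).trans ?_
    nlinarith
  · refine (min_le_right _ _).trans ?_
    linarith

end Local

section Slices

variable {n : ℕ}

theorem hw_le (x : Fin n → Bool) : hw x ≤ n := by
  simpa [hw] using card_filter_le (univ : Finset (Fin n)) (fun i => x i = true)

theorem card_filter_eq_false (x : Fin n → Bool) :
    (univ.filter fun i => x i = false).card = n - hw x := by
  have := card_filter_add_card_filter_not (s := (univ : Finset (Fin n))) (fun i => x i = true)
  simp only [Bool.not_eq_true, card_univ, Fintype.card_fin] at this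
  simp only [hw]
  omega

theorem hw_comp_equiv (x : Fin n → Bool) (σ : Equiv.Perm (Fin n)) : hw (x ∘ σ) = hw x := by
  simp only [hw, card_filter, Function.comp]
  exact Equiv.sum_comp σ fun i => if x i = true then 1 else 0

theorem card_hw_eq (w : ℕ) : (univ.filter fun x : Fin n → Bool => hw x = w).card = n.choose w := by
  have h : (powersetCard w (univ : Finset (Fin n))).card = n.choose w := by simp
  rw [← h]
  refine card_nbij' (fun x => univ.filter fun i => x i = true) (fun s i => decide (i ∈ s))
    ?_ ?_ ?_ ?_
  · intro x hx
    rw [SetLike.mem_coe, mem_filter] at hx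
    rw [SetLike.mem_coe, mem_powersetCard]
    exact ⟨subset_univ _, hx.2⟩
  · intro s hs
    rw [SetLike.mem_coe, mem_powersetCard] at hs
    rw [SetLike.mem_coe, mem_filter]
    simpa [hw] using hs.2
  · intro x _
    ext i
    simp
  · intro s _
    ext i
    simp

/-- Fixing one more coordinate of a slice, by symmetry of the remaining coordinates. -/
theorem card_slice_fix_mul_le {I : Finset (Fin n)} {z : Fin n → Bool} {w B : ℕ} (hw1 : w ≤ B)
    (hw2 : n - w ≤ B) {i : Fin n} (hi : i ∉ I) :
    (univ.filter fun y : Fin n → Bool => hw y = w ∧ ∀ j ∈ insert i I, y j = z j).card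
        * (n - I.card)
      ≤ B * (univ.filter fun y : Fin n → Bool => hw y = w ∧ ∀ j ∈ I, y j = z j).card := by
  set S := univ.filter fun y : Fin n → Bool => hw y = w ∧ ∀ j ∈ I, y j = z j with hS
  have h1 : (univ.filter fun y : Fin n → Bool => hw y = w ∧ ∀ j ∈ insert i I, y j = z j)
      = S.filter fun y => y i = z i := by
    ext y
    simp only [hS, mem_filter, mem_univ, true_and, forall_mem_insert]
    tauto
  have h2 : ∀ i' ∈ Iᶜ, (S.filter fun y => y i' = z i).card = (S.filter fun y => y i = z i).card := by
    intro i' hi'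
    rw [mem_compl] at hi'
    have hfix : ∀ j ∈ I, Equiv.swap i i' j = j := fun j hj =>
      Equiv.swap_apply_of_ne_of_ne (fun h => hi (h ▸ hj)) (fun h => hi' (h ▸ hj))
    refine card_nbij' (fun y => y ∘ Equiv.swap i i') (fun y => y ∘ Equiv.swap i i') ?_ ?_ ?_ ?_
    · intro y hy
      simp only [hS, SetLike.mem_coe, mem_filter, mem_univ, true_and, hw_comp_equiv] at hy ⊢
      refine ⟨⟨hy.1.1, fun j hj => ?_⟩, by simpa using hy.2⟩
      simpa [hfix j hj] using hy.1.2 j hj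
    · intro y hy
      simp only [hS, SetLike.mem_coe, mem_filter, mem_univ, true_and, hw_comp_equiv] at hy ⊢
      refine ⟨⟨hy.1.1, fun j hj => ?_⟩, by simpa using hy.2⟩
      simpa [hfix j hj] using hy.1.2 j hj
    · intro y _
      ext j
      simp
    · intro y _
      ext j
      simp
  have h3 : ∑ i' ∈ Iᶜ, (S.filter fun y => y i' = z i).card
      = (S.filter fun y => y i = z i).card * (n - I.card) := by
    rw [sum_congr rfl h2, sum_const, card_compl, Fintype.card_fin, smul_eq_mul, mul_comm]
  rw [h1, ← h3]
  simp_rw [card_filter]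
  rw [sum_comm, mul_comm, ← smul_eq_mul, ← sum_const]
  refine sum_le_sum fun y hy => ?_
  rw [← card_filter]
  refine (card_le_card (filter_subset_filter _ (subset_univ _))).trans ?_
  have hy' : hw y = w := by
    simp only [hS, mem_filter, mem_univ, true_and] at hy
    exact hy.1
  cases z i
  · rw [card_filter_eq_false, hy']; exact hw2
  · change hw y ≤ B
    rw [hy']; exact hw1

theorem card_slice_fix_le {K : ℕ} (hK : 1 ≤ K) (hn : 4 * K ^ 2 + 2 * K ≤ n) {w : ℕ} (hwn : w ≤ n)
    (hw1 : (w : ℝ) ≤ n / 2 + 2 * (n / (16 * K))) (hw2 : (n : ℝ) / 2 - 2 * (n / (16 * K)) ≤ w)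
    (I : Finset (Fin n)) (hI : I.card ≤ K) (z : Fin n → Bool) :
    ((univ.filter fun y : Fin n → Bool => hw y = w ∧ ∀ j ∈ I, y j = z j).card : ℝ) * 2 ^ I.card
      ≤ (1 + 1 / (2 * K)) ^ I.card * (univ.filter fun y : Fin n → Bool => hw y = w).card := by
  have hK' : (1 : ℝ) ≤ K := by exact_mod_cast hK
  have hn' : (4 * K ^ 2 + 2 * K : ℝ) ≤ n := by exact_mod_cast hn
  induction I using Finset.induction_on with
  | empty => simp
  | insert i I hi ih =>
    rw [card_insert_of_notMem hi] at hI ⊢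
    have ih' := ih (by omega)
    have h := card_slice_fix_mul_le (I := I) (z := z) (w := w) (B := max w (n - w))
      (le_max_left _ _) (le_max_right _ _) hi
    have hIn : I.card ≤ n := by nlinarith
    have hB : ((max w (n - w) : ℕ) : ℝ) ≤ n / 2 + 2 * (n / (16 * K)) := by
      rw [Nat.cast_max, Nat.cast_sub hwn]
      exact max_le hw1 (by linarith)
    set a : ℝ := ((univ.filter fun y : Fin n → Bool =>
      hw y = w ∧ ∀ j ∈ insert i I, y j = z j).card : ℝ) with ha
    set b : ℝ := ((univ.filter fun y : Fin n → Bool =>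
      hw y = w ∧ ∀ j ∈ I, y j = z j).card : ℝ) with hb
    have hR : a * (n - I.card) ≤ (n / 2 + 2 * (n / (16 * K))) * b := by
      have h' : a * ((n - I.card : ℕ) : ℝ) ≤ ((max w (n - w) : ℕ) : ℝ) * b := by
        rw [ha, hb]
        exact_mod_cast h
      rw [Nat.cast_sub hIn] at h'
      exact h'.trans (by gcongr)
    have hIK : (I.card : ℝ) ≤ K := by exact_mod_cast (by omega : I.card ≤ K)
    have hpos : (0 : ℝ) < n - I.card := by nlinarith
    have hstep : a * 2 ≤ (1 + 1 / (2 * K)) * b := by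
      have hb0 : 0 ≤ b := by rw [hb]; positivity
      have hcoef : 2 * (n / 2 + 2 * (n / (16 * K)) : ℝ) ≤ (1 + 1 / (2 * K)) * (n - I.card) := by
        have e1 : 2 * (n / 2 + 2 * (n / (16 * K)) : ℝ) = n + n / (4 * K) := by
          field_simp; ring
        have e2 : (1 + 1 / (2 * K) : ℝ) * (n - K) = n + 2 * (n / (4 * K)) - K - 1 / 2 := by
          field_simp; ring
        have e3 : (K + 1 / 2 : ℝ) ≤ n / (4 * K) := by
          rw [le_div_iff₀ (by positivity)]
          nlinarith
        have e4 : (1 + 1 / (2 * K) : ℝ) * (n - K) ≤ (1 + 1 / (2 * K)) * (n - I.card) := by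
          gcongr
        linarith
      refine le_of_mul_le_mul_right ?_ hpos
      nlinarith [mul_le_mul_of_nonneg_right hcoef hb0]
    calc a * 2 ^ (I.card + 1) = a * 2 * 2 ^ I.card := by ring
      _ ≤ (1 + 1 / (2 * K)) * b * 2 ^ I.card := by gcongr
      _ = (1 + 1 / (2 * K)) * (b * 2 ^ I.card) := by ring
      _ ≤ (1 + 1 / (2 * K)) * ((1 + 1 / (2 * K)) ^ I.card
            * (univ.filter fun y : Fin n → Bool => hw y = w).card) := by gcongr
      _ = _ := by ring

theorem choose_add_le_pow_mul {c : ℝ} (hc : 2 ≤ c) {a : ℕ} (ha : (n : ℝ) / 2 + n / c ≤ a)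
    (t : ℕ) : (n.choose (a + t) : ℝ) ≤ ((c - 2) / (c + 2)) ^ t * n.choose a := by
  induction t with
  | zero => simp
  | succ t ih =>
    have hq : 0 ≤ (c - 2) / (c + 2) := div_nonneg (by linarith) (by linarith)
    rcases lt_or_ge n (a + t + 1) with h | h
    · rw [← add_assoc, Nat.choose_eq_zero_of_lt h]
      push_cast
      positivity
    · have e := Nat.choose_succ_right_eq n (a + t)
      have e' : (n.choose (a + t + 1) : ℝ) * (a + t + 1) = n.choose (a + t) * (n - (a + t)) := by
        rw [← Nat.cast_add, ← Nat.cast_sub (by omega)]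
        exact_mod_cast e
      have hcoef : ((n : ℝ) - (a + t)) ≤ (c - 2) / (c + 2) * (a + t + 1) := by
        rw [div_mul_eq_mul_div, le_div_iff₀ (by linarith)]
        have h1 : (n : ℝ) * (c + 2) ≤ 2 * c * a := by
          have : (n : ℝ) / 2 + n / c = n * (c + 2) / (2 * c) := by field_simp
          rw [this, div_le_iff₀ (by linarith)] at ha
          linarith
        have ht : (0 : ℝ) ≤ t := by positivity
        nlinarith
      have hstep : (n.choose (a + t + 1) : ℝ) ≤ (c - 2) / (c + 2) * n.choose (a + t) := by
        have hp : (0 : ℝ) < a + t + 1 := by positivity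
        refine le_of_mul_le_mul_right ?_ hp
        rw [e']
        have : (0 : ℝ) ≤ n.choose (a + t) := by positivity
        nlinarith [mul_le_mul_of_nonneg_left hcoef this]
      rw [← add_assoc, pow_succ']
      refine hstep.trans ?_
      rw [mul_assoc]
      gcongr

theorem choose_le_choose_of_half_le {a b : ℕ} (ha : n ≤ 2 * a) (hab : a ≤ b) :
    n.choose b ≤ n.choose a := by
  induction b, hab using Nat.le_induction with
  | base => exact le_rfl
  | succ b hab ih =>
    refine le_trans ?_ ih
    have e := Nat.choose_succ_right_eq n b
    refine Nat.le_of_mul_le_mul_right (c := b + 1) ?_ (by omega)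
    rw [e]
    exact Nat.mul_le_mul_left _ (by omega)

/-- Binomial coefficients far from the middle are negligible compared with those near it. -/
theorem choose_le_pow_mul_choose_of_far {c L : ℕ} (hc : 2 ≤ c) (hL : c * (L + 1) ≤ n) {s w : ℕ}
    (hsn : s ≤ n) (hwn : w ≤ n) (hs : |(s : ℝ) - n / 2| ≤ n / c)
    (hw' : 2 * (n / c : ℝ) < |(w : ℝ) - n / 2|) :
    (n.choose w : ℝ) ≤ (((c : ℝ) - 2) / (c + 2)) ^ L * n.choose s := by
  have reflect : ∀ v : ℕ, v ≤ n → ∃ v' ≤ n, n.choose v' = n.choose v ∧ n ≤ 2 * v' ∧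
      (v' : ℝ) - n / 2 = |(v : ℝ) - n / 2| := by
    intro v hv
    rcases le_total n (2 * v) with h | h
    · refine ⟨v, hv, rfl, h, ?_⟩
      have : (n : ℝ) ≤ 2 * v := by exact_mod_cast h
      rw [abs_of_nonneg (by linarith)]
    · refine ⟨n - v, Nat.sub_le _ _, Nat.choose_symm hv, by omega, ?_⟩
      have : (2 * v : ℝ) ≤ n := by exact_mod_cast h
      rw [abs_of_nonpos (by linarith), Nat.cast_sub hv]
      ring
  obtain ⟨s', hs'n, hs'c, hs'2, hs'⟩ := reflect s hsn
  obtain ⟨j, hjn, hjc, hj2, hj'⟩ := reflect w hwn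
  rw [← hs'] at hs
  rw [← hj'] at hw'
  have hc0 : (0 : ℝ) < c := by exact_mod_cast (by omega : 0 < c)
  have hLn : (L + 1 : ℝ) ≤ n / c := by
    rw [le_div_iff₀ hc0]
    have : ((c * (L + 1) : ℕ) : ℝ) ≤ n := by exact_mod_cast hL
    push_cast at this
    linarith
  set a := ⌈(n : ℝ) / 2 + n / c⌉₊ with ha
  have ha1 : (n : ℝ) / 2 + n / c ≤ a := Nat.le_ceil _
  have ha2 : (a : ℝ) < n / 2 + n / c + 1 := Nat.ceil_lt_add_one (by positivity)
  have hsa : s' ≤ a := by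
    have : (s' : ℝ) ≤ a := by linarith
    exact_mod_cast this
  have haj : a + L ≤ j := by
    have : ((a + L : ℕ) : ℝ) ≤ j := by push_cast; linarith
    exact_mod_cast this
  have hq1 : ((c : ℝ) - 2) / (c + 2) ≤ 1 := by
    rw [div_le_one (by linarith)]; linarith
  have hc2 : (2 : ℝ) ≤ c := by exact_mod_cast hc
  have hq0 : 0 ≤ ((c : ℝ) - 2) / (c + 2) := div_nonneg (by linarith) (by linarith)
  have h1 := choose_add_le_pow_mul (n := n) hc2 ha1 (j - a)
  rw [Nat.add_sub_cancel' (by omega)] at h1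
  rw [← hjc, ← hs'c]
  refine h1.trans ?_
  have h2 : n.choose a ≤ n.choose s' := choose_le_choose_of_half_le hs'2 hsa
  have h3 : (((c : ℝ) - 2) / (c + 2)) ^ (j - a) ≤ (((c : ℝ) - 2) / (c + 2)) ^ L :=
    pow_le_pow_of_le_one hq0 hq1 (by omega)
  gcongr

theorem exists_forall_mul_pow_le {c : ℕ} {q ε : ℝ} (hq0 : 0 ≤ q) (hq1 : q < 1)
    (hε : 0 < ε) : ∃ L₀ : ℕ, ∀ L ≥ L₀, (c * (L + 2) + 1 : ℝ) * q ^ L ≤ ε := by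
  have h1 := tendsto_self_mul_const_pow_of_lt_one hq0 hq1
  have h2 := tendsto_pow_atTop_nhds_zero_of_lt_one hq0 hq1
  have h3 := (h1.const_mul (c : ℝ)).add (h2.const_mul (2 * c + 1 : ℝ))
  simp only [mul_zero, add_zero] at h3
  obtain ⟨L₀, h⟩ := Filter.eventually_atTop.1 (h3.eventually (eventually_le_nhds hε))
  refine ⟨L₀, fun L hL => le_trans (le_of_eq ?_) (h L hL)⟩
  ring

end Slices

/-- The small marginals of `D_Ψ` are nearly uniform once `Ψ` contains a weight near `n / 2`. -/
theorem exists_marginal_DPsi_le (K : ℕ) : ∃ c n₀ : ℕ, 1 ≤ c ∧ ∀ n : ℕ, n₀ ≤ n → ∀ Ψ : Finset ℕ,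
    (∃ s ∈ Ψ, s ≤ n ∧ |(s : ℝ) - n / 2| ≤ n / c) →
    ∀ I : Finset (Fin n), I.card ≤ K → ∀ z : Fin n → Bool,
      (∑ y ∈ univ.filter (fun y : Fin n → Bool => ∀ i ∈ I, y i = z i), DPsi n Ψ y)
        * 2 ^ I.card ≤ 3 := by
  wlog hK : 1 ≤ K generalizing K
  · obtain ⟨c, n₀, hc, h⟩ := this 1 le_rfl
    exact ⟨c, n₀, hc, fun n hn Ψ hΨ I hI => h n hn Ψ hΨ I (by omega)⟩
  set c := 16 * K with hc
  have hc2 : (16 : ℝ) ≤ c := by exact_mod_cast (by omega : 16 ≤ c)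
  set q : ℝ := ((c : ℝ) - 2) / (c + 2) with hq
  have hq0 : 0 ≤ q := div_nonneg (by linarith) (by linarith)
  have hq1 : q < 1 := by rw [hq, div_lt_one (by linarith)]; linarith
  obtain ⟨L₀, hL₀⟩ := exists_forall_mul_pow_le (c := c) hq0 hq1
    (by positivity : (0 : ℝ) < (2 ^ K : ℝ)⁻¹)
  refine ⟨c, max (4 * K ^ 2 + 2 * K) (c * (L₀ + 1)), by omega, ?_⟩
  rintro n hn Ψ ⟨s, hsΨ, hsn, hs⟩ I hI z
  have hn1 : 4 * K ^ 2 + 2 * K ≤ n := (le_max_left _ _).trans hn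
  have hn2 : c * (L₀ + 1) ≤ n := (le_max_right _ _).trans hn
  obtain ⟨L, hLL, hL1, hL2⟩ : ∃ L, L₀ ≤ L ∧ c * (L + 1) ≤ n ∧ n ≤ c * (L + 2) := by
    have h1 : L₀ + 1 ≤ n / c := (Nat.le_div_iff_mul_le (by omega)).2 (by linarith)
    refine ⟨n / c - 1, by omega, ?_, ?_⟩
    · rw [Nat.sub_add_cancel (by omega)]
      exact Nat.mul_div_le n c
    · rw [show n / c - 1 + 2 = n / c + 1 by omega]
      exact (Nat.lt_mul_div_succ n (by omega)).le
  set N : ℕ := (univ.filter fun y : Fin n → Bool => hw y ∈ Ψ).card with hN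
  have hNs : n.choose s ≤ N := by
    rw [← card_hw_eq]
    refine card_le_card fun y hy => ?_
    simp only [mem_filter, mem_univ, true_and] at hy ⊢
    rwa [hy]
  have hN0 : (0 : ℝ) < N := by
    exact_mod_cast lt_of_lt_of_le (Nat.choose_pos hsn) hNs
  have hsum : ∑ y ∈ univ.filter (fun y : Fin n → Bool => ∀ i ∈ I, y i = z i), DPsi n Ψ y
      = ((univ.filter fun y : Fin n → Bool => hw y ∈ Ψ ∧ ∀ i ∈ I, y i = z i).card : ℝ) / N := by
    simp only [DPsi, unifOn]
    rw [← sum_filter, sum_const, nsmul_eq_mul, filter_filter, div_eq_mul_inv]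
    congr 3
    ext y
    simp
    tauto
  rw [hsum, div_mul_eq_mul_div, div_le_iff₀ hN0]
  have hdecomp : ∀ p : (Fin n → Bool) → Prop, ∀ [DecidablePred p],
      (univ.filter fun y : Fin n → Bool => hw y ∈ Ψ ∧ p y).card
        = ∑ w ∈ Ψ ∩ range (n + 1), (univ.filter fun y : Fin n → Bool => hw y = w ∧ p y).card := by
    intro p _
    rw [card_eq_sum_card_fiberwise (f := hw) (t := Ψ ∩ range (n + 1))]
    · refine sum_congr rfl fun w hw' => ?_
      congr 1
      ext y
      simp only [mem_filter, mem_univ, true_and, mem_inter] at hw' ⊢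
      constructor
      · rintro ⟨⟨_, h⟩, rfl⟩; exact ⟨rfl, h⟩
      · rintro ⟨rfl, h⟩; exact ⟨⟨hw'.1, h⟩, rfl⟩
    · intro y hy
      simp only [SetLike.mem_coe, mem_filter, mem_univ, true_and, mem_inter, mem_range] at hy ⊢
      exact ⟨hy.1, Nat.lt_succ_of_le (hw_le y)⟩
  have hpow2 : (1 + 1 / (2 * K) : ℝ) ^ I.card ≤ 2 := by
    have hK' : (1 : ℝ) ≤ K := by exact_mod_cast hK
    have h1 : (1 + 1 / (2 * K) : ℝ) ^ I.card ≤ (1 + 1 / (2 * K)) ^ K :=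
      pow_le_pow_right₀ (by simp) hI
    have h2 : (1 + 1 / (2 * K) : ℝ) ^ K ≤ Real.exp (1 / 2) := by
      have h3 : (1 + 1 / (2 * K) : ℝ) ≤ Real.exp (1 / (2 * K)) := by
        linarith [Real.add_one_le_exp (1 / (2 * K) : ℝ)]
      calc (1 + 1 / (2 * K) : ℝ) ^ K ≤ Real.exp (1 / (2 * K)) ^ K := by gcongr
        _ = Real.exp (1 / 2) := by
          rw [← Real.exp_nat_mul]; congr 1; field_simp
    have h4 : Real.exp (1 / 2) ^ 2 ≤ 2 ^ 2 := by
      rw [← Real.exp_nat_mul]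
      norm_num
      linarith [Real.exp_one_lt_d9]
    have h5 : Real.exp (1 / 2) ≤ 2 := by
      nlinarith [Real.exp_pos (1 / 2)]
    linarith
  have hterm : ∀ w ∈ Ψ ∩ range (n + 1),
      ((univ.filter fun y : Fin n → Bool => hw y = w ∧ ∀ i ∈ I, y i = z i).card : ℝ)
        * 2 ^ I.card
      ≤ 2 * (univ.filter fun y : Fin n → Bool => hw y = w).card
        + 2 ^ K * (q ^ L * n.choose s) := by
    intro w hwΨ
    have hwn : w ≤ n := by
      have := (mem_inter.1 hwΨ).2
      rw [mem_range] at this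
      omega
    rcases le_or_gt |(w : ℝ) - n / 2| (2 * (n / c)) with h | h
    · rw [abs_le] at h
      have hcK : (c : ℝ) = 16 * K := by rw [hc]; push_cast; ring
      rw [hcK] at h
      refine (card_slice_fix_le hK hn1 hwn (by linarith) (by linarith) I hI z).trans ?_
      have : (0 : ℝ) ≤ 2 ^ K * (q ^ L * n.choose s) := by positivity
      refine le_trans ?_ (le_add_of_nonneg_right this)
      gcongr
    · have h1 := choose_le_pow_mul_choose_of_far (by omega) hL1 hsn hwn hs h
      have h2 : ((univ.filter fun y : Fin n → Bool => hw y = w ∧ ∀ i ∈ I, y i = z i).card : ℝ)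
          ≤ n.choose w := by
        rw [← card_hw_eq]
        norm_cast
        refine card_le_card fun y hy => ?_
        simp only [mem_filter, mem_univ, true_and] at hy ⊢
        exact hy.1
      have h3 : ((univ.filter fun y : Fin n → Bool => hw y = w ∧ ∀ i ∈ I, y i = z i).card : ℝ)
          * 2 ^ I.card ≤ (q ^ L * n.choose s) * 2 ^ K := by
        refine mul_le_mul (h2.trans h1) (pow_le_pow_right₀ (by norm_num) hI) (by positivity)
          (by positivity)
      have h4 : (0 : ℝ) ≤ 2 * (univ.filter fun y : Fin n → Bool => hw y = w).card := by
        positivity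
      linarith
  have hN' : (N : ℝ) = ∑ w ∈ Ψ ∩ range (n + 1),
      ((univ.filter fun y : Fin n → Bool => hw y = w).card : ℝ) := by
    have := hdecomp fun _ => True
    simp only [and_true] at this
    rw [hN, this]
    push_cast
    rfl
  rw [hdecomp fun y => ∀ i ∈ I, y i = z i]
  push_cast
  rw [sum_mul]
  refine (sum_le_sum hterm).trans ?_
  rw [sum_add_distrib, ← mul_sum, ← hN', sum_const, nsmul_eq_mul]
  have hcard : ((Ψ ∩ range (n + 1)).card : ℝ) ≤ c * (L + 2) + 1 := by
    have h1 : (Ψ ∩ range (n + 1)).card ≤ n + 1 := by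
      simpa using card_le_card (inter_subset_right : Ψ ∩ range (n + 1) ⊆ range (n + 1))
    exact_mod_cast h1.trans (by omega)
  have hfar : ((Ψ ∩ range (n + 1)).card : ℝ) * (2 ^ K * (q ^ L * n.choose s)) ≤ N := by
    calc _ ≤ (c * (L + 2) + 1 : ℝ) * (2 ^ K * (q ^ L * N)) := by
          gcongr
      _ = (c * (L + 2) + 1 : ℝ) * q ^ L * 2 ^ K * N := by ring
      _ ≤ (2 ^ K : ℝ)⁻¹ * 2 ^ K * N := by
          gcongr
          exact hL₀ L hLL
      _ = N := by field_simp
  linarith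

section Tree

variable {m : ℕ}

/-- A state satisfying `G` can be reached from `ρ` by fixing at most `t` further coordinates. -/
def Reaches (G : (Fin m → Option Bool) → Prop) : ℕ → (Fin m → Option Bool) → Prop
  | 0, ρ => G ρ
  | t + 1, ρ => G ρ ∨ ∃ j b, ρ j = none ∧ Reaches G t (Function.update ρ j (some b))

open Classical in
/-- The cube of `ρ` splits into at most `N` subcubes such that those outside `G` have relative
mass at most `β`. -/
def HasPartition (G : (Fin m → Option Bool) → Prop) (N : ℕ) (β : ℝ)
    (ρ : Fin m → Option Bool) : Prop :=
  ∃ P : Finset (Fin m → Option Bool), (∀ ρ' ∈ P, cube ρ' ⊆ cube ρ) ∧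
    (∀ x ∈ cube ρ, ∃! ρ', ρ' ∈ P ∧ x ∈ cube ρ') ∧ P.card ≤ N ∧
    ∑ ρ' ∈ P.filter (fun ρ' => ¬ G ρ'), ((cube ρ').card : ℝ) ≤ β * (cube ρ).card

variable {G : (Fin m → Option Bool) → Prop}

theorem HasPartition.mono {N N' : ℕ} {β β' : ℝ} {ρ : Fin m → Option Bool}
    (h : HasPartition G N β ρ) (hN : N ≤ N') (hβ : β ≤ β') : HasPartition G N' β' ρ := by
  obtain ⟨P, h1, h2, h3, h4⟩ := h
  exact ⟨P, h1, h2, h3.trans hN, h4.trans (by gcongr)⟩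

theorem hasPartition_one (ρ : Fin m → Option Bool) : HasPartition G 1 1 ρ := by
  classical
  refine ⟨{ρ}, by simp, fun x hx => ⟨ρ, by simp [hx], by simp⟩, by simp, ?_⟩
  rw [one_mul]
  refine (sum_le_sum_of_subset_of_nonneg (filter_subset _ _) ?_).trans (by simp)
  intros; positivity

theorem hasPartition_of_mem {ρ : Fin m → Option Bool} (h : G ρ) : HasPartition G 1 0 ρ := by
  classical
  refine ⟨{ρ}, by simp, fun x hx => ⟨ρ, by simp [hx], by simp⟩, by simp, ?_⟩
  rw [filter_singleton]
  simp [h]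

theorem HasPartition.glue {ρ : Fin m → Option Bool} {j : Fin m} (hj : ρ j = none) (b : Bool)
    {N₁ N₂ : ℕ} {β₁ β₂ : ℝ} (h₁ : HasPartition G N₁ β₁ (Function.update ρ j (some b)))
    (h₂ : HasPartition G N₂ β₂ (Function.update ρ j (some (!b)))) :
    HasPartition G (N₁ + N₂) ((β₁ + β₂) / 2) ρ := by
  classical
  obtain ⟨P, hP1, hP2, hP3, hP4⟩ := h₁
  obtain ⟨Q, hQ1, hQ2, hQ3, hQ4⟩ := h₂
  have hP : ∀ σ ∈ P, ∀ x ∈ cube σ, x ∈ cube ρ ∧ x j = b := fun σ hσ x hx =>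
    (mem_cube_update hj b).1 (hP1 σ hσ hx)
  have hQ : ∀ σ ∈ Q, ∀ x ∈ cube σ, x ∈ cube ρ ∧ x j = !b := fun σ hσ x hx =>
    (mem_cube_update hj _).1 (hQ1 σ hσ hx)
  refine ⟨P ∪ Q, ?_, ?_, (card_union_le _ _).trans (by omega), ?_⟩
  · intro σ hσ x hx
    rcases mem_union.1 hσ with h | h
    · exact (hP σ h x hx).1
    · exact (hQ σ h x hx).1
  · intro x hx
    by_cases hb : x j = b
    · obtain ⟨σ, ⟨hσ, hxσ⟩, hu⟩ := hP2 x ((mem_cube_update hj b).2 ⟨hx, hb⟩)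
      refine ⟨σ, ⟨mem_union_left _ hσ, hxσ⟩, ?_⟩
      rintro τ ⟨hτ, hxτ⟩
      rcases mem_union.1 hτ with h | h
      · exact hu τ ⟨h, hxτ⟩
      · have := (hQ τ h x hxτ).2
        rw [hb] at this
        simp at this
    · have hb' : x j = !b := by cases b <;> simpa using hb
      obtain ⟨σ, ⟨hσ, hxσ⟩, hu⟩ := hQ2 x ((mem_cube_update hj _).2 ⟨hx, hb'⟩)
      refine ⟨σ, ⟨mem_union_right _ hσ, hxσ⟩, ?_⟩
      rintro τ ⟨hτ, hxτ⟩
      rcases mem_union.1 hτ with h | h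
      · exact absurd (hP τ h x hxτ).2 hb
      · exact hu τ ⟨h, hxτ⟩
  · have h1 : ((cube (Function.update ρ j (some b))).card : ℝ) * 2 = (cube ρ).card := by
      exact_mod_cast card_cube_update hj b
    have h2 : ((cube (Function.update ρ j (some (!b)))).card : ℝ) * 2 = (cube ρ).card := by
      exact_mod_cast card_cube_update hj (!b)
    rw [filter_union]
    have h3 := sum_union_inter (s₁ := P.filter fun ρ' => ¬ G ρ')
      (s₂ := Q.filter fun ρ' => ¬ G ρ') (f := fun ρ' => ((cube ρ').card : ℝ))
    have h4 : (0 : ℝ) ≤ ∑ ρ' ∈ P.filter (fun ρ' => ¬ G ρ') ∩ Q.filter (fun ρ' => ¬ G ρ'),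
        ((cube ρ').card : ℝ) := by positivity
    have h5 : ((cube (Function.update ρ j (some b))).card : ℝ) = (cube ρ).card / 2 := by linarith
    have h6 : ((cube (Function.update ρ j (some (!b)))).card : ℝ) = (cube ρ).card / 2 := by
      linarith
    rw [h5] at hP4
    rw [h6] at hQ4
    linarith

theorem hasPartition_of_reaches {B : ℕ} {γ : ℝ} (hB : 1 ≤ B) (hγ : 0 ≤ γ)
    (hall : ∀ ρ, HasPartition G B γ ρ) (t : ℕ) (ρ : Fin m → Option Bool) (h : Reaches G t ρ) :
    HasPartition G ((t + 1) * B) ((1 - (1 / 2) ^ t) * γ) ρ := by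
  have hpow : ∀ t : ℕ, 0 ≤ (1 - (1 / 2 : ℝ) ^ t) * γ := fun t =>
    mul_nonneg (sub_nonneg.2 (pow_le_one₀ (by norm_num) (by norm_num))) hγ
  induction t generalizing ρ with
  | zero => exact (hasPartition_of_mem h).mono (by omega) (hpow 0)
  | succ t ih =>
    rcases h with h | ⟨j, b, hj, h⟩
    · exact (hasPartition_of_mem h).mono (by nlinarith) (hpow _)
    · refine ((ih _ h).glue hj b (hall _)).mono (le_of_eq (by ring)) (le_of_eq ?_)
      rw [pow_succ]
      ring

theorem hasPartition_of_forall_reaches {t : ℕ} (h : ∀ ρ, G ρ ∨ Reaches G t ρ) (M : ℕ)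
    (ρ : Fin m → Option Bool) : HasPartition G ((t + 1) ^ M) ((1 - (1 / 2) ^ t) ^ M) ρ := by
  have hpow : 0 ≤ (1 - (1 / 2 : ℝ) ^ t) := sub_nonneg.2 (pow_le_one₀ (by norm_num) (by norm_num))
  induction M generalizing ρ with
  | zero => simpa using hasPartition_one ρ
  | succ M ih =>
    have hB : 1 ≤ (t + 1) ^ M := Nat.one_le_pow _ _ (by omega)
    rcases h ρ with h | h
    · exact (hasPartition_of_mem h).mono (Nat.one_le_pow _ _ (by omega)) (pow_nonneg hpow _)
    · rw [pow_succ', pow_succ']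
      exact hasPartition_of_reaches hB (pow_nonneg hpow _) ih t ρ h

theorem Reaches.mono {G G' : (Fin m → Option Bool) → Prop} (hG : ∀ ρ, G ρ → G' ρ) {t : ℕ}
    {ρ : Fin m → Option Bool} (h : Reaches G t ρ) : Reaches G' t ρ := by
  induction t generalizing ρ with
  | zero => exact hG _ h
  | succ t ih =>
    rcases h with h | ⟨j, b, hj, h⟩
    · exact Or.inl (hG _ h)
    · exact Or.inr ⟨j, b, hj, ih h⟩

end Tree

/-- Every sufficiently large family contains a large subfamily with pairwise disjoint images, or
the members of a large subfamily share a point. -/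
theorem exists_pairwise_disjoint_or_common {α β : Type} [DecidableEq α] [DecidableEq β]
    (F : Finset α) (g : α → Finset β) {r t R : ℕ} (hg : ∀ A ∈ F, (g A).card ≤ t)
    (hF : r + r * t * R < F.card) :
    (∃ H ⊆ F, r ≤ H.card ∧ ∀ A ∈ H, ∀ B ∈ H, A ≠ B → Disjoint (g A) (g B)) ∨
    ∃ j, R < (F.filter fun A => j ∈ g A).card := by
  classical
  set 𝒞 := F.powerset.filter fun H => ∀ A ∈ H, ∀ B ∈ H, A ≠ B → Disjoint (g A) (g B) with h𝒞
  obtain ⟨H, hH, hmax⟩ := exists_max_image 𝒞 card ⟨∅, by simp [h𝒞]⟩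
  simp only [h𝒞, mem_filter, mem_powerset] at hH hmax
  rcases le_or_gt r H.card with hr | hr
  · exact Or.inl ⟨H, hH.1, hr, hH.2⟩
  right
  have hex : ∀ A ∈ F \ H, ∃ j ∈ H.biUnion g, j ∈ g A := by
    intro A hA
    rw [mem_sdiff] at hA
    by_contra! hcon
    have hdisj : ∀ B ∈ H, Disjoint (g A) (g B) := fun B hB =>
      disjoint_left.2 fun j hjA hjB => hcon j (mem_biUnion.2 ⟨B, hB, hjB⟩) hjA
    have := hmax (insert A H) ⟨insert_subset hA.1 hH.1, ?_⟩
    · rw [card_insert_of_notMem hA.2] at this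
      omega
    · intro B hB C hC hBC
      rcases mem_insert.1 hB with rfl | hB' <;> rcases mem_insert.1 hC with rfl | hC'
      · exact absurd rfl hBC
      · exact hdisj C hC'
      · exact (hdisj B hB').symm
      · exact hH.2 B hB' C hC' hBC
  have hQ : (H.biUnion g).card ≤ r * t :=
    (card_biUnion_le_card_mul H g t fun A hA => hg A (hH.1 hA)).trans
      (Nat.mul_le_mul_right _ hr.le)
  have hlt : (H.biUnion g).card * R < (F \ H).card := by
    have h1 := le_card_sdiff H F
    have h2 := Nat.mul_le_mul_right R hQ
    omega
  obtain ⟨A₀, hA₀⟩ := card_pos.1 (Nat.zero_lt_of_lt hlt)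
  obtain ⟨j₀, -, -⟩ := hex A₀ hA₀
  have : Nonempty β := ⟨j₀⟩
  choose! φ hφ1 hφ2 using hex
  obtain ⟨j, _, hj⟩ := exists_lt_card_fiber_of_mul_lt_card_of_maps_to hφ1 hlt
  refine ⟨j, hj.trans_le (card_le_card fun A hA => ?_)⟩
  rw [mem_filter] at hA ⊢
  exact ⟨(mem_sdiff.1 hA.1).1, hA.2 ▸ hφ2 A hA.1⟩

/-- The family size that forces a path to `r` independent members, at locality `t`. -/
def familyBound (r : ℕ) : ℕ → ℕ
  | 0 => r
  | t + 1 => r + r * (t + 1) * (2 * familyBound r t) + 1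

section Family

variable {m n : ℕ} {f : (Fin m → Bool) → (Fin n → Bool)} {nb : Fin n → Finset (Fin m)}

/-- The marginal of `f` on `I` is not uniform. -/
def NonUniform (f : (Fin m → Bool) → (Fin n → Bool)) (ρ : Fin m → Option Bool)
    (I : Finset (Fin n)) : Prop :=
  ∃ z, marg f ρ I z * 2 ^ I.card ≠ 1

theorem NonUniform.exists_update {ρ : Fin m → Option Bool} {I : Finset (Fin n)}
    (h : NonUniform f ρ I) {j : Fin m} (hj : ρ j = none) :
    ∃ b, NonUniform f (Function.update ρ j (some b)) I := by
  obtain ⟨z, hz⟩ := h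
  by_contra! hcon
  simp only [NonUniform, not_exists, not_not] at hcon
  refine hz ?_
  have key : marg f ρ I z = (marg f (Function.update ρ j (some true)) I z
      + marg f (Function.update ρ j (some false)) I z) / 2 := by
    have h1 : ((cube (Function.update ρ j (some true))).card : ℝ) * 2 = (cube ρ).card := by
      exact_mod_cast card_cube_update hj true
    have h2 : ((cube (Function.update ρ j (some false))).card : ℝ) * 2 = (cube ρ).card := by
      exact_mod_cast card_cube_update hj false
    have hc := (card_cube_pos ρ).ne'
    unfold marg
    rw [card_filter_cube_split hj true,
      (by linarith : ((cube (Function.update ρ j (some true))).card : ℝ) = (cube ρ).card / 2),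
      Bool.not_true,
      (by linarith : ((cube (Function.update ρ j (some false))).card : ℝ) = (cube ρ).card / 2)]
    push_cast
    field_simp
  rw [key, div_mul_eq_mul_div, add_mul, hcon true z, hcon false z]
  norm_num

theorem freeNbhd_update_ssubset {ρ : Fin m → Option Bool} {I : Finset (Fin n)} {j : Fin m}
    (hj : j ∈ freeNbhd nb ρ I) (b : Bool) :
    freeNbhd nb (Function.update ρ j (some b)) I ⊂ freeNbhd nb ρ I := by
  refine (ssubset_iff_of_subset ?_).2 ⟨j, hj, by simp [freeNbhd]⟩
  intro i hi
  simp only [freeNbhd, mem_filter] at hi ⊢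
  refine ⟨hi.1, ?_⟩
  by_cases h : i = j
  · simp [h] at hi
  · simpa [h] using hi.2

/-- `r` independent non-uniform marginals of size at most `k` and locality at most `h`. -/
def HasIndependentFamily (f : (Fin m → Bool) → (Fin n → Bool)) (nb : Fin n → Finset (Fin m))
    (r k h : ℕ) (ρ : Fin m → Option Bool) : Prop :=
  ∃ F : Finset (Finset (Fin n)), F.card = r ∧
    (∀ A ∈ F, A.card ≤ k ∧ (freeNbhd nb ρ A).card ≤ h ∧ NonUniform f ρ A) ∧
    (∀ A ∈ F, ∀ B ∈ F, A ≠ B → Disjoint A B) ∧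
    (∀ A ∈ F, ∀ B ∈ F, A ≠ B → Disjoint (freeNbhd nb ρ A) (freeNbhd nb ρ B))

theorem reaches_hasIndependentFamily {r k h t : ℕ} (hth : t ≤ h) {ρ : Fin m → Option Bool}
    {F : Finset (Finset (Fin n))} (hF : familyBound r t ≤ F.card)
    (hFp : ∀ A ∈ F, A.card ≤ k ∧ (freeNbhd nb ρ A).card ≤ t ∧ NonUniform f ρ A)
    (hFd : ∀ A ∈ F, ∀ B ∈ F, A ≠ B → Disjoint A B) :
    Reaches (HasIndependentFamily f nb r k h) t ρ := by
  classical
  have found : ∀ t ≤ h, ∀ (ρ : Fin m → Option Bool) (F H : Finset (Finset (Fin n))),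
      (∀ A ∈ F, A.card ≤ k ∧ (freeNbhd nb ρ A).card ≤ t ∧ NonUniform f ρ A) →
      (∀ A ∈ F, ∀ B ∈ F, A ≠ B → Disjoint A B) → H ⊆ F → r ≤ H.card →
      (∀ A ∈ H, ∀ B ∈ H, A ≠ B → Disjoint (freeNbhd nb ρ A) (freeNbhd nb ρ B)) →
      HasIndependentFamily f nb r k h ρ := by
    intro t hth ρ F H hFp hFd hHF hr hH
    obtain ⟨H', hH', hc⟩ := exists_subset_card_eq hr
    refine ⟨H', hc, fun A hA => ?_, fun A hA B hB => ?_, fun A hA B hB => ?_⟩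
    · have := hFp A (hHF (hH' hA))
      exact ⟨this.1, this.2.1.trans hth, this.2.2⟩
    · exact hFd A (hHF (hH' hA)) B (hHF (hH' hB))
    · exact hH A (hH' hA) B (hH' hB)
  induction t generalizing ρ F with
  | zero =>
    refine found 0 hth ρ F F hFp hFd subset_rfl hF fun A hA B _ _ => ?_
    rw [card_eq_zero.1 (Nat.le_zero.1 (hFp A hA).2.1)]
    exact disjoint_empty_left _
  | succ t ih =>
    rcases exists_pairwise_disjoint_or_common F (freeNbhd nb ρ) (r := r) (t := t + 1)
      (R := 2 * familyBound r t) (fun A hA => (hFp A hA).2.1)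
      (by rw [familyBound] at hF; omega) with ⟨H, hHF, hr, hH⟩ | ⟨j, hj⟩
    · exact Or.inl (found (t + 1) hth ρ F H hFp hFd hHF hr hH)
    · right
      set E := F.filter fun A => j ∈ freeNbhd nb ρ A with hE
      have hρj : ρ j = none := by
        obtain ⟨A, hA⟩ := card_pos.1 (by omega : 0 < E.card)
        exact (mem_filter.1 (mem_filter.1 hA).2).2
      set E' : Bool → Finset (Finset (Fin n)) := fun b =>
        E.filter fun A => NonUniform f (Function.update ρ j (some b)) A with hE'
      have hcover : E ⊆ E' true ∪ E' false := by
        intro A hA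
        obtain ⟨b, hb⟩ := (hFp A (mem_filter.1 hA).1).2.2.exists_update hρj
        cases b
        · exact mem_union_right _ (mem_filter.2 ⟨hA, hb⟩)
        · exact mem_union_left _ (mem_filter.2 ⟨hA, hb⟩)
      have hcard := (card_le_card hcover).trans (card_union_le _ _)
      obtain ⟨b, hb⟩ : ∃ b, familyBound r t ≤ (E' b).card := by
        by_contra! hcon
        have h1 := hcon true
        have h2 := hcon false
        omega
      refine ⟨j, b, hρj, ih (by omega) hb (fun A hA => ?_) fun A hA B hB => ?_⟩
      · have hA1 := mem_filter.1 hA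
        have hA2 := mem_filter.1 hA1.1
        have h1 := hFp A hA2.1
        have h2 := card_lt_card (freeNbhd_update_ssubset hA2.2 b)
        exact ⟨h1.1, by omega, hA1.2⟩
      · exact hFd A (mem_filter.1 (mem_filter.1 hA).1).1 B (mem_filter.1 (mem_filter.1 hB).1).1

theorem kWiseOn_of_forall_not_nonUniform {k : ℕ} {ρ : Fin m → Option Bool} {S : Finset (Fin n)}
    (h : ∀ I ⊆ S, I.card ≤ k → ¬ NonUniform f ρ I) :
    KWiseOn k (pushf f (unifOn (cube ρ))) S := by
  intro I hI hk z
  have h1 := h I hI hk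
  simp only [NonUniform, not_exists, not_not] at h1
  rw [sum_pushf_unifOn f (cube ρ) (fun y => ∀ i ∈ I, y i = z i), 
    ← one_div, eq_div_iff (by positivity)]
  exact h1 z

theorem not_nonUniform_empty (ρ : Fin m → Option Bool) : ¬ NonUniform f ρ ∅ := by
  have := (card_cube_pos ρ).ne'
  simp [NonUniform, marg, this]

/-- Either `f` is `k`-wise independent off a small set, or it has many disjoint non-uniform
marginals. -/
theorem exists_kWiseOn_or_family (f : (Fin m → Bool) → (Fin n → Bool)) (ρ : Fin m → Option Bool)
    (k R : ℕ) :
    (∃ S : Finset (Fin n), S.card ≤ R * k ∧ KWiseOn k (pushf f (unifOn (cube ρ))) Sᶜ) ∨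
    ∃ F : Finset (Finset (Fin n)), R ≤ F.card ∧ (∀ A ∈ F, A.card ≤ k ∧ NonUniform f ρ A) ∧
      ∀ A ∈ F, ∀ B ∈ F, A ≠ B → Disjoint A B := by
  classical
  set 𝒞 := (univ : Finset (Finset (Finset (Fin n)))).filter fun F =>
    (∀ A ∈ F, A.card ≤ k ∧ NonUniform f ρ A) ∧ ∀ A ∈ F, ∀ B ∈ F, A ≠ B → Disjoint A B with h𝒞
  obtain ⟨F, hF, hmax⟩ := exists_max_image 𝒞 card ⟨∅, by simp [h𝒞]⟩
  simp only [h𝒞, mem_filter, mem_univ, true_and] at hF hmax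
  rcases le_or_gt R F.card with hR | hR
  · exact Or.inr ⟨F, hR, hF⟩
  left
  refine ⟨F.biUnion id, (card_biUnion_le_card_mul F id k fun A hA => (hF.1 A hA).1).trans
    (Nat.mul_le_mul_right _ hR.le), kWiseOn_of_forall_not_nonUniform fun I hI hk hnu => ?_⟩
  have hdisj : ∀ A ∈ F, Disjoint I A := fun A hA =>
    disjoint_left.2 fun i hi hiA => (mem_compl.1 (hI hi)) (mem_biUnion.2 ⟨A, hA, hiA⟩)
  have hIF : I ∉ F := fun h => by
    have h0 := disjoint_self.1 (hdisj I h)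
    rw [bot_eq_empty] at h0
    exact not_nonUniform_empty ρ (h0 ▸ hnu)
  have := hmax (insert I F) ⟨?_, ?_⟩
  · rw [card_insert_of_notMem hIF] at this
    omega
  · intro A hA
    rcases mem_insert.1 hA with rfl | hA
    · exact ⟨hk, hnu⟩
    · exact hF.1 A hA
  · intro B hB C hC hBC
    rcases mem_insert.1 hB with rfl | hB' <;> rcases mem_insert.1 hC with rfl | hC'
    · exact absurd rfl hBC
    · exact hdisj C hC'
    · exact (hdisj B hB').symm
    · exact hF.2 B hB' C hC' hBC

end Family

/-- The overlap of a union of sets with a distribution is at most the sum of the overlaps. -/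
theorem sum_min_pushf_biUnion_le {α β ι : Type} [Fintype α] [DecidableEq α] [Fintype β]
    [DecidableEq β] (f : α → β) (P : Finset ι) (C : ι → Finset α) {D : β → ℝ}
    (hD : ∀ y, 0 ≤ D y) :
    ∑ y, min (pushf f (unifOn (P.biUnion C)) y) (D y)
      ≤ ∑ i ∈ P, ∑ y, min (pushf f (unifOn (C i)) y) (D y) := by
  rw [sum_comm]
  refine sum_le_sum fun y _ => ?_
  have h1 : pushf f (unifOn (P.biUnion C)) y ≤ ∑ i ∈ P, pushf f (unifOn (C i)) y := by
    simp only [pushf_unifOn_apply]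
    rw [filter_biUnion]
    calc _ ≤ (∑ i ∈ P, (((C i).filter fun x => f x = y).card : ℝ)) / (P.biUnion C).card := by
          gcongr
          exact_mod_cast card_biUnion_le
      _ = ∑ i ∈ P, (((C i).filter fun x => f x = y).card : ℝ) / (P.biUnion C).card :=
          sum_div _ _ _
      _ ≤ _ := by
          refine sum_le_sum fun i hi => ?_
          rcases (C i).eq_empty_or_nonempty with h | h
          · simp [h]
          · have hpos : (0 : ℝ) < (C i).card := by exact_mod_cast h.card_pos
            have hle : ((C i).card : ℝ) ≤ (P.biUnion C).card := by
              exact_mod_cast card_le_card (subset_biUnion_of_mem C hi)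
            gcongr
  have h0 : ∀ i ∈ P, 0 ≤ pushf f (unifOn (C i)) y := fun i _ => by
    rw [pushf_unifOn_apply]; positivity
  by_cases hex : ∃ i ∈ P, D y ≤ pushf f (unifOn (C i)) y
  · obtain ⟨i, hi, hle⟩ := hex
    calc _ ≤ D y := min_le_right _ _
      _ = min (pushf f (unifOn (C i)) y) (D y) := (min_eq_right hle).symm
      _ ≤ _ := single_le_sum (f := fun i => min (pushf f (unifOn (C i)) y) (D y))
          (fun i hi => le_min (h0 i hi) (hD y)) hi
  · push Not at hex
    refine (min_le_left _ _).trans (h1.trans (le_of_eq (sum_congr rfl fun i hi => ?_)))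
    rw [min_eq_left (hex i hi).le]

theorem sum_pushf_unifOn_eq_one {α β : Type} [Fintype α] [DecidableEq α] [Fintype β]
    [DecidableEq β] (f : α → β) {C : Finset α} (hC : C.Nonempty) :
    ∑ y, pushf f (unifOn C) y = 1 := by
  have h := sum_pushf_unifOn f C fun _ => True
  have hpos : (C.card : ℝ) ≠ 0 := by exact_mod_cast hC.card_pos.ne'
  simpa [hpos] using h

theorem sum_DPsi_eq_one {n : ℕ} {Ψ : Finset ℕ} {s : ℕ} (hs : s ∈ Ψ) (hsn : s ≤ n) :
    ∑ y, DPsi n Ψ y = 1 := by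
  have hne : (univ.filter fun x : Fin n → Bool => hw x ∈ Ψ).Nonempty := by
    obtain ⟨x, hx⟩ := card_pos.1 ((card_hw_eq (n := n) s).symm ▸ Nat.choose_pos hsn)
    exact ⟨x, by simpa [(mem_filter.1 hx).2] using hs⟩
  have hpos : ((univ.filter fun x : Fin n → Bool => hw x ∈ Ψ).card : ℝ) ≠ 0 := by
    exact_mod_cast hne.card_pos.ne'
  simp only [DPsi, unifOn]
  rw [sum_ite_mem, univ_inter, sum_const, nsmul_eq_mul, mul_inv_cancel₀ hpos]

theorem DPsi_nonneg {n : ℕ} (Ψ : Finset ℕ) (y : Fin n → Bool) : 0 ≤ DPsi n Ψ y := by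
  unfold DPsi unifOn
  split_ifs <;> positivity

/-- Tree lemma: a partition of the input space into subcubes of three types. -/
theorem stmt5 :
    ∀ d k : ℕ, 1 ≤ d → 1 ≤ k → ∀ δ κ : ℝ, 0 < δ → δ ≤ 1 → 0 < κ → κ ≤ 1 →
    ∃ c₀ : ℝ, ∃ T : ℕ, ∀ c : ℝ, c₀ ≤ c → ∀ n m : ℕ,
    ∀ f : (Fin m → Bool) → (Fin n → Bool), IsLocal d f →
    ∀ Ψ : Finset ℕ, Ψ ⊆ Finset.range (n + 1) →
    (∃ s ∈ Ψ, |(s : ℝ) - n / 2| ≤ n / c) →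
    ∃ P : Finset (Fin m → Option Bool), ∃ L : (Fin m → Option Bool) → Fin 3,
      -- the subcubes indexed by `P` partition `{0,1}^m`
      (∀ x : Fin m → Bool, ∃! ρ : Fin m → Option Bool, ρ ∈ P ∧ x ∈ cube ρ) ∧
      -- Type-I subcubes: `k`-wise independent outside at most `T` coordinates
      (∀ ρ ∈ P, L ρ = 0 → ∃ S : Finset (Fin n), S.card ≤ T ∧
        KWiseOn k (pushf f (unifOn (cube ρ))) Sᶜ) ∧
      -- Type-II subcubes: their union is far from `D_Ψ`
      ((P.filter fun ρ => L ρ = 1).biUnion cube |>.Nonempty →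
        tvd (pushf f (unifOn ((P.filter fun ρ => L ρ = 1).biUnion cube))) (DPsi n Ψ) > 1 - κ) ∧
      -- Type-III subcubes: total mass at most `δ`
      ((∑ ρ ∈ P.filter fun ρ => L ρ = 2, ((cube ρ).card : ℝ)) / 2 ^ m ≤ δ) := by
  classical
  intro d k _ _ δ κ hδ _ hκ _
  set t := k * d with ht
  obtain ⟨M, hM⟩ := exists_pow_lt_of_lt_one hδ
    (sub_lt_self 1 (by positivity : (0 : ℝ) < (1 / 2) ^ t))
  set N := (t + 1) ^ M with hN
  have hN0 : (0 : ℝ) < N := by positivity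
  set b : ℝ := 1 - (4 * (2 ^ k + 1) * 2 ^ k * 4 ^ t : ℝ)⁻¹ with hb
  have hb1 : b < 1 := sub_lt_self 1 (by positivity)
  have hb0 : 0 ≤ b := by
    refine sub_nonneg.2 (inv_le_one_of_one_le₀ ?_)
    have h1 : (1 : ℝ) ≤ 2 ^ k := one_le_pow₀ (by norm_num)
    have h2 : (1 : ℝ) ≤ 4 ^ t := one_le_pow₀ (by norm_num)
    have h3 : (1 : ℝ) ≤ 4 * (2 ^ k + 1) := by linarith
    exact one_le_mul_of_one_le_of_one_le (one_le_mul_of_one_le_of_one_le h3 h1) h2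
  obtain ⟨r, hr⟩ := exists_pow_lt_of_lt_one (by positivity : (0 : ℝ) < κ / (3 * N)) hb1
  obtain ⟨c₁, n₀, hc₁, hslice⟩ := exists_marginal_DPsi_le (r * k)
  refine ⟨c₁, max n₀ (familyBound r t * k), ?_⟩
  rintro c hc n m f hf Ψ hΨ ⟨s, hsΨ, hs⟩
  choose nb hnb hfnb using hf
  have hsn : s ≤ n := Nat.lt_succ_iff.1 (mem_range.1 (hΨ hsΨ))
  have hc₁' : (1 : ℝ) ≤ c₁ := by exact_mod_cast hc₁
  have hs' : |(s : ℝ) - n / 2| ≤ n / c₁ := hs.trans (by gcongr)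
  set G₁ : (Fin m → Option Bool) → Prop := fun ρ => ∃ S : Finset (Fin n),
    S.card ≤ max n₀ (familyBound r t * k) ∧ KWiseOn k (pushf f (unifOn (cube ρ))) Sᶜ
  set G₂ : (Fin m → Option Bool) → Prop := HasIndependentFamily f nb r k t
  have hreach : ∀ ρ, (G₁ ρ ∨ G₂ ρ) ∨ Reaches (fun ρ => G₁ ρ ∨ G₂ ρ) t ρ := by
    intro ρ
    rcases exists_kWiseOn_or_family f ρ k (familyBound r t) with ⟨S, hS, hk⟩ | ⟨F, hF, hFp, hFd⟩
    · exact Or.inl (Or.inl ⟨S, hS.trans (le_max_right _ _), hk⟩)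
    · refine Or.inr (Reaches.mono (fun _ => Or.inr)
        (reaches_hasIndependentFamily le_rfl hF (fun A hA => ?_) hFd))
      refine ⟨(hFp A hA).1, ?_, (hFp A hA).2⟩
      calc (freeNbhd nb ρ A).card ≤ (A.biUnion nb).card := card_filter_le _ _
        _ ≤ A.card * d := card_biUnion_le_card_mul A nb d fun i _ => hnb i
        _ ≤ k * d := Nat.mul_le_mul_right _ (hFp A hA).1
  have hoverlap : ∀ ρ, ¬ G₁ ρ → G₂ ρ →
      ∑ y, min (pushf f (unifOn (cube ρ)) y) (DPsi n Ψ y) ≤ 3 * b ^ r := by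
    rintro ρ h₁ ⟨F, hFr, hFp, hFd, hFN⟩
    have hn : n₀ ≤ n := by
      by_contra! hlt
      refine h₁ ⟨univ, ?_, kWiseOn_of_forall_not_nonUniform fun I hI _ => ?_⟩
      · rw [card_univ, Fintype.card_fin]
        exact hlt.le.trans (le_max_left _ _)
      · rw [compl_univ, subset_empty] at hI
        exact hI ▸ not_nonUniform_empty ρ
    have hI : (F.biUnion id).card ≤ r * k := by
      rw [← hFr]
      exact card_biUnion_le_card_mul F id k fun A hA => (hFp A hA).1
    rw [← hFr]
    refine sum_min_pushf_le hfnb hb0 F (fun A hA => ?_) hFd hFN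
      (hslice n hn Ψ ⟨s, hsΨ, hsn, hs'⟩ _ hI)
    obtain ⟨z, hz⟩ := (hFp A hA).2.2
    exact affinity_le_of_marg_ne hfnb (hFp A hA).1 (hFp A hA).2.1 hz
  obtain ⟨P, -, hP, hPN, hPβ⟩ := hasPartition_of_forall_reaches hreach M fun _ => none
  rw [cube_none] at hP hPβ
  set L : (Fin m → Option Bool) → Fin 3 := fun ρ => if G₁ ρ then 0 else if G₂ ρ then 1 else 2
  have hLdef : ∀ ρ, L ρ = if G₁ ρ then 0 else if G₂ ρ then 1 else 2 := fun _ => rfl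
  have hL0 : ∀ ρ, L ρ = 0 → G₁ ρ := by
    intro ρ h
    rw [hLdef] at h
    split_ifs at h with h1 h2
    · exact h1
    · exact absurd h (by decide)
    · exact absurd h (by decide)
  have hL1 : ∀ ρ, L ρ = 1 → ¬ G₁ ρ ∧ G₂ ρ := by
    intro ρ h
    rw [hLdef] at h
    split_ifs at h with h1 h2
    · exact absurd h (by decide)
    · exact ⟨h1, h2⟩
    · exact absurd h (by decide)
  have hL2 : ∀ ρ, L ρ = 2 → ¬ (G₁ ρ ∨ G₂ ρ) := by
    intro ρ h
    rw [hLdef] at h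
    split_ifs at h with h1 h2
    · exact absurd h (by decide)
    · exact absurd h (by decide)
    · exact not_or.2 ⟨h1, h2⟩
  refine ⟨P, L, fun x => hP x (mem_univ x), fun ρ _ h => hL0 ρ h, fun hne => ?_, ?_⟩
  · rw [tvd_eq_one_sub (sum_pushf_unifOn_eq_one f hne) (sum_DPsi_eq_one hsΨ hsn)]
    refine sub_lt_sub_left ?_ 1
    refine (sum_min_pushf_biUnion_le f _ cube (DPsi_nonneg Ψ)).trans_lt ?_
    calc _ ≤ ∑ ρ ∈ P.filter fun ρ => L ρ = 1, 3 * b ^ r := by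
          refine sum_le_sum fun ρ hρ => ?_
          have := hL1 ρ (mem_filter.1 hρ).2
          exact hoverlap ρ this.1 this.2
      _ = ((P.filter fun ρ => L ρ = 1).card : ℝ) * (3 * b ^ r) := by
          rw [sum_const, nsmul_eq_mul]
      _ ≤ N * (3 * b ^ r) := by
          gcongr
          exact (card_filter_le _ _).trans hPN
      _ < κ := by
          rw [lt_div_iff₀ (by positivity)] at hr
          linarith
  · rw [div_le_iff₀ (by positivity)]
    have hcard : ((univ : Finset (Fin m → Bool)).card : ℝ) = 2 ^ m := by simp
    rw [hcard] at hPβ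
    calc _ ≤ ∑ ρ ∈ P.filter fun ρ => ¬ (G₁ ρ ∨ G₂ ρ), ((cube ρ).card : ℝ) := by
          refine sum_le_sum_of_subset_of_nonneg (fun ρ hρ => ?_) fun _ _ _ => by positivity
          rw [mem_filter] at hρ ⊢
          exact ⟨hρ.1, hL2 ρ hρ.2⟩
      _ ≤ (1 - (1 / 2) ^ t) ^ M * 2 ^ m := by convert hPβ
      _ ≤ δ * 2 ^ m := by gcongr
end
end

section
/- There exists an absolute constant C > 0, and for each integer d ≥ 1 there exist constants c(d) > 0, C_d > 0, and N_d, with the following property. For every n ≥ N_d, every d-local function f : {0,1}^m → {0,1}^n, and every Ψ ⊆ {0,1,…,n} containing an element s with |s − n/2| ≤ c(d)·n, there exist a ∈ [0,1] with a ≤ C·dTV(f(U^m), D_Ψ) and probability distributions E and X on {0,1}^n with f(U^m) = a·E + (1−a)·X, such that for every even integer Δ and every x ∈ {0,1,…,n}: |Pr[|X| = x] − Pr[|X| = x + Δ]| ≤ C_d·|Δ|/n. -/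
open Finset

noncomputable section

/-- Probability that the Hamming weight under `A` equals the integer `j`. -/
def wdZ {n : ℕ} (A : (Fin n → Bool) → ℝ) (j : ℤ) : ℝ :=
  ∑ x ∈ Finset.univ.filter (fun x : Fin n → Bool => (hw x : ℤ) = j), A x

set_option linter.unusedSectionVars false

open scoped BigOperators

section Cube

variable {ι κ : Type*} [Fintype ι] [DecidableEq ι] [Fintype κ] [DecidableEq κ]

/-- The Boolean string whose support is `A`. -/
def indBool (A : Finset ι) : ι → Bool := fun j => decide (j ∈ A)

lemma expect_piecewise_swap {K : Type*} [AddCommMonoid K] [Module ℚ≥0 K] (J : Finset ι)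
    (F : (ι → Bool) → (ι → Bool) → K) :
    𝔼 x, 𝔼 y, F (J.piecewise x y) (J.piecewise y x) = 𝔼 x, 𝔼 y, F x y := by
  rw [← Finset.expect_product', ← Finset.expect_product' _ _ F]
  let e : ((ι → Bool) × (ι → Bool)) → ((ι → Bool) × (ι → Bool)) :=
    fun p => (J.piecewise p.1 p.2, J.piecewise p.2 p.1)
  have he : Function.Involutive e := by
    rintro ⟨x, y⟩
    ext i <;> by_cases hi : i ∈ J <;> simp [e, Finset.piecewise, hi]
  exact Finset.expect_equiv he.toPerm (by simp) (fun p _ => rfl)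

lemma expect_piecewise {K : Type*} [AddCommMonoid K] [Module ℚ≥0 K] (J : Finset ι)
    (g : (ι → Bool) → K) :
    𝔼 z, 𝔼 x, g (J.piecewise x z) = 𝔼 x, g x := by
  rw [Finset.expect_comm, expect_piecewise_swap J (fun x _ => g x)]
  simp

lemma expect_mul_of_dependsOn {K : Type*} [Field K] [CharZero K] {J : Finset ι}
    {φ ψ : (ι → Bool) → K} (hφ : DependsOn φ J) (hψ : DependsOn ψ (Jᶜ : Finset ι)) :
    𝔼 x, φ x * ψ x = (𝔼 x, φ x) * 𝔼 x, ψ x := by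
  rw [Finset.expect_mul_expect, ← expect_piecewise J]
  rw [Finset.expect_comm]
  refine Finset.expect_congr rfl fun x _ => Finset.expect_congr rfl fun y _ => ?_
  rw [hφ (y := x), hψ (y := y)]
  · intro i hi
    simp only [Finset.coe_compl, Set.mem_compl_iff, Finset.mem_coe] at hi
    simp [Finset.piecewise, hi]
  · intro i hi
    simp only [Finset.mem_coe] at hi
    simp [Finset.piecewise, hi]

lemma dependsOn_prod {α K : Type*} [DecidableEq α] [CommMonoid K] (M : Finset α) (J : α → Finset ι)
    {φ : α → (ι → Bool) → K} (hφ : ∀ a ∈ M, DependsOn (φ a) (J a)) :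
    DependsOn (fun x => ∏ a ∈ M, φ a x) (M.biUnion J) := by
  intro x y h
  refine Finset.prod_congr rfl fun a ha => hφ a ha fun i hi => h i ?_
  simp only [Finset.coe_biUnion, Set.mem_iUnion]
  exact ⟨a, ha, hi⟩

lemma expect_prod_of_dependsOn {α K : Type*} [DecidableEq α] [Field K] [CharZero K] (M : Finset α)
    (J : α → Finset ι) {φ : α → (ι → Bool) → K} (hφ : ∀ a ∈ M, DependsOn (φ a) (J a))
    (hJ : (M : Set α).PairwiseDisjoint J) :
    𝔼 x, ∏ a ∈ M, φ a x = ∏ a ∈ M, 𝔼 x, φ a x := by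
  induction M using Finset.induction_on with
  | empty => simp
  | insert a M ha ih =>
    simp only [Finset.prod_insert ha]
    rw [expect_mul_of_dependsOn (J := J a), ih]
    · exact fun b hb => hφ b (Finset.mem_insert_of_mem hb)
    · exact hJ.subset (by simp)
    · exact hφ a (Finset.mem_insert_self _ _)
    · refine (dependsOn_prod M J fun b hb => hφ b (Finset.mem_insert_of_mem hb)).mono ?_
      intro i hi
      simp only [Finset.coe_biUnion, Set.mem_iUnion, Finset.mem_coe] at hi
      obtain ⟨b, hb, hi⟩ := hi
      simp only [Finset.coe_compl, Set.mem_compl_iff, Finset.mem_coe]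
      intro hia
      have := hJ (Finset.mem_coe.2 (Finset.mem_insert_self a M))
        (Finset.mem_coe.2 (Finset.mem_insert_of_mem hb)) (by rintro rfl; exact ha hb)
      exact Finset.disjoint_left.1 this hia hi

lemma expect_coord {K : Type*} [Field K] [CharZero K] (i : ι) (h : Bool → K) :
    𝔼 x : ι → Bool, h (x i) = (h true + h false) / 2 := by
  have key : 𝔼 x : ι → Bool, h (x i) = 𝔼 x : ι → Bool, h (!(x i)) := by
    let e : (ι → Bool) → (ι → Bool) := fun x => Function.update x i (!(x i))
    have he : Function.Involutive e := by
      intro x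
      simp [e]
    exact Finset.expect_equiv he.toPerm (by simp) (fun x _ => by simp [e])
  have h2 : (𝔼 x : ι → Bool, h (x i)) + 𝔼 x : ι → Bool, h (!(x i)) = h true + h false := by
    rw [← Finset.expect_add_distrib]
    have : ∀ x : ι → Bool, h (x i) + h (!(x i)) = h true + h false := by
      intro x
      cases x i <;> simp [add_comm]
    simp only [this]
    exact Fintype.expect_const _
  rw [← key] at h2
  rw [eq_div_iff two_ne_zero, mul_two, h2]

lemma expect_prod_coord {K : Type*} [Field K] [CharZero K] (S : Finset ι) (h : ι → Bool → K) :
    𝔼 x : ι → Bool, ∏ i ∈ S, h i (x i) = ∏ i ∈ S, (h i true + h i false) / 2 := by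
  rw [expect_prod_of_dependsOn S (fun i => {i}) (φ := fun i x => h i (x i))]
  · exact Finset.prod_congr rfl fun i _ => expect_coord i _
  · intro i _ x y hxy
    simp only
    rw [hxy i (by simp)]
  · intro i _ j _ hij
    simpa [Function.onFun] using hij

lemma expect_cylinder {K : Type*} [Field K] [CharZero K] (S : Finset ι) (w : ι → Bool) :
    𝔼 z : ι → Bool, (if ∀ j ∈ S, z j = w j then (1 : K) else 0) = (1 / 2) ^ S.card := by
  have := expect_prod_coord (K := K) S (fun i b => if b = w i then 1 else 0)
  simp only [Finset.prod_ite_zero] at this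
  simp only [Finset.prod_const_one] at this
  rw [this, Finset.prod_congr rfl (g := fun _ => (1 / 2 : K)), Finset.prod_const]
  intro i _
  cases w i <;> simp

lemma sum_powerset_cylinder {K : Type*} [Semiring K] {S : Finset ι} {H : (ι → Bool) → K}
    (hH : DependsOn H S) (z : ι → Bool) :
    H z = ∑ A ∈ S.powerset, H (indBool A) * (if ∀ j ∈ S, z j = indBool A j then 1 else 0) := by
  rw [Finset.sum_eq_single (S.filter fun j => z j = true)]
  · rw [if_pos, mul_one]
    · refine hH fun j hj => ?_
      have hj' : j ∈ S := hj
      simp [indBool, hj']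
    · intro j hj
      simp [indBool, hj]
  · intro A hA hne
    rw [if_neg, mul_zero]
    intro h
    apply hne
    ext j
    rw [Finset.mem_powerset] at hA
    simp only [Finset.mem_filter]
    constructor
    · intro hj
      exact ⟨hA hj, by rw [h j (hA hj)]; simp [indBool, hj]⟩
    · rintro ⟨hj, hz⟩
      rw [h j hj] at hz
      simpa [indBool] using hz
  · intro h
    exact absurd (by simp) h

lemma expect_eq_sum_powerset {K : Type*} [Field K] [CharZero K] {S : Finset ι}
    {H : (ι → Bool) → K} (hH : DependsOn H S) :
    𝔼 z, H z = (∑ A ∈ S.powerset, H (indBool A)) / 2 ^ S.card := by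
  have : 𝔼 z, H z = 𝔼 z : ι → Bool, ∑ A ∈ S.powerset,
      H (indBool A) * (if ∀ j ∈ S, z j = indBool A j then 1 else 0) :=
    Finset.expect_congr rfl fun z _ => sum_powerset_cylinder hH z
  rw [this, Finset.expect_sum_comm, Finset.sum_div]
  refine Finset.sum_congr rfl fun A _ => ?_
  rw [← Finset.mul_expect, expect_cylinder]
  simp [div_eq_mul_inv]

lemma expect_eq_sum_restrict {K : Type*} [Field K] [CharZero K] (S : Finset ι)
    (g : (ι → Bool) → K) :
    𝔼 x, g x = (∑ A ∈ S.powerset, 𝔼 x, g (S.piecewise (indBool A) x)) / 2 ^ S.card := by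
  rw [← expect_piecewise S, Finset.expect_comm]
  refine expect_eq_sum_powerset (H := fun z => 𝔼 x, g (S.piecewise z x)) ?_
  intro z z' h
  refine Finset.expect_congr rfl fun x _ => congrArg g ?_
  ext i
  by_cases hi : i ∈ S
  · simp [Finset.piecewise, hi, h i hi]
  · simp [Finset.piecewise, hi]

lemma apply_div_le_expect {S : Finset ι} {H : (ι → Bool) → ℝ} (hH : DependsOn H S)
    (h0 : ∀ x, 0 ≤ H x) {q : ℕ} (hq : S.card ≤ q) (z : ι → Bool) :
    H z / 2 ^ q ≤ 𝔼 x, H x := by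
  have h1 : H z = H (indBool (S.filter fun j => z j = true)) := by
    refine hH fun j hj => ?_
    have hj' : j ∈ S := hj
    simp [indBool, hj']
  rw [expect_eq_sum_powerset hH]
  have h2 : H z ≤ ∑ A ∈ S.powerset, H (indBool A) := by
    rw [h1]
    exact Finset.single_le_sum (f := fun A => H (indBool A)) (fun A _ => h0 _) (by simp)
  calc H z / 2 ^ q ≤ H z / 2 ^ S.card := by
        apply div_le_div_of_nonneg_left (h0 z) (by positivity)
        exact pow_le_pow_right₀ (by norm_num) hq
    _ ≤ _ := by gcongr

end Cube

section Test

open scoped BigOperators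

variable {ι κ : Type*} [Fintype ι] [DecidableEq ι] [Fintype κ] [DecidableEq κ]

/-- The outputs of `g` in the coordinates `N` are exactly uniform. -/
def UniformOn (g : (ι → Bool) → (κ → Bool)) (N : Finset κ) : Prop :=
  ∀ w : κ → Bool, 𝔼 x, (if ∀ u ∈ N, g x u = w u then (1 : ℝ) else 0) = (1 / 2) ^ N.card

lemma dependsOn_cylinder {g : (ι → Bool) → (κ → Bool)} {I : κ → Finset ι}
    (hI : ∀ u, DependsOn (fun x => g x u) (I u)) {N : Finset κ} {J : Finset ι}
    (hJ : ∀ u ∈ N, I u ⊆ J) {K : Type*} (F : (κ → Bool) → K) (hF : DependsOn F N) :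
    DependsOn (fun x => F (g x)) J :=
  fun _ _ hxy => hF fun u hu => hI u fun _ hi => hxy _ (hJ u hu hi)

lemma dependsOn_ite_forall (N : Finset κ) (w : κ → Bool) :
    DependsOn (fun y : κ → Bool => if ∀ u ∈ N, y u = w u then (1 : ℝ) else 0) N := by
  intro y y' h
  have : (∀ u ∈ N, y u = w u) ↔ ∀ u ∈ N, y' u = w u :=
    forall₂_congr fun u hu => by rw [h u hu]
  simp only [this]

lemma exists_heavy_of_not_uniformOn {g : (ι → Bool) → (κ → Bool)} {I : κ → Finset ι}
    (hI : ∀ u, DependsOn (fun x => g x u) (I u)) {N : Finset κ} {J : Finset ι}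
    (hJ : ∀ u ∈ N, I u ⊆ J) {q : ℕ} (hJq : J.card ≤ q) (hNq : N.card ≤ q)
    (hU : ¬ UniformOn g N) :
    ∃ w : κ → Bool, (1 / 2 : ℝ) ^ N.card + (1 / 2) ^ q ≤
      𝔼 x, (if ∀ u ∈ N, g x u = w u then (1 : ℝ) else 0) := by
  set P : (κ → Bool) → ℝ := fun w => 𝔼 x, (if ∀ u ∈ N, g x u = w u then (1 : ℝ) else 0) with hP
  have hmean : 𝔼 w, P w = (1 / 2) ^ N.card := by
    rw [hP, Finset.expect_comm]
    have : ∀ x, 𝔼 w : κ → Bool, (if ∀ u ∈ N, g x u = w u then (1 : ℝ) else 0)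
        = (1 / 2) ^ N.card := by
      intro x
      rw [← expect_cylinder N (g x)]
      exact Finset.expect_congr rfl fun w _ => by simp only [eq_comm]
    simp only [this]
    exact Fintype.expect_const _
  obtain ⟨w, hw⟩ : ∃ w, (1 / 2) ^ N.card < P w := by
    by_contra! hle
    unfold UniformOn at hU
    push Not at hU
    obtain ⟨w, hw⟩ := hU
    have := Finset.expect_lt (s := Finset.univ) (f := P) (fun x _ => hle x)
      ⟨w, Finset.mem_univ _, lt_of_le_of_ne (hle w) hw⟩
    exact absurd hmean this.ne
  refine ⟨w, ?_⟩
  change _ ≤ P w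
  have hPw : P w = ((∑ A ∈ J.powerset, if ∀ u ∈ N, g (indBool A) u = w u then 1 else 0 : ℕ) : ℝ)
      / 2 ^ J.card := by
    rw [hP]
    simp only
    rw [expect_eq_sum_powerset (dependsOn_cylinder hI hJ _ (dependsOn_ite_forall N w))]
    push_cast
    rfl
  generalize (∑ A ∈ J.powerset, if ∀ u ∈ N, g (indBool A) u = w u then 1 else 0 : ℕ) = k at hPw
  obtain ⟨a, ha⟩ := Nat.exists_eq_add_of_le hJq
  obtain ⟨b, hb⟩ := Nat.exists_eq_add_of_le hNq
  have h2q : (0 : ℝ) < 2 ^ q := by positivity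
  have e1 : P w = ((k * 2 ^ a : ℕ) : ℝ) / 2 ^ q := by
    rw [hPw, ha, pow_add]; push_cast; field_simp
  have e2 : (1 / 2 : ℝ) ^ N.card = ((2 ^ b : ℕ) : ℝ) / 2 ^ q := by
    rw [hb, pow_add, one_div, inv_pow]; push_cast; field_simp
  rw [e1, e2] at hw
  rw [e1, e2, one_div, inv_pow, inv_eq_one_div, ← add_div]
  rw [div_lt_div_iff_of_pos_right h2q] at hw
  rw [div_le_div_iff_of_pos_right h2q]
  have : 2 ^ b < k * 2 ^ a := by exact_mod_cast hw
  exact_mod_cast this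

/-- A distribution with many independent blocks, none of them uniform, is distinguished from the
uniform distribution with exponentially small error. -/
lemma exists_test {g : (ι → Bool) → (κ → Bool)} {I : κ → Finset ι}
    (hI : ∀ u, DependsOn (fun x => g x u) (I u)) {α : Type*} [DecidableEq α]
    (M : Finset α) (N : α → Finset κ)
    (J : α → Finset ι) (hJ : ∀ v ∈ M, ∀ u ∈ N v, I u ⊆ J v)
    (hJd : (M : Set α).PairwiseDisjoint J) (hNd : (M : Set α).PairwiseDisjoint N)
    {q : ℕ} (hJq : ∀ v ∈ M, (J v).card ≤ q) (hNq : ∀ v ∈ M, (N v).card ≤ q)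
    (hU : ∀ v ∈ M, ¬ UniformOn g (N v)) :
    ∃ T : Finset (κ → Bool),
      𝔼 y, (if y ∈ T then (1 : ℝ) else 0) ≤ (1 - ((1 / 2) ^ q) ^ 2 / 16) ^ M.card ∧
      𝔼 x, (if g x ∈ T then (0 : ℝ) else 1) ≤ (1 - ((1 / 2) ^ q) ^ 2 / 16) ^ M.card := by
  have hw : ∀ v, ∃ w : κ → Bool, v ∈ M → (1 / 2 : ℝ) ^ (N v).card + (1 / 2) ^ q ≤
      𝔼 x, (if ∀ u ∈ N v, g x u = w u then (1 : ℝ) else 0) := by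
    intro v
    by_cases hv : v ∈ M
    · obtain ⟨w, h⟩ := exists_heavy_of_not_uniformOn hI (hJ v hv) (hJq v hv) (hNq v hv) (hU v hv)
      exact ⟨w, fun _ => h⟩
    · exact ⟨fun _ => true, fun h => absurd h hv⟩
  choose w hw using hw
  set δ : ℝ := (1 / 2) ^ q with hδ
  have hδ0 : 0 < δ := by positivity
  have hδ1 : δ ≤ 1 := pow_le_one₀ (by norm_num) (by norm_num)
  set b : α → (κ → Bool) → ℝ := fun v y => if ∀ u ∈ N v, y u = w v u then (1 : ℝ) else 0 with hb
  have hb01 : ∀ v y, 0 ≤ b v y ∧ b v y ≤ 1 := by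
    intro v y
    simp only [hb]
    split_ifs <;> norm_num
  have hbdep : ∀ v, DependsOn (b v) (N v) := fun v => dependsOn_ite_forall (N v) (w v)
  set μ : α → ℝ := fun v => (1 / 2) ^ (N v).card + δ / 2 with hμ
  have hμ0 : ∀ v, 0 ≤ μ v := fun v => by simp only [hμ]; positivity
  have hμ1 : ∀ v ∈ M, μ v ≤ 1 := by
    intro v hv
    have h1 := hw v hv
    have h2 : 𝔼 x, b v (g x) ≤ 1 :=
      Finset.expect_le Finset.univ_nonempty fun x _ => (hb01 v (g x)).2
    have : μ v ≤ (1 / 2 : ℝ) ^ (N v).card + δ := by simp only [hμ]; linarith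
    exact this.trans (h1.trans h2)
  have hexp : ∀ s : ℝ, |s| ≤ 1 → Real.exp s ≤ 1 + s + s ^ 2 := by
    intro s hs
    have := (abs_le.1 (Real.abs_exp_sub_one_sub_id_le hs)).2
    linarith
  have hsq : ∀ v ∈ M, ∀ y, (b v y - μ v) ^ 2 ≤ 1 := by
    intro v hv y
    rw [sq_le_one_iff_abs_le_one, abs_le]
    have := hb01 v y; have := hμ0 v; have := hμ1 v hv
    constructor <;> linarith
  have hup : ∀ σ : ℝ, |σ| = δ / 4 → ∀ v ∈ M, ∀ y,
      Real.exp (σ * (b v y - μ v)) ≤ 1 + σ * (b v y - μ v) + (δ / 4) ^ 2 := by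
    intro σ hσ v hv y
    have hs := hsq v hv y
    have h1 : (σ * (b v y - μ v)) ^ 2 ≤ (δ / 4) ^ 2 := by
      rw [mul_pow, ← sq_abs σ, hσ]
      nlinarith [sq_nonneg (δ / 4)]
    have h2 : |σ * (b v y - μ v)| ≤ 1 := by
      rw [← sq_le_one_iff_abs_le_one]
      nlinarith
    linarith [hexp _ h2]
  set F : (κ → Bool) → ℝ := fun y => ∏ v ∈ M, Real.exp (δ / 4 * (b v y - μ v)) with hF
  set G : (κ → Bool) → ℝ := fun y => ∏ v ∈ M, Real.exp (-(δ / 4) * (b v y - μ v)) with hG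
  have hFG : ∀ y, F y * G y = 1 := by
    intro y
    simp only [hF, hG]
    rw [← Finset.prod_mul_distrib]
    refine Finset.prod_eq_one fun v _ => ?_
    rw [← Real.exp_add]
    simp
  have hF0 : ∀ y, 0 < F y := fun y => Finset.prod_pos fun v _ => Real.exp_pos _
  have hG0 : ∀ y, 0 < G y := fun y => Finset.prod_pos fun v _ => Real.exp_pos _
  refine ⟨Finset.univ.filter fun y => 1 ≤ F y, ?_, ?_⟩
  · calc 𝔼 y, (if y ∈ (Finset.univ.filter fun y => 1 ≤ F y) then (1 : ℝ) else 0)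
        ≤ 𝔼 y, F y := by
          refine Finset.expect_le_expect fun y _ => ?_
          split_ifs with h
          · simpa using h
          · exact (hF0 y).le
      _ = ∏ v ∈ M, 𝔼 y, Real.exp (δ / 4 * (b v y - μ v)) := by
          simp only [hF]
          refine expect_prod_of_dependsOn M N
            (φ := fun v y => Real.exp (δ / 4 * (b v y - μ v))) (fun v _ => ?_) hNd
          intro y y' h
          simp only
          rw [hbdep v h]
      _ ≤ ∏ _v ∈ M, (1 - δ ^ 2 / 16) := by
          refine Finset.prod_le_prod (fun v _ => Finset.expect_nonneg fun _ _ => by positivity)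
            fun v hv => ?_
          calc 𝔼 y, Real.exp (δ / 4 * (b v y - μ v))
              ≤ 𝔼 y, (δ / 4 * b v y + (1 - δ / 4 * μ v + (δ / 4) ^ 2)) :=
                Finset.expect_le_expect fun y _ => by
                  have := hup (δ / 4) (abs_of_pos (by positivity)) v hv y
                  linarith
            _ = δ / 4 * (1 / 2) ^ (N v).card + (1 - δ / 4 * μ v + (δ / 4) ^ 2) := by
                rw [Finset.expect_add_distrib, ← Finset.mul_expect, Fintype.expect_const]
                simp only [hb]
                rw [expect_cylinder]
            _ ≤ 1 - δ ^ 2 / 16 := by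
                simp only [hμ]
                nlinarith
      _ = _ := by rw [Finset.prod_const]
  · calc 𝔼 x, (if g x ∈ (Finset.univ.filter fun y => 1 ≤ F y) then (0 : ℝ) else 1)
        ≤ 𝔼 x, G (g x) := by
          refine Finset.expect_le_expect fun x _ => ?_
          split_ifs with h
          · exact (hG0 _).le
          · simp only [Finset.mem_filter, Finset.mem_univ, true_and, not_le] at h
            have := hFG (g x)
            by_contra! h2
            nlinarith [hF0 (g x), hG0 (g x)]
      _ = ∏ v ∈ M, 𝔼 x, Real.exp (-(δ / 4) * (b v (g x) - μ v)) := by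
          simp only [hG]
          refine expect_prod_of_dependsOn M J
            (φ := fun v x => Real.exp (-(δ / 4) * (b v (g x) - μ v))) (fun v hv => ?_) hJd
          refine dependsOn_cylinder hI (hJ v hv)
            (fun y => Real.exp (-(δ / 4) * (b v y - μ v))) ?_
          intro y y' h
          simp only
          rw [hbdep v h]
      _ ≤ ∏ _v ∈ M, (1 - δ ^ 2 / 16) := by
          refine Finset.prod_le_prod (fun v _ => Finset.expect_nonneg fun _ _ => by positivity)
            fun v hv => ?_
          calc 𝔼 x, Real.exp (-(δ / 4) * (b v (g x) - μ v))
              ≤ 𝔼 x, (-(δ / 4) * b v (g x) + (1 + δ / 4 * μ v + (δ / 4) ^ 2)) :=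
                Finset.expect_le_expect fun x _ => by
                  have := hup (-(δ / 4)) (by rw [abs_neg]; exact abs_of_pos (by positivity))
                    v hv (g x)
                  linarith
            _ = -(δ / 4) * (𝔼 x, b v (g x)) + (1 + δ / 4 * μ v + (δ / 4) ^ 2) := by
                rw [Finset.expect_add_distrib, ← Finset.mul_expect, Fintype.expect_const]
            _ ≤ 1 - δ ^ 2 / 16 := by
                have := hw v hv
                have h2 : (1 / 2 : ℝ) ^ (N v).card + δ ≤ 𝔼 x, b v (g x) := this
                simp only [hμ]
                nlinarith
      _ = _ := by rw [Finset.prod_const]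

end Test

section Block

open scoped BigOperators

lemma norm_expect_cexp_sq {α : Type*} [Fintype α] (a : α → ℝ) :
    ‖𝔼 x, Complex.exp (a x * Complex.I)‖ ^ 2 = 𝔼 x, 𝔼 y, Real.cos (a x - a y) := by
  have h : 𝔼 x, Complex.exp (a x * Complex.I)
      = ((𝔼 x, Real.cos (a x) : ℝ) : ℂ) + ((𝔼 x, Real.sin (a x) : ℝ) : ℂ) * Complex.I := by
    rw [Complex.ofReal_expect, Complex.ofReal_expect, Finset.expect_mul,
      ← Finset.expect_add_distrib]
    refine Finset.expect_congr rfl fun x _ => ?_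
    rw [Complex.exp_mul_I]
    push_cast
    rfl
  rw [h, Complex.sq_norm, Complex.normSq_add_mul_I, sq, sq, Finset.expect_mul_expect,
    Finset.expect_mul_expect, ← Finset.expect_add_distrib]
  refine Finset.expect_congr rfl fun x _ => ?_
  rw [← Finset.expect_add_distrib]
  refine Finset.expect_congr rfl fun y _ => ?_
  rw [Real.cos_sub]

lemma exists_abs_sin_le_of_closure (K : Set ℤ) (a : ℤ) (ha : a ∈ AddSubgroup.closure K) :
    ∃ L : ℝ, ∀ θ B : ℝ, (∀ k ∈ K, |Real.sin (k * θ / 2)| ≤ B) → |Real.sin (a * θ / 2)| ≤ L * B := by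
  induction ha using AddSubgroup.closure_induction with
  | mem k hk => exact ⟨1, fun θ B h => by simpa using h k hk⟩
  | zero => exact ⟨0, fun θ B _ => by simp⟩
  | add a b _ _ iha ihb =>
    obtain ⟨L₁, h₁⟩ := iha
    obtain ⟨L₂, h₂⟩ := ihb
    refine ⟨L₁ + L₂, fun θ B h => ?_⟩
    have e : ((a + b : ℤ) : ℝ) * θ / 2 = a * θ / 2 + b * θ / 2 := by push_cast; ring
    rw [e, Real.sin_add, add_mul]
    refine (abs_add_le _ _).trans ?_
    rw [abs_mul, abs_mul]
    have c₁ := Real.abs_cos_le_one (a * θ / 2)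
    have c₂ := Real.abs_cos_le_one (b * θ / 2)
    have s₁ := abs_nonneg (Real.sin (a * θ / 2))
    have s₂ := abs_nonneg (Real.sin (b * θ / 2))
    nlinarith [h₁ θ B h, h₂ θ B h]
  | neg a _ iha =>
    obtain ⟨L, hL⟩ := iha
    refine ⟨L, fun θ B h => ?_⟩
    have e : ((-a : ℤ) : ℝ) * θ / 2 = -(a * θ / 2) := by push_cast; ring
    rw [e, Real.sin_neg, abs_neg]
    exact hL θ B h

lemma exists_abs_sin_le (q : ℕ) :
    ∃ L : ℝ, 0 < L ∧ ∀ K : Set ℤ, K ⊆ Set.Icc (-q : ℤ) q → (2 : ℤ) ∈ AddSubgroup.closure K →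
      ∀ θ B : ℝ, (∀ k ∈ K, |Real.sin (k * θ / 2)| ≤ B) → |Real.sin θ| ≤ L * B := by
  have hfin : (Set.Icc (-q : ℤ) q).powerset.Finite := (Set.finite_Icc _ _).finite_subsets
  have : ∀ K : Set ℤ, ∃ L : ℝ, (2 : ℤ) ∈ AddSubgroup.closure K →
      ∀ θ B : ℝ, (∀ k ∈ K, |Real.sin (k * θ / 2)| ≤ B) → |Real.sin θ| ≤ L * B := by
    intro K
    by_cases h2 : (2 : ℤ) ∈ AddSubgroup.closure K
    · obtain ⟨L, hL⟩ := exists_abs_sin_le_of_closure K 2 h2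
      refine ⟨L, fun _ θ B h => ?_⟩
      have := hL θ B h
      simpa using this
    · exact ⟨0, fun h => absurd h h2⟩
  choose L hL using this
  refine ⟨1 + ∑ K ∈ hfin.toFinset, |L K|, by positivity, fun K hK h2 θ B h => ?_⟩
  refine (hL K h2 θ B h).trans ?_
  have hB : 0 ≤ B := by
    obtain ⟨k, hk⟩ : K.Nonempty := by
      by_contra hne
      rw [Set.not_nonempty_iff_eq_empty] at hne
      rw [hne] at h2
      simp at h2
    exact (abs_nonneg _).trans (h k hk)
  refine mul_le_mul_of_nonneg_right ?_ hB
  have : |L K| ≤ ∑ K ∈ hfin.toFinset, |L K| :=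
    Finset.single_le_sum (f := fun K => |L K|) (fun _ _ => abs_nonneg _) (by simpa using hK)
  linarith [le_abs_self (L K)]

/-- A set of integers not generating `2` is annihilated by a character of order at least `3`. -/
lemma exists_character_of_two_notMem_closure (K : Set ℤ) (h : (2 : ℤ) ∉ AddSubgroup.closure K) :
    ∃ ω : ℂ, ω ≠ 0 ∧ 1 + ω ≠ 0 ∧ 1 - ω ≠ 0 ∧ ∀ k ∈ K, ω ^ k = 1 := by
  obtain ⟨a, ha⟩ := Int.subgroup_cyclic (AddSubgroup.closure K)
  have hmem : ∀ k, k ∈ AddSubgroup.closure K ↔ a ∣ k := by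
    intro k
    rw [ha, ← AddSubgroup.zmultiples_eq_closure, Int.mem_zmultiples_iff]
  have hK : ∀ k ∈ K, a ∣ k := fun k hk => (hmem k).1 (AddSubgroup.subset_closure hk)
  rw [hmem] at h
  by_cases ha0 : a = 0
  · refine ⟨Complex.I, Complex.I_ne_zero, ?_, ?_, ?_⟩
    · intro h; simpa using congrArg Complex.re h
    · intro h; simpa using congrArg Complex.re h
    · intro k hk
      have := hK k hk
      rw [ha0, zero_dvd_iff] at this
      simp [this]
  · have hn : a.natAbs ≠ 0 := by simpa using ha0
    have hprim := Complex.isPrimitiveRoot_exp a.natAbs hn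
    set ω := Complex.exp (2 * Real.pi * Complex.I / a.natAbs) with hω
    have key : ¬ ω ^ 2 = 1 := by
      intro h2
      have := hprim.dvd_of_pow_eq_one 2 h2
      exact h (Int.natAbs_dvd.1 (by exact_mod_cast this))
    refine ⟨ω, Complex.exp_ne_zero _, ?_, ?_, ?_⟩
    · intro h1
      apply key
      have : ω = -1 := by linear_combination h1
      rw [this]; norm_num
    · intro h1
      apply key
      have : ω = 1 := by linear_combination -h1
      rw [this]; norm_num
    · intro k hk
      rw [hprim.zpow_eq_one_iff_dvd]
      exact Int.natAbs_dvd.2 (hK k hk)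

variable {ι κ : Type*} [Fintype ι] [DecidableEq ι] [Fintype κ] [DecidableEq κ]

/-- The number of ones in the coordinates `N`. -/
def partialWeight (N : Finset κ) (y : κ → Bool) : ℕ := ∑ u ∈ N, if y u = true then 1 else 0

lemma dependsOn_partialWeight (N : Finset κ) : DependsOn (partialWeight N) N := by
  intro y y' h
  exact Finset.sum_congr rfl fun u hu => by rw [h u hu]

lemma partialWeight_le (N : Finset κ) (y : κ → Bool) : partialWeight N y ≤ N.card := by
  rw [partialWeight, Finset.card_eq_sum_ones]
  exact Finset.sum_le_sum fun u _ => by split_ifs <;> simp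

lemma UniformOn.expect_comp {g : (ι → Bool) → (κ → Bool)} {N : Finset κ} (hU : UniformOn g N)
    {F : (κ → Bool) → ℂ} (hF : DependsOn F N) : 𝔼 x, F (g x) = 𝔼 y, F y := by
  rw [expect_eq_sum_powerset hF]
  simp only [sum_powerset_cylinder hF (g _)]
  rw [Finset.expect_sum_comm, Finset.sum_div]
  refine Finset.sum_congr rfl fun A _ => ?_
  rw [← Finset.mul_expect]
  have := congrArg (fun r : ℝ => (r : ℂ)) (hU (indBool A))
  rw [Complex.ofReal_expect] at this
  simp only [apply_ite (fun r : ℝ => (r : ℂ)), Complex.ofReal_one, Complex.ofReal_zero] at this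
  rw [this]
  simp [div_eq_mul_inv]

/-- If the outputs in `N` are uniform, the weight in `N` is not determined modulo any integer
greater than `2` by the inputs that do not feed the output `v ∈ N`. -/
lemma two_mem_closure_differences {g : (ι → Bool) → (κ → Bool)} {N : Finset κ} {v : κ}
    {I : Finset ι} (hI : DependsOn (fun x => g x v) I) (hv : v ∈ N) (hU : UniformOn g N) :
    (2 : ℤ) ∈ AddSubgroup.closure {k : ℤ | ∃ z x x' : ι → Bool,
      k = (partialWeight N (g (I.piecewise x z)) : ℤ) - partialWeight N (g (I.piecewise x' z))} := by
  by_contra hcon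
  obtain ⟨ω, hω0, hω1, hω2, hω⟩ := exists_character_of_two_notMem_closure _ hcon
  set s : Bool → ℂ := fun b => if b = true then -1 else 1 with hs
  have hsv : 𝔼 x, s (g x v) = 0 := by
    rw [hU.expect_comp (F := fun y => s (y v))
      (fun y y' h => congrArg s (h v hv)), expect_coord]
    simp [hs]
  have hA : 𝔼 x, ω ^ partialWeight N (g x) * s (g x v) ≠ 0 := by
    rw [hU.expect_comp (F := fun y => ω ^ partialWeight N y * s (y v))]
    · have : ∀ y : κ → Bool, ω ^ partialWeight N y * s (y v) =
          ∏ u ∈ N, (if y u = true then ω else 1) * (if u = v then s (y u) else 1) := by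
        intro y
        rw [Finset.prod_mul_distrib, Finset.prod_ite_eq' N v, if_pos hv, partialWeight,
          ← Finset.prod_pow_eq_pow_sum]
        congr 1
        refine Finset.prod_congr rfl fun u _ => ?_
        split_ifs <;> simp
      simp only [this]
      rw [expect_prod_coord N
        (fun u b => (if b = true then ω else 1) * (if u = v then s b else 1))]
      rw [Finset.prod_ne_zero_iff]
      intro u _
      by_cases huv : u = v
      · simp only [huv, hs]
        norm_num
        intro h
        exact hω2 (by linear_combination h)
      · simp only [huv]
        norm_num
        intro h
        exact hω1 (by linear_combination h)
    · intro y y' h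
      simp only
      rw [dependsOn_partialWeight N h, h v hv]
  apply hA
  rw [← expect_piecewise I]
  refine Finset.expect_eq_zero fun z _ => ?_
  have : ∀ x, ω ^ partialWeight N (g (I.piecewise x z)) * s (g (I.piecewise x z) v)
      = ω ^ partialWeight N (g z) * s (g x v) := by
    intro x
    have h1 : g (I.piecewise x z) v = g x v := hI fun i hi => by
      have hi' : i ∈ I := hi
      simp [Finset.piecewise, hi']
    have h2 := hω _ ⟨z, x, z, rfl⟩
    rw [zpow_sub₀ hω0, div_eq_one_iff_eq (zpow_ne_zero _ hω0), Finset.piecewise_same,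
      zpow_natCast, zpow_natCast] at h2
    rw [h1, h2]
  simp only [this]
  rw [← Finset.mul_expect, hsv, mul_zero]

/-- The characteristic function of a uniform block, after resampling the inputs of one of its
outputs, decays away from the multiples of `π`. -/
lemma exists_block_decay (q : ℕ) :
    ∃ c : ℝ, 0 < c ∧ ∀ {ι κ : Type} [Fintype ι] [DecidableEq ι] [Fintype κ] [DecidableEq κ]
      {g : (ι → Bool) → (κ → Bool)} {I : κ → Finset ι}
      (_ : ∀ u, DependsOn (fun x => g x u) (I u)) {N : Finset κ} {v : κ} {J : Finset ι}
      (_ : v ∈ N) (_ : ∀ u ∈ N, I u ⊆ J) (_ : J.card ≤ q) (_ : N.card ≤ q)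
      (_ : UniformOn g N) (θ : ℝ),
      𝔼 z, ‖𝔼 x, Complex.exp (((θ * partialWeight N (g ((I v).piecewise x z)) : ℝ) : ℂ)
        * Complex.I)‖ ≤ Real.exp (-c * Real.sin θ ^ 2) := by
  obtain ⟨L, hL0, hL⟩ := exists_abs_sin_le q
  refine ⟨1 / (L ^ 2 * 8 ^ q), by positivity, ?_⟩
  intro ι κ _ _ _ _ g I hI N v J hv hJ hJq hNq hU θ
  set h : (ι → Bool) → (ι → Bool) → ℕ :=
    fun z x => partialWeight N (g ((I v).piecewise x z)) with hh
  set G : ℝ := 𝔼 z, ‖𝔼 x, Complex.exp (((θ * h z x : ℝ) : ℂ) * Complex.I)‖ with hG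
  have hdep : ∀ z z' x x' : ι → Bool, (∀ i ∈ J, z i = z' i) → (∀ i ∈ J, x i = x' i) →
      h z x = h z' x' := by
    intro z z' x x' hz hx
    refine dependsOn_partialWeight N fun u hu => hI u fun i hi => ?_
    have hiJ := hJ u hu hi
    by_cases hiv : i ∈ I v
    · simp [Finset.piecewise, hiv, hx i hiJ]
    · simp [Finset.piecewise, hiv, hz i hiJ]
  set D : (ι → Bool) → (ι → Bool) → (ι → Bool) → ℝ :=
    fun z x x' => 2 * Real.sin ((θ * h z x - θ * h z x') / 2) ^ 2 with hD
  have hD0 : ∀ z x x', 0 ≤ D z x x' := fun _ _ _ => by simp only [hD]; positivity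
  have hG2 : G ^ 2 ≤ 1 - 𝔼 z, 𝔼 x, 𝔼 x', D z x x' := by
    have h1 : G ^ 2 ≤ 𝔼 z, ‖𝔼 x, Complex.exp (((θ * h z x : ℝ) : ℂ) * Complex.I)‖ ^ 2 := by
      have := Finset.expect_mul_sq_le_sq_mul_sq (Finset.univ : Finset (ι → Bool))
        (fun z => ‖𝔼 x, Complex.exp (((θ * h z x : ℝ) : ℂ) * Complex.I)‖) (fun _ => 1)
      simpa [hG, Fintype.expect_const] using this
    refine h1.trans (le_of_eq ?_)
    simp only [norm_expect_cexp_sq]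
    have e : ∀ z x x', Real.cos (θ * h z x - θ * h z x') = 1 - D z x x' := by
      intro z x x'
      have := Real.cos_two_mul ((θ * h z x - θ * h z x') / 2)
      have h2 := Real.sin_sq_add_cos_sq ((θ * h z x - θ * h z x') / 2)
      rw [mul_div_cancel₀ _ (two_ne_zero)] at this
      simp only [hD]
      linarith
    simp only [e, Finset.expect_sub_distrib, Fintype.expect_const]
  have hlow : ∀ z x x', D z x x' / 8 ^ q ≤ 1 - G ^ 2 := by
    intro z x x'
    have h1 : 𝔼 z, 𝔼 x, 𝔼 x', D z x x' ≤ 1 - G ^ 2 := by linarith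
    refine le_trans ?_ h1
    have hdx' : ∀ z x, DependsOn (fun x' => D z x x') J := fun z x y y' hy => by
      simp only [hD]
      rw [hdep z z y y' (fun _ _ => rfl) (fun i hi => hy i hi)]
    have hdx : ∀ z, DependsOn (fun x => 𝔼 x', D z x x') J := fun z y y' hy =>
      Finset.expect_congr rfl fun x' _ => by
        simp only [hD]
        rw [hdep z z y y' (fun _ _ => rfl) (fun i hi => hy i hi)]
    have hdz : DependsOn (fun z => 𝔼 x, 𝔼 x', D z x x') J := fun y y' hy =>
      Finset.expect_congr rfl fun x _ => Finset.expect_congr rfl fun x' _ => by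
        simp only [hD]
        rw [hdep y y' x x (fun i hi => hy i hi) (fun _ _ => rfl),
          hdep y y' x' x' (fun i hi => hy i hi) (fun _ _ => rfl)]
    have a1 := apply_div_le_expect (hdx' z x) (fun _ => hD0 _ _ _) hJq x'
    have a2 := apply_div_le_expect (hdx z)
      (fun _ => Finset.expect_nonneg fun _ _ => hD0 _ _ _) hJq x
    have a3 := apply_div_le_expect hdz (fun _ => Finset.expect_nonneg fun _ _ =>
      Finset.expect_nonneg fun _ _ => hD0 _ _ _) hJq z
    calc D z x x' / 8 ^ q = D z x x' / 2 ^ q / 2 ^ q / 2 ^ q := by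
          rw [div_div, div_div, ← mul_pow, ← mul_pow]; norm_num
      _ ≤ (𝔼 x', D z x x') / 2 ^ q / 2 ^ q := by gcongr
      _ ≤ (𝔼 x, 𝔼 x', D z x x') / 2 ^ q := by gcongr
      _ ≤ _ := a3
  have h1G : 0 ≤ 1 - G ^ 2 :=
    le_trans (by have := hD0 (fun _ => true) (fun _ => true) (fun _ => true); positivity)
      (hlow (fun _ => true) (fun _ => true) (fun _ => true))
  have hsin := hL _ ?_ (two_mem_closure_differences (hI v) hv hU) θ
    (Real.sqrt (8 ^ q * (1 - G ^ 2) / 2)) ?_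
  · have hsq : Real.sin θ ^ 2 ≤ L ^ 2 * (8 ^ q * (1 - G ^ 2) / 2) := by
      rw [← sq_abs]
      calc |Real.sin θ| ^ 2 ≤ (L * Real.sqrt (8 ^ q * (1 - G ^ 2) / 2)) ^ 2 := by gcongr
        _ = _ := by rw [mul_pow, Real.sq_sqrt (by positivity)]
    have hG2' : G ^ 2 ≤ 1 - 2 * (1 / (L ^ 2 * 8 ^ q) * Real.sin θ ^ 2) := by
      have : 2 * (1 / (L ^ 2 * 8 ^ q) * Real.sin θ ^ 2) ≤ 1 - G ^ 2 := by
        calc 2 * (1 / (L ^ 2 * 8 ^ q) * Real.sin θ ^ 2)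
            ≤ 2 * (1 / (L ^ 2 * 8 ^ q) * (L ^ 2 * (8 ^ q * (1 - G ^ 2) / 2))) := by gcongr
          _ = 1 - G ^ 2 := by field_simp
      linarith
    have : G ^ 2 ≤ Real.exp (-(1 / (L ^ 2 * 8 ^ q)) * Real.sin θ ^ 2) ^ 2 := by
      rw [← Real.exp_nat_mul]
      refine hG2'.trans ?_
      have := Real.add_one_le_exp (((2 : ℕ) : ℝ) * (-(1 / (L ^ 2 * 8 ^ q)) * Real.sin θ ^ 2))
      push_cast at this ⊢
      linarith
    exact le_of_sq_le_sq this (Real.exp_pos _).le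
  · rintro k ⟨z, x, x', rfl⟩
    have h1 := (partialWeight_le N (g ((I v).piecewise x z))).trans hNq
    have h2 := (partialWeight_le N (g ((I v).piecewise x' z))).trans hNq
    constructor <;> omega
  · rintro k ⟨z, x, x', rfl⟩
    apply Real.abs_le_sqrt
    have := hlow z x x'
    rw [div_le_iff₀ (by positivity)] at this
    simp only [hD, hh] at this
    have e : (((partialWeight N (g ((I v).piecewise x z)) : ℤ) -
        partialWeight N (g ((I v).piecewise x' z)) : ℤ) : ℝ) * θ / 2 =
        (θ * (partialWeight N (g ((I v).piecewise x z)) : ℝ) -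
          θ * (partialWeight N (g ((I v).piecewise x' z)) : ℝ)) / 2 := by
      push_cast; ring
    rw [e]
    linarith

end Block

section CharFun

open scoped BigOperators

/-- The input coordinates around which the blocks of a local function are resampled: each output
sharing an input with the centre `v` lies in the block `N v`, whose inputs lie in `J v`; distinct
blocks share neither inputs nor outputs. -/
structure BlockSystem {ι κ : Type} [DecidableEq ι] [DecidableEq κ] (I : κ → Finset ι)
    (M : Finset κ) (N : κ → Finset κ) (J : κ → Finset ι) : Prop where
  self_mem : ∀ v ∈ M, v ∈ N v
  mem_of_not_disjoint : ∀ v ∈ M, ∀ u, ¬ Disjoint (I u) (I v) → u ∈ N v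
  inputs_subset : ∀ v ∈ M, ∀ u ∈ N v, I u ⊆ J v
  disjoint_inputs : (M : Set κ).PairwiseDisjoint J
  disjoint_outputs : (M : Set κ).PairwiseDisjoint N

lemma BlockSystem.mono {ι κ : Type} [DecidableEq ι] [DecidableEq κ] {I : κ → Finset ι}
    {M M' : Finset κ} {N : κ → Finset κ} {J : κ → Finset ι} (h : BlockSystem I M N J)
    (hM : M' ⊆ M) : BlockSystem I M' N J where
  self_mem v hv := h.self_mem v (hM hv)
  mem_of_not_disjoint v hv := h.mem_of_not_disjoint v (hM hv)
  inputs_subset v hv := h.inputs_subset v (hM hv)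
  disjoint_inputs := h.disjoint_inputs.subset (by exact_mod_cast hM)
  disjoint_outputs := h.disjoint_outputs.subset (by exact_mod_cast hM)

/-- The characteristic function of the output weight decays like a Gaussian in `sin θ` when the
output has many independent uniform blocks. -/
lemma exists_weight_decay (q : ℕ) :
    ∃ c : ℝ, 0 < c ∧ ∀ {ι κ : Type} [Fintype ι] [DecidableEq ι] [Fintype κ] [DecidableEq κ]
      {g : (ι → Bool) → (κ → Bool)} {I : κ → Finset ι}
      (_ : ∀ u, DependsOn (fun x => g x u) (I u)) {M : Finset κ} {N : κ → Finset κ}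
      {J : κ → Finset ι} (_ : BlockSystem I M N J)
      (_ : ∀ v ∈ M, (J v).card ≤ q) (_ : ∀ v ∈ M, (N v).card ≤ q)
      (_ : ∀ v ∈ M, UniformOn g (N v)) (θ : ℝ),
      ‖𝔼 x, Complex.exp (((θ * partialWeight Finset.univ (g x) : ℝ) : ℂ) * Complex.I)‖
        ≤ Real.exp (-(c * M.card) * Real.sin θ ^ 2) := by
  obtain ⟨c, hc, H⟩ := exists_block_decay q
  refine ⟨c, hc, ?_⟩
  intro ι κ _ _ _ _ g I hI M N J hB hJq hNq hU θ
  set B := M.biUnion I with hBdef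
  set E : ℝ → ℂ := fun r => Complex.exp (((θ * r : ℝ) : ℂ) * Complex.I) with hE
  have hEadd : ∀ r s, E (r + s) = E r * E s := by
    intro r s
    simp only [hE]
    rw [← Complex.exp_add]
    congr 1
    push_cast
    ring
  have hEnorm : ∀ r, ‖E r‖ = 1 := fun r => Complex.norm_exp_ofReal_mul_I _
  have hlocal : ∀ v ∈ M, ∀ u ∈ N v, ∀ x z : ι → Bool,
      g (B.piecewise x z) u = g ((I v).piecewise x z) u := by
    intro v hv u hu x z
    refine hI u fun i hi => ?_
    by_cases hiv : i ∈ I v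
    · have : i ∈ B := Finset.mem_biUnion.2 ⟨v, hv, hiv⟩
      simp [Finset.piecewise, hiv, this]
    · have : i ∉ B := by
        intro h
        obtain ⟨w, hw, hiw⟩ := Finset.mem_biUnion.1 h
        have hne : v ≠ w := by rintro rfl; exact hiv hiw
        exact Finset.disjoint_left.1 (hB.disjoint_inputs hv hw hne)
          (hB.inputs_subset v hv u hu hi) (hB.inputs_subset w hw w (hB.self_mem w hw) hiw)
      simp [Finset.piecewise, hiv, this]
  set R : Finset κ := Finset.univ \ M.biUnion N with hR
  have hrest : ∀ u ∈ R, ∀ x z : ι → Bool, g (B.piecewise x z) u = g z u := by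
    intro u hu x z
    refine hI u fun i hi => ?_
    have : i ∉ B := by
      intro h
      obtain ⟨w, hw, hiw⟩ := Finset.mem_biUnion.1 h
      have := hB.mem_of_not_disjoint w hw u (Finset.not_disjoint_iff.2 ⟨i, hi, hiw⟩)
      rw [hR, Finset.mem_sdiff] at hu
      exact hu.2 (Finset.mem_biUnion.2 ⟨w, hw, this⟩)
    simp [Finset.piecewise, this]
  have hsplit : ∀ y : κ → Bool, partialWeight Finset.univ y
      = partialWeight R y + ∑ v ∈ M, partialWeight (N v) y := by
    intro y
    simp only [partialWeight]
    rw [← Finset.sum_biUnion hB.disjoint_outputs, hR, Finset.sum_sdiff (Finset.subset_univ _)]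
  have hEsum : ∀ (a : κ → ℕ), E ((∑ v ∈ M, a v : ℕ) : ℝ) = ∏ v ∈ M, E (a v) := by
    intro a
    simp only [hE]
    rw [← Complex.exp_sum]
    congr 1
    push_cast
    rw [Finset.mul_sum, Finset.sum_mul]
  set ψ : κ → (ι → Bool) → (ι → Bool) → ℂ :=
    fun v z x => E (partialWeight (N v) (g ((I v).piecewise x z))) with hψ
  have hfact : ∀ z x, E (partialWeight Finset.univ (g (B.piecewise x z)))
      = E (partialWeight R (g z)) * ∏ v ∈ M, ψ v z x := by
    intro z x
    rw [hsplit, Nat.cast_add, hEadd, hEsum]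
    congr 1
    · congr 2
      exact dependsOn_partialWeight R fun u hu => hrest u hu x z
    · refine Finset.prod_congr rfl fun v hv => ?_
      simp only [hψ]
      congr 2
      exact dependsOn_partialWeight (N v) fun u hu => hlocal v hv u hu x z
  have hIJ : ∀ v ∈ M, I v ⊆ J v := fun v hv => hB.inputs_subset v hv v (hB.self_mem v hv)
  have hdisjI : (M : Set κ).PairwiseDisjoint I := fun v hv w hw hvw =>
    (hB.disjoint_inputs hv hw hvw).mono (hIJ v hv) (hIJ w hw)
  have hinner : ∀ z, ‖𝔼 x, E (partialWeight Finset.univ (g (B.piecewise x z)))‖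
      = ∏ v ∈ M, ‖𝔼 x, ψ v z x‖ := by
    intro z
    simp only [hfact]
    rw [← Finset.mul_expect, norm_mul, hEnorm, one_mul, ← norm_prod]
    rw [expect_prod_of_dependsOn M I (φ := fun v x => ψ v z x) (fun v _ => ?_) hdisjI]
    intro x x' hx
    have e : (I v).piecewise x z = (I v).piecewise x' z := by
      funext i
      by_cases hi : i ∈ I v
      · simp [Finset.piecewise, hi, hx i hi]
      · simp [Finset.piecewise, hi]
    simp only [hψ, e]
  change ‖𝔼 x, E (partialWeight Finset.univ (g x))‖ ≤ _
  calc ‖𝔼 x, E (partialWeight Finset.univ (g x))‖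
      = ‖𝔼 z, 𝔼 x, E (partialWeight Finset.univ (g (B.piecewise x z)))‖ := by
        rw [expect_piecewise B (fun x => E (partialWeight Finset.univ (g x)))]
    _ ≤ 𝔼 z, ‖𝔼 x, E (partialWeight Finset.univ (g (B.piecewise x z)))‖ :=
        RCLike.norm_expect_le (K := ℝ)
    _ = 𝔼 z, ∏ v ∈ M, ‖𝔼 x, ψ v z x‖ := Finset.expect_congr rfl fun z _ => hinner z
    _ = ∏ v ∈ M, 𝔼 z, ‖𝔼 x, ψ v z x‖ := by
        refine expect_prod_of_dependsOn M J (φ := fun v z => ‖𝔼 x, ψ v z x‖) (fun v hv => ?_)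
          hB.disjoint_inputs
        intro z z' hz
        simp only
        congr 1
        refine Finset.expect_congr rfl fun x _ => ?_
        simp only [hψ]
        congr 2
        refine dependsOn_partialWeight (N v) fun u hu => hI u fun i hi => ?_
        have hiJ := hB.inputs_subset v hv u hu hi
        by_cases hiv : i ∈ I v
        · simp [Finset.piecewise, hiv]
        · simp [Finset.piecewise, hiv, hz i hiJ]
    _ ≤ ∏ _v ∈ M, Real.exp (-c * Real.sin θ ^ 2) := by
        refine Finset.prod_le_prod (fun v _ => Finset.expect_nonneg fun _ _ => norm_nonneg _)
          fun v hv => ?_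
        exact H hI (hB.self_mem v hv) (hB.inputs_subset v hv) (hJq v hv) (hNq v hv) (hU v hv) θ
    _ = _ := by
        rw [Finset.prod_const, ← Real.exp_nat_mul]
        congr 1
        ring

end CharFun

section Fourier

open scoped BigOperators Interval
open MeasureTheory

lemma integral_cexp_int_mul (k : ℤ) :
    ∫ θ in (-(Real.pi / 2))..(3 * Real.pi / 2), Complex.exp (((θ * k : ℝ) : ℂ) * Complex.I)
      = if k = 0 then (2 * Real.pi : ℂ) else 0 := by
  split_ifs with hk
  · subst hk
    simp only [Int.cast_zero, mul_zero, Complex.ofReal_zero, zero_mul, Complex.exp_zero,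
      intervalIntegral.integral_const]
    rw [Complex.real_smul, mul_one]
    push_cast
    ring
  · have hc : (k : ℂ) * Complex.I ≠ 0 := mul_ne_zero (by exact_mod_cast hk) Complex.I_ne_zero
    have e : ∀ θ : ℝ, Complex.exp (((θ * k : ℝ) : ℂ) * Complex.I)
        = Complex.exp ((k : ℂ) * Complex.I * θ) := by
      intro θ; congr 1; push_cast; ring
    simp only [e]
    rw [integral_exp_mul_complex hc]
    have e2 : (k : ℂ) * Complex.I * ((3 * Real.pi / 2 : ℝ) : ℂ)
        = (k : ℂ) * Complex.I * ((-(Real.pi / 2) : ℝ) : ℂ) + k * (2 * Real.pi * Complex.I) := by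
      push_cast; ring
    rw [e2, Complex.exp_periodic.int_mul k, sub_self, zero_div]

lemma integral_mul_exp_neg_sq {b : ℝ} (hb : 0 < b) (c : ℝ) :
    ∫ θ in (0 : ℝ)..c, θ * Real.exp (-b * θ ^ 2) ≤ 1 / (2 * b) := by
  have hd : ∀ θ ∈ [[(0 : ℝ), c]], HasDerivAt (fun θ : ℝ => -(1 / (2 * b)) * Real.exp (-b * θ ^ 2))
      (θ * Real.exp (-b * θ ^ 2)) θ := by
    intro θ _
    have h1 : HasDerivAt (fun θ : ℝ => -b * θ ^ 2) (-b * (2 * θ)) θ := by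
      simpa using (hasDerivAt_pow 2 θ).const_mul (-b)
    have h2 : θ * Real.exp (-b * θ ^ 2)
        = -(1 / (2 * b)) * (Real.exp (-b * θ ^ 2) * (-b * (2 * θ))) := by
      field_simp
    rw [h2]
    exact h1.exp.const_mul (-(1 / (2 * b)))
  rw [intervalIntegral.integral_eq_sub_of_hasDerivAt hd
    (Continuous.intervalIntegrable (by fun_prop) _ _)]
  have : 0 ≤ 1 / (2 * b) * Real.exp (-b * c ^ 2) := by positivity
  simp only [ne_eq, OfNat.ofNat_ne_zero, not_false_eq_true, zero_pow, mul_zero, Real.exp_zero,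
    mul_one]
  linarith

lemma integral_abs_mul_exp_neg_sq {b : ℝ} (hb : 0 < b) (c : ℝ) :
    ∫ θ in (-c)..c, |θ| * Real.exp (-b * θ ^ 2) ≤ 1 / b := by
  by_cases hc : c ≤ 0
  · rw [intervalIntegral.integral_symm]
    have : 0 ≤ ∫ θ in c..(-c), |θ| * Real.exp (-b * θ ^ 2) :=
      intervalIntegral.integral_nonneg (by linarith) fun θ _ => by positivity
    have : 0 < 1 / b := by positivity
    linarith
  push Not at hc
  have hInt : ∀ u v, IntervalIntegrable (fun θ : ℝ => |θ| * Real.exp (-b * θ ^ 2)) volume u v :=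
    fun u v => Continuous.intervalIntegrable (by fun_prop) _ _
  rw [← intervalIntegral.integral_add_adjacent_intervals (hInt (-c) 0) (hInt 0 c)]
  have h1 : ∫ θ in (0 : ℝ)..c, |θ| * Real.exp (-b * θ ^ 2) ≤ 1 / (2 * b) := by
    refine le_trans (le_of_eq ?_) (integral_mul_exp_neg_sq hb c)
    refine intervalIntegral.integral_congr fun θ hθ => ?_
    rw [Set.uIcc_of_le hc.le] at hθ
    rw [abs_of_nonneg hθ.1]
  have h2 : ∫ θ in (-c)..0, |θ| * Real.exp (-b * θ ^ 2)
      = ∫ θ in (0 : ℝ)..c, |θ| * Real.exp (-b * θ ^ 2) := by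
    have := intervalIntegral.integral_comp_neg (a := 0) (b := c)
      (fun θ : ℝ => |θ| * Real.exp (-b * θ ^ 2))
    simp only [abs_neg, neg_zero, neg_sq] at this
    rw [this]
  rw [h2]
  have : 1 / b = 1 / (2 * b) + 1 / (2 * b) := by field_simp; norm_num
  linarith

lemma integral_abs_sin_mul_exp {A : ℝ} (hA : 0 < A) :
    ∫ θ in (-(Real.pi / 2))..(3 * Real.pi / 2), |Real.sin θ| * Real.exp (-A * Real.sin θ ^ 2)
      ≤ Real.pi ^ 2 / (2 * A) := by
  have hπ := Real.pi_pos
  set f : ℝ → ℝ := fun θ => |Real.sin θ| * Real.exp (-A * Real.sin θ ^ 2) with hf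
  have hfc : Continuous f := by fun_prop
  have hInt : ∀ u v, IntervalIntegrable f volume u v := fun u v => hfc.intervalIntegrable _ _
  rw [← intervalIntegral.integral_add_adjacent_intervals (hInt (-(Real.pi / 2)) (Real.pi / 2))
    (hInt (Real.pi / 2) (3 * Real.pi / 2))]
  have hper : ∫ θ in (Real.pi / 2)..(3 * Real.pi / 2), f θ
      = ∫ θ in (-(Real.pi / 2))..(Real.pi / 2), f θ := by
    have h1 := intervalIntegral.integral_comp_add_right (a := -(Real.pi / 2)) (b := Real.pi / 2)
      f Real.pi
    have e1 : -(Real.pi / 2) + Real.pi = Real.pi / 2 := by ring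
    have e2 : Real.pi / 2 + Real.pi = 3 * Real.pi / 2 := by ring
    rw [e1, e2] at h1
    rw [← h1]
    refine intervalIntegral.integral_congr fun θ _ => ?_
    simp [hf, Real.sin_add_pi]
  rw [hper]
  have hb : 0 < 4 * A / Real.pi ^ 2 := by positivity
  have hmain : ∫ θ in (-(Real.pi / 2))..(Real.pi / 2), f θ ≤ 1 / (4 * A / Real.pi ^ 2) := by
    refine le_trans ?_ (integral_abs_mul_exp_neg_sq hb (Real.pi / 2))
    refine intervalIntegral.integral_mono_on (by linarith) (hInt _ _)
      (Continuous.intervalIntegrable (by fun_prop) _ _) fun θ hθ => ?_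
    have habs : |θ| ≤ Real.pi / 2 := abs_le.2 ⟨hθ.1, hθ.2⟩
    have hs := Real.mul_abs_le_abs_sin habs
    refine mul_le_mul Real.abs_sin_le_abs (Real.exp_le_exp.2 ?_) (Real.exp_pos _).le (abs_nonneg _)
    have hsq : (2 / Real.pi * |θ|) ^ 2 ≤ Real.sin θ ^ 2 := by
      rw [← sq_abs (Real.sin θ)]
      gcongr
    have e : 4 * A / Real.pi ^ 2 * θ ^ 2 = A * (2 / Real.pi * |θ|) ^ 2 := by
      rw [mul_pow, sq_abs]; field_simp; ring
    rw [neg_mul, neg_mul, e]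
    exact neg_le_neg (mul_le_mul_of_nonneg_left hsq hA.le)
  have e : Real.pi ^ 2 / (2 * A) = 1 / (4 * A / Real.pi ^ 2) + 1 / (4 * A / Real.pi ^ 2) := by
    field_simp; norm_num
  linarith

/-- Fourier inversion: Gaussian-like decay of the characteristic function away from `0` and `π`
bounds the differences of the mass function at distance two. -/
lemma abs_mass_sub_mass_le {α : Type*} [Fintype α] (W : α → ℕ) {A : ℝ} (hA : 0 < A)
    (h : ∀ θ : ℝ, ‖𝔼 x, Complex.exp (((θ * W x : ℝ) : ℂ) * Complex.I)‖
      ≤ Real.exp (-A * Real.sin θ ^ 2)) (j : ℤ) :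
    |(𝔼 x, if (W x : ℤ) = j then (1 : ℝ) else 0) - 𝔼 x, if (W x : ℤ) = j + 2 then (1 : ℝ) else 0|
      ≤ 2 / A := by
  have hπ := Real.pi_pos
  set e : ℤ → ℝ → ℂ := fun k θ => Complex.exp (((θ * k : ℝ) : ℂ) * Complex.I) with he
  have hec : ∀ k, Continuous (e k) := fun k => by fun_prop
  have hInt : ∀ k, IntervalIntegrable (e k) volume (-(Real.pi / 2)) (3 * Real.pi / 2) :=
    fun k => (hec k).intervalIntegrable _ _
  have hmass : ∀ j : ℤ, ((2 * Real.pi * 𝔼 x, if (W x : ℤ) = j then (1 : ℝ) else 0 : ℝ) : ℂ)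
      = 𝔼 x, ∫ θ in (-(Real.pi / 2))..(3 * Real.pi / 2), e (W x - j) θ := by
    intro j
    push_cast
    rw [Finset.mul_expect]
    refine Finset.expect_congr rfl fun x _ => ?_
    rw [he]
    simp only
    rw [integral_cexp_int_mul]
    simp only [sub_eq_zero]
    split_ifs <;> simp
  have hdiff : ((2 * Real.pi * ((𝔼 x, if (W x : ℤ) = j then (1 : ℝ) else 0)
      - 𝔼 x, if (W x : ℤ) = j + 2 then (1 : ℝ) else 0) : ℝ) : ℂ)
      = ∫ θ in (-(Real.pi / 2))..(3 * Real.pi / 2),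
        (𝔼 x, Complex.exp (((θ * W x : ℝ) : ℂ) * Complex.I)) * (e (-j) θ - e (-(j + 2)) θ) := by
    rw [mul_sub, Complex.ofReal_sub, hmass, hmass, ← Finset.expect_sub_distrib]
    have h1 : ∀ x, (∫ θ in (-(Real.pi / 2))..(3 * Real.pi / 2), e (W x - j) θ)
        - ∫ θ in (-(Real.pi / 2))..(3 * Real.pi / 2), e (W x - (j + 2)) θ
        = ∫ θ in (-(Real.pi / 2))..(3 * Real.pi / 2),
          (Complex.exp (((θ * W x : ℝ) : ℂ) * Complex.I)) * (e (-j) θ - e (-(j + 2)) θ) := by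
      intro x
      rw [← intervalIntegral.integral_sub (hInt _) (hInt _)]
      refine intervalIntegral.integral_congr fun θ _ => ?_
      simp only [he]
      rw [mul_sub, ← Complex.exp_add, ← Complex.exp_add]
      congr 2 <;> (push_cast; ring)
    simp only [h1]
    rw [Fintype.expect_eq_sum_div_card, ← intervalIntegral.integral_finsetSum,
      ← intervalIntegral.integral_div]
    · refine intervalIntegral.integral_congr fun θ _ => ?_
      rw [Fintype.expect_eq_sum_div_card, ← Finset.sum_mul]
      ring
    · intro x _
      exact Continuous.intervalIntegrable (by fun_prop) _ _
  have hnorm : ∀ θ, ‖e (-j) θ - e (-(j + 2)) θ‖ = 2 * |Real.sin θ| := by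
    intro θ
    have h1 : e (-j) θ - e (-(j + 2)) θ = e (-(j + 1)) θ * (2 * Complex.I * (Real.sin θ : ℂ)) := by
      have hsin : (2 : ℂ) * Complex.I * (Real.sin θ : ℂ) = e 1 θ - e (-1) θ := by
        simp only [he]
        rw [Complex.ofReal_sin, Complex.sin]
        have : ((θ * ((1 : ℤ) : ℝ) : ℝ) : ℂ) * Complex.I = θ * Complex.I := by push_cast; ring
        rw [this]
        have : ((θ * ((-1 : ℤ) : ℝ) : ℝ) : ℂ) * Complex.I = -θ * Complex.I := by push_cast; ring
        rw [this]
        linear_combination (Complex.exp (-θ * Complex.I) - Complex.exp (θ * Complex.I)) *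
          Complex.I_mul_I
      rw [hsin, mul_sub]
      simp only [he]
      rw [← Complex.exp_add, ← Complex.exp_add]
      congr 2 <;> (push_cast; ring)
    rw [h1, norm_mul]
    simp only [he]
    rw [Complex.norm_exp_ofReal_mul_I, norm_mul, norm_mul, Complex.norm_real, Real.norm_eq_abs]
    simp
  have hbound : ‖∫ θ in (-(Real.pi / 2))..(3 * Real.pi / 2),
      (𝔼 x, Complex.exp (((θ * W x : ℝ) : ℂ) * Complex.I)) * (e (-j) θ - e (-(j + 2)) θ)‖
      ≤ ∫ θ in (-(Real.pi / 2))..(3 * Real.pi / 2),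
        2 * (|Real.sin θ| * Real.exp (-A * Real.sin θ ^ 2)) := by
    refine intervalIntegral.norm_integral_le_of_norm_le (by linarith)
      (Filter.Eventually.of_forall fun θ _ => ?_)
      (Continuous.intervalIntegrable (by fun_prop) _ _)
    rw [norm_mul, hnorm]
    have := h θ
    have hs := abs_nonneg (Real.sin θ)
    nlinarith
  rw [← hdiff, Complex.norm_real, intervalIntegral.integral_const_mul, norm_mul,
    Real.norm_of_nonneg (by positivity), Real.norm_eq_abs] at hbound
  have hi := integral_abs_sin_mul_exp hA
  have hfin : 2 * Real.pi * |(𝔼 x, if (W x : ℤ) = j then (1 : ℝ) else 0)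
      - 𝔼 x, if (W x : ℤ) = j + 2 then (1 : ℝ) else 0| ≤ 2 * Real.pi * (2 / A) := by
    refine hbound.trans ?_
    calc _ ≤ 2 * (Real.pi ^ 2 / (2 * A)) := by gcongr
      _ = Real.pi / A * Real.pi := by field_simp
      _ ≤ Real.pi / A * 4 := by gcongr; exact Real.pi_le_four
      _ = 2 * Real.pi * (2 / A) := by field_simp; norm_num
  exact le_of_mul_le_mul_left hfin (by positivity)

end Fourier

section Graph

variable {ι κ : Type} [Fintype ι] [DecidableEq ι] [Fintype κ] [DecidableEq κ]

/-- The outputs reading the input `j`. -/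
def readers (I : κ → Finset ι) (j : ι) : Finset κ := Finset.univ.filter fun u => j ∈ I u

/-- The inputs read by more than `t` outputs. -/
def heavyInputs (I : κ → Finset ι) (t : ℕ) : Finset ι :=
  Finset.univ.filter fun j => t < (readers I j).card

/-- The dependency sets after fixing all heavy inputs. -/
def prune (I : κ → Finset ι) (t : ℕ) (u : κ) : Finset ι := I u \ heavyInputs I t

/-- The output `v` together with all outputs sharing an input with it. -/
def neighborhood (I : κ → Finset ι) (v : κ) : Finset κ :=
  Finset.univ.filter fun u => u = v ∨ ¬Disjoint (I u) (I v)

/-- The inputs read by the neighbourhood of `v`. -/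
def neighborhoodInputs (I : κ → Finset ι) (v : κ) : Finset ι := (neighborhood I v).biUnion I

/-- After fixing the inputs heavier than `t'`, all inputs around `v` are of degree at most `t`. -/
def IsTame (I : κ → Finset ι) (t t' : ℕ) (v : κ) : Prop :=
  ∀ j ∈ neighborhoodInputs (prune I t') v, (readers I j).card ≤ t

variable {I : κ → Finset ι} {d t t' : ℕ} {u v w : κ} {j : ι}

lemma mem_readers : u ∈ readers I j ↔ j ∈ I u := by simp [readers]

lemma mem_prune : j ∈ prune I t u ↔ j ∈ I u ∧ (readers I j).card ≤ t := by
  simp [prune, heavyInputs]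

lemma prune_subset : prune I t u ⊆ I u := Finset.sdiff_subset

lemma prune_mono (h : t ≤ t') : prune I t u ⊆ prune I t' u := fun j hj => by
  rw [mem_prune] at hj ⊢
  exact ⟨hj.1, hj.2.trans h⟩

lemma mem_neighborhood : u ∈ neighborhood I v ↔ u = v ∨ ¬Disjoint (I u) (I v) := by
  simp [neighborhood]

lemma self_mem_neighborhood (I : κ → Finset ι) (v : κ) : v ∈ neighborhood I v :=
  mem_neighborhood.2 (Or.inl rfl)

lemma subset_neighborhoodInputs (h : u ∈ neighborhood I v) : I u ⊆ neighborhoodInputs I v :=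
  Finset.subset_biUnion_of_mem I h

lemma card_neighborhood_le (hd : (I v).card ≤ d)
    (ht : ∀ j ∈ prune I t' v, (readers I j).card ≤ t) :
    (neighborhood (prune I t') v).card ≤ 1 + d * t := by
  have hsub : neighborhood (prune I t') v ⊆ insert v ((prune I t' v).biUnion (readers I)) := by
    intro u hu
    rcases mem_neighborhood.1 hu with rfl | hu
    · exact Finset.mem_insert_self _ _
    · obtain ⟨j, hju, hjv⟩ := Finset.not_disjoint_iff.1 hu
      exact Finset.mem_insert_of_mem
        (Finset.mem_biUnion.2 ⟨j, hjv, mem_readers.2 (prune_subset hju)⟩)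
  calc _ ≤ _ := Finset.card_le_card hsub
    _ ≤ ((prune I t' v).biUnion (readers I)).card + 1 := Finset.card_insert_le _ _
    _ ≤ (prune I t' v).card * t + 1 := by
        gcongr; exact Finset.card_biUnion_le_card_mul _ _ _ ht
    _ ≤ d * t + 1 := by gcongr; exact (Finset.card_le_card prune_subset).trans hd
    _ = 1 + d * t := add_comm _ _

lemma card_neighborhoodInputs_le (hI : ∀ u, (I u).card ≤ d)
    (ht : ∀ j ∈ prune I t' v, (readers I j).card ≤ t) :
    (neighborhoodInputs (prune I t') v).card ≤ d * (1 + d * t) :=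
  calc _ ≤ (neighborhood (prune I t') v).card * d := Finset.card_biUnion_le_card_mul _ _ _
          fun u _ => (Finset.card_le_card prune_subset).trans (hI u)
    _ ≤ (1 + d * t) * d := by gcongr; exact card_neighborhood_le (hI v) ht
    _ = _ := mul_comm _ _

lemma IsTame.prune_card_le (h : IsTame I t t' v) : ∀ j ∈ prune I t' v, (readers I j).card ≤ t :=
  fun j hj => h j (subset_neighborhoodInputs (self_mem_neighborhood _ _) hj)

lemma neighborhood_mono (h : t ≤ t') : neighborhood (prune I t) v ⊆ neighborhood (prune I t') v := by
  intro u hu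
  rw [mem_neighborhood] at hu ⊢
  exact hu.imp_right (mt fun hd => hd.mono (prune_mono h) (prune_mono h))

lemma neighborhoodInputs_mono (h : t ≤ t') :
    neighborhoodInputs (prune I t) v ⊆ neighborhoodInputs (prune I t') v :=
  (Finset.biUnion_subset_biUnion_of_subset_left _ (neighborhood_mono h)).trans
    (Finset.biUnion_mono fun _ _ => prune_mono h)

lemma card_lt_of_not_isTame (h : t ≤ t') (hv : ¬IsTame I t t' v) :
    (neighborhoodInputs (prune I t) v).card < (neighborhoodInputs (prune I t') v).card := by
  simp only [IsTame, not_forall] at hv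
  obtain ⟨j, hj, hjt⟩ := hv
  refine Finset.card_lt_card ((Finset.ssubset_iff_of_subset (neighborhoodInputs_mono h)).2
    ⟨j, hj, fun hj' => hjt ?_⟩)
  obtain ⟨u, -, hu⟩ := Finset.mem_biUnion.1 hj'
  exact (mem_prune.1 hu).2

/-- If the inputs of `v` keep their status along a long enough stretch of thresholds, then `v` is
tame at some point of the stretch. -/
lemma exists_isTame_of_prune_eq (hI : ∀ u, (I u).card ≤ d) {T : ℕ → ℕ} (hT : Monotone T) (p R : ℕ)
    (hR : d * (1 + d * T p) < R) (hp : prune I (T (p + R)) v = prune I (T p) v) :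
    ∃ ℓ, ℓ < p + R ∧ IsTame I (T ℓ) (T (ℓ + 1)) v := by
  by_contra! hcon
  have hgrow : ∀ k ≤ R, k ≤ (neighborhoodInputs (prune I (T (p + k))) v).card := by
    intro k
    induction k with
    | zero => intro _; exact Nat.zero_le _
    | succ k ih =>
      intro hk
      have h1 := ih (by omega)
      have h2 := card_lt_of_not_isTame (hT (Nat.le_succ (p + k))) (hcon (p + k) (by omega))
      have h3 : p + (k + 1) = (p + k).succ := rfl
      rw [h3]
      omega
  have h1 := hgrow R le_rfl
  have h2 := card_neighborhoodInputs_le (v := v) (t := T p) (t' := T (p + R)) hI (by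
    intro j hj
    rw [hp] at hj
    exact (mem_prune.1 hj).2)
  omega

/-- The horizon within which every output becomes tame. -/
def tameHorizon (d : ℕ) (T : ℕ → ℕ) : ℕ → ℕ → ℕ
  | 0, p => p + (d * (1 + d * T p) + 1)
  | k + 1, p => tameHorizon d T k (p + (d * (1 + d * T p) + 1))

lemma lt_tameHorizon (d : ℕ) (T : ℕ → ℕ) (k p : ℕ) : p < tameHorizon d T k p := by
  induction k generalizing p with
  | zero => simp only [tameHorizon]; omega
  | succ k ih =>
    have := ih (p + (d * (1 + d * T p) + 1))
    simp only [tameHorizon]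
    omega

lemma exists_isTame (hI : ∀ u, (I u).card ≤ d) {T : ℕ → ℕ} (hT : Monotone T) (v : κ) (k p : ℕ)
    (hk : (I v).card ≤ (prune I (T p) v).card + k) :
    ∃ ℓ, ℓ < tameHorizon d T k p ∧ IsTame I (T ℓ) (T (ℓ + 1)) v := by
  induction k generalizing p with
  | zero =>
    refine exists_isTame_of_prune_eq hI hT p _ (Nat.lt_succ_self _) ?_
    have h1 : prune I (T p) v = I v := Finset.eq_of_subset_of_card_le prune_subset hk
    exact (prune_subset.trans h1.ge).antisymm (prune_mono (hT (Nat.le_add_right _ _)))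
  | succ k ih =>
    set R := d * (1 + d * T p) + 1 with hR
    by_cases hp : prune I (T (p + R)) v = prune I (T p) v
    · obtain ⟨ℓ, hℓ, h⟩ := exists_isTame_of_prune_eq hI hT p R (Nat.lt_succ_self _) hp
      exact ⟨ℓ, hℓ.trans (lt_tameHorizon d T k (p + R)), h⟩
    · refine ih (p + R) ?_
      have hss : prune I (T p) v ⊂ prune I (T (p + R)) v :=
        (prune_mono (hT (Nat.le_add_right _ _))).ssubset_of_ne (Ne.symm hp)
      have := Finset.card_lt_card hss
      omega

/-- A maximal independent set is large when all conflict sets are small. -/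
lemma exists_independent {α : Type*} [DecidableEq α] (r : α → α → Prop) (hr : ∀ v w, r v w → r w v)
    [DecidableRel r] (B : ℕ) (V : Finset α)
    (hB : ∀ v ∈ V, (V.filter fun w => w = v ∨ r v w).card ≤ B) :
    ∃ M ⊆ V, (∀ v ∈ M, ∀ w ∈ M, v ≠ w → ¬r v w) ∧ V.card ≤ M.card * B := by
  induction V using Finset.strongInduction with
  | H V ih =>
    rcases V.eq_empty_or_nonempty with rfl | ⟨v, hv⟩
    · exact ⟨∅, subset_rfl, by simp, by simp⟩
    set K := V.filter fun w => w = v ∨ r v w with hK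
    have hvK : v ∈ K := Finset.mem_filter.2 ⟨hv, Or.inl rfl⟩
    have hKV : K ⊆ V := Finset.filter_subset _ _
    obtain ⟨M, hMV, hM, hcard⟩ := ih (V \ K) (Finset.sdiff_ssubset hKV ⟨v, hvK⟩) fun w hw =>
      (Finset.card_le_card (Finset.filter_subset_filter _ Finset.sdiff_subset)).trans
        (hB w (Finset.sdiff_subset hw))
    have hnot : ∀ w ∈ M, w ≠ v ∧ ¬r v w := by
      intro w hw
      have := hMV hw
      simp only [hK, Finset.mem_sdiff, Finset.mem_filter, not_and, not_or] at this
      exact this.2 this.1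
    have hvM : v ∉ M := fun h => (hnot v h).1 rfl
    refine ⟨insert v M, Finset.insert_subset hv (hMV.trans Finset.sdiff_subset), ?_, ?_⟩
    · intro a ha b hb hab
      rcases Finset.mem_insert.1 ha with ha' | ha' <;>
        rcases Finset.mem_insert.1 hb with hb' | hb'
      · exact absurd (ha'.trans hb'.symm) hab
      · exact ha' ▸ (hnot b hb').2
      · exact hb' ▸ fun h => (hnot a ha').2 (hr _ _ (hb' ▸ h))
      · exact hM a ha' b hb' hab
    · rw [Finset.card_insert_of_notMem hvM]
      have h1 := Finset.card_sdiff_add_card_eq_card hKV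
      have h2 : K.card ≤ B := hB v hv
      rw [add_mul]
      omega

lemma exists_le_card_mul_two_pow {α : Type*} [Fintype α] [DecidableEq α] {L : ℕ} (hL : 0 < L)
    (V : ℕ → Finset α) (hV : ∀ a, ∃ ℓ, ℓ < L ∧ a ∈ V ℓ) :
    ∃ ℓ, ℓ < L ∧ Fintype.card α ≤ (V ℓ).card * 2 ^ (ℓ + 1) := by
  by_contra! hcon
  have h0 : (0 : ℝ) < Fintype.card α := by
    have := hcon 0 hL
    exact_mod_cast (Nat.zero_le _).trans_lt this
  have hsum : (Fintype.card α : ℝ) ≤ ∑ ℓ ∈ Finset.range L, ((V ℓ).card : ℝ) := by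
    have h1 : (Finset.univ : Finset α) ⊆ (Finset.range L).biUnion V := by
      intro a _
      obtain ⟨ℓ, hℓ, ha⟩ := hV a
      exact Finset.mem_biUnion.2 ⟨ℓ, Finset.mem_range.2 hℓ, ha⟩
    have h2 := (Finset.card_le_card h1).trans Finset.card_biUnion_le
    rw [Finset.card_univ] at h2
    exact_mod_cast h2
  have hle : ∀ k ≤ L, ∑ ℓ ∈ Finset.range k, ((V ℓ).card : ℝ)
      ≤ Fintype.card α * (1 - (1 / 2) ^ k) := by
    intro k
    induction k with
    | zero => simp
    | succ k ih =>
      intro hk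
      have h1 : ((V k).card : ℝ) * 2 ^ (k + 1) ≤ Fintype.card α := by
        exact_mod_cast (hcon k (by omega)).le
      have h2 : ((V k).card : ℝ) ≤ Fintype.card α * (1 / 2) ^ (k + 1) := by
        rw [one_div, inv_pow, ← div_eq_mul_inv, le_div_iff₀ (by positivity)]
        exact h1
      rw [Finset.sum_range_succ]
      have h3 := ih (by omega)
      have h4 : (1 / 2 : ℝ) ^ k = 2 * (1 / 2) ^ (k + 1) := by rw [pow_succ]; ring
      rw [h4] at h3
      linarith
  have h1 := hle L le_rfl
  have h2 : (0 : ℝ) < Fintype.card α * (1 / 2) ^ L := by positivity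
  linarith

lemma card_heavyInputs_mul_le (hI : ∀ u, (I u).card ≤ d) (t : ℕ) :
    (heavyInputs I t).card * t ≤ Fintype.card κ * d := by
  calc _ = ∑ j ∈ heavyInputs I t, t := by rw [Finset.sum_const, smul_eq_mul]
    _ ≤ ∑ j ∈ heavyInputs I t, (readers I j).card :=
        Finset.sum_le_sum fun j hj => (Finset.mem_filter.1 hj).2.le
    _ ≤ ∑ j, (readers I j).card :=
        Finset.sum_le_sum_of_subset (Finset.subset_univ _)
    _ = ∑ u, (I u).card := by
        simp only [readers, Finset.card_filter]
        rw [Finset.sum_comm]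
        refine Finset.sum_congr rfl fun u _ => ?_
        simp
    _ ≤ ∑ _u : κ, d := Finset.sum_le_sum fun u _ => hI u
    _ = _ := by simp

/-- The bound on the number of outputs conflicting with a given tame output. -/
def conflictBound (d t : ℕ) : ℕ := 1 + d * (1 + d * t) * (t * (1 + d * t))

lemma conflictBound_mono : Monotone (conflictBound d) := fun a b h => by
  unfold conflictBound
  gcongr

lemma card_conflict_le (hI : ∀ u, (I u).card ≤ d) (V : Finset κ)
    (hV : ∀ v ∈ V, IsTame I t t' v) (hv : v ∈ V) :
    (V.filter fun w => w = v ∨ ¬Disjoint (neighborhoodInputs (prune I t') v)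
      (neighborhoodInputs (prune I t') w)).card ≤ conflictBound d t := by
  set K : κ → Finset κ := fun u =>
    insert u (((I u).filter fun j => (readers I j).card ≤ t).biUnion (readers I)) with hK
  have hsub : (V.filter fun w => w = v ∨ ¬Disjoint (neighborhoodInputs (prune I t') v)
      (neighborhoodInputs (prune I t') w))
      ⊆ insert v ((neighborhoodInputs (prune I t') v).biUnion fun j => (readers I j).biUnion K) := by
    intro w hw
    obtain ⟨hwV, rfl | hw⟩ := Finset.mem_filter.1 hw
    · exact Finset.mem_insert_self _ _
    obtain ⟨j, hjv, hjw⟩ := Finset.not_disjoint_iff.1 hw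
    obtain ⟨u, hu, hju⟩ := Finset.mem_biUnion.1 hjw
    refine Finset.mem_insert_of_mem (Finset.mem_biUnion.2 ⟨j, hjv, Finset.mem_biUnion.2
      ⟨u, mem_readers.2 (prune_subset hju), ?_⟩⟩)
    rcases mem_neighborhood.1 hu with rfl | hu
    · exact Finset.mem_insert_self _ _
    obtain ⟨i, hiu, hiw⟩ := Finset.not_disjoint_iff.1 hu
    exact Finset.mem_insert_of_mem (Finset.mem_biUnion.2 ⟨i, Finset.mem_filter.2
      ⟨prune_subset hiu, (hV w hwV).prune_card_le i hiw⟩, mem_readers.2 (prune_subset hiw)⟩)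
  have hKcard : ∀ u, (K u).card ≤ 1 + d * t := by
    intro u
    calc _ ≤ _ := Finset.card_insert_le _ _
      _ ≤ ((I u).filter fun j => (readers I j).card ≤ t).card * t + 1 := by
          gcongr
          exact Finset.card_biUnion_le_card_mul _ _ _ fun j hj => (Finset.mem_filter.1 hj).2
      _ ≤ d * t + 1 := by gcongr; exact (Finset.card_filter_le _ _).trans (hI u)
      _ = _ := add_comm _ _
  calc _ ≤ _ := Finset.card_le_card hsub
    _ ≤ _ := Finset.card_insert_le _ _
    _ ≤ (neighborhoodInputs (prune I t') v).card * (t * (1 + d * t)) + 1 := by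
        gcongr
        refine Finset.card_biUnion_le_card_mul _ _ _ fun j hj => ?_
        refine (Finset.card_biUnion_le_card_mul _ _ _ fun u _ => hKcard u).trans ?_
        gcongr
        exact hV v hv j hj
    _ ≤ d * (1 + d * t) * (t * (1 + d * t)) + 1 := by
        gcongr
        exact card_neighborhoodInputs_le hI (hV v hv).prune_card_le
    _ = _ := add_comm _ _

lemma blockSystem_neighborhood (I : κ → Finset ι) (M : Finset κ)
    (hM : ∀ v ∈ M, ∀ w ∈ M, v ≠ w →
      Disjoint (neighborhoodInputs I v) (neighborhoodInputs I w)) :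
    BlockSystem I M (neighborhood I) (neighborhoodInputs I) where
  self_mem v _ := self_mem_neighborhood I v
  mem_of_not_disjoint v _ u hu := mem_neighborhood.2 (Or.inr hu)
  inputs_subset v _ u hu := subset_neighborhoodInputs hu
  disjoint_inputs v hv w hw hvw := hM v hv w hw hvw
  disjoint_outputs v hv w hw hvw := by
    refine Finset.disjoint_left.2 fun u huv huw => ?_
    have hne : (I u).Nonempty := by
      by_contra hemp
      rw [Finset.not_nonempty_iff_eq_empty] at hemp
      have h1 := mem_neighborhood.1 huv
      have h2 := mem_neighborhood.1 huw
      simp only [hemp, Finset.disjoint_empty_left, not_true, or_false] at h1 h2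
      exact hvw (h1.symm.trans h2)
    obtain ⟨j, hj⟩ := hne
    exact Finset.disjoint_left.1 (hM v hv w hw hvw) (subset_neighborhoodInputs huv hj)
      (subset_neighborhoodInputs huw hj)

/-- The rapidly growing thresholds. -/
def thresholds (d : ℕ) (Λ : ℕ → ℕ) : ℕ → ℕ
  | 0 => 1
  | ℓ + 1 => thresholds d Λ ℓ + d * 2 ^ (ℓ + 1) * conflictBound d (thresholds d Λ ℓ) *
      Λ (thresholds d Λ ℓ)

lemma thresholds_monotone (d : ℕ) (Λ : ℕ → ℕ) : Monotone (thresholds d Λ) :=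
  monotone_nat_of_le_succ fun ℓ => by rw [thresholds]; exact Nat.le_add_right _ _

end Graph

/-- A bounded-degree hypergraph becomes locally sparse after the deletion of a negligible set of
vertices, with linearly many well separated neighbourhoods. -/
lemma exists_blockSystem {d : ℕ} (hd : 1 ≤ d) (Λ : ℕ → ℕ) :
    ∃ ν tmax : ℕ, ∀ {ι κ : Type} [Fintype ι] [DecidableEq ι] [Fintype κ] [DecidableEq κ]
      (I : κ → Finset ι), (∀ u, (I u).card ≤ d) →
      ∃ (S : Finset ι) (t : ℕ) (M : Finset κ) (N : κ → Finset κ) (J : κ → Finset ι),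
        t ≤ tmax ∧ BlockSystem (fun u => I u \ S) M N J ∧
        (∀ v ∈ M, (N v).card ≤ 1 + d * t) ∧ (∀ v ∈ M, (J v).card ≤ d * (1 + d * t)) ∧
        S.card * Λ t ≤ M.card ∧ Fintype.card κ ≤ ν * M.card := by
  classical
  set T := thresholds d Λ with hTdef
  have hT : Monotone T := thresholds_monotone d Λ
  set L := tameHorizon d T d 0 with hL
  refine ⟨2 ^ L * conflictBound d (T L), T L, ?_⟩
  intro ι κ _ _ _ _ I hI
  obtain ⟨ℓ, hℓ, hcard⟩ := exists_le_card_mul_two_pow (lt_tameHorizon d T d 0)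
    (fun ℓ => Finset.univ.filter fun v => IsTame I (T ℓ) (T (ℓ + 1)) v) (fun v => by
      obtain ⟨ℓ, h1, h2⟩ := exists_isTame hI hT v d 0 (by have := hI v; omega)
      exact ⟨ℓ, h1, Finset.mem_filter.2 ⟨Finset.mem_univ _, h2⟩⟩)
  set V := Finset.univ.filter fun v => IsTame I (T ℓ) (T (ℓ + 1)) v with hVdef
  have hV : ∀ v ∈ V, IsTame I (T ℓ) (T (ℓ + 1)) v := fun v hv => (Finset.mem_filter.1 hv).2
  obtain ⟨M, hMV, hM, hVM⟩ := exists_independent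
    (fun v w => ¬Disjoint (neighborhoodInputs (prune I (T (ℓ + 1))) v)
      (neighborhoodInputs (prune I (T (ℓ + 1))) w))
    (fun v w h h' => h h'.symm) (conflictBound d (T ℓ)) V
    (fun v hv => card_conflict_le hI V hV hv)
  have hn : Fintype.card κ ≤ 2 ^ (ℓ + 1) * conflictBound d (T ℓ) * M.card :=
    calc _ ≤ V.card * 2 ^ (ℓ + 1) := hcard
      _ ≤ M.card * conflictBound d (T ℓ) * 2 ^ (ℓ + 1) := by gcongr
      _ = _ := by ring
  refine ⟨heavyInputs I (T (ℓ + 1)), T ℓ, M, _, _, hT hℓ.le,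
    blockSystem_neighborhood (prune I (T (ℓ + 1))) M
      (fun v hv w hw hvw => not_not.1 (hM v hv w hw hvw)), ?_, ?_, ?_, ?_⟩
  · exact fun v hv => card_neighborhood_le (hI v) (hV v (hMV hv)).prune_card_le
  · exact fun v hv => card_neighborhoodInputs_le hI (hV v (hMV hv)).prune_card_le
  · have h1 := card_heavyInputs_mul_le hI (T (ℓ + 1))
    have h2 : d * 2 ^ (ℓ + 1) * conflictBound d (T ℓ) * Λ (T ℓ) ≤ T (ℓ + 1) := by
      rw [hTdef, thresholds]
      exact Nat.le_add_left _ _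
    have hpos : 0 < d * 2 ^ (ℓ + 1) * conflictBound d (T ℓ) := by
      have : 0 < conflictBound d (T ℓ) := by unfold conflictBound; omega
      positivity
    refine Nat.le_of_mul_le_mul_left ?_ hpos
    calc d * 2 ^ (ℓ + 1) * conflictBound d (T ℓ) * ((heavyInputs I (T (ℓ + 1))).card * Λ (T ℓ))
        = (heavyInputs I (T (ℓ + 1))).card *
          (d * 2 ^ (ℓ + 1) * conflictBound d (T ℓ) * Λ (T ℓ)) := by ring
      _ ≤ (heavyInputs I (T (ℓ + 1))).card * T (ℓ + 1) := by gcongr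
      _ ≤ Fintype.card κ * d := h1
      _ ≤ 2 ^ (ℓ + 1) * conflictBound d (T ℓ) * M.card * d := by gcongr
      _ = _ := by ring
  · refine hn.trans ?_
    gcongr
    · norm_num
    · exact hℓ
    · exact conflictBound_mono (hT hℓ.le)

section Binomial

open scoped BigOperators

lemma choose_succ_le_three_mul {n k : ℕ} (h : n ≤ 4 * k + 3) :
    n.choose (k + 1) ≤ 3 * n.choose k := by
  have h1 := Nat.choose_succ_right_eq n k
  have h2 : n.choose k * (n - k) ≤ n.choose k * (3 * (k + 1)) := by gcongr; omega
  refine Nat.le_of_mul_le_mul_right (c := k + 1) ?_ (Nat.succ_pos k)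
  calc _ = n.choose k * (n - k) := h1
    _ ≤ _ := h2
    _ = _ := by ring

lemma choose_add_le_three_pow_mul {n s : ℕ} (h : n ≤ 4 * s + 3) (k : ℕ) :
    n.choose (s + k) ≤ 3 ^ k * n.choose s := by
  induction k with
  | zero => simp
  | succ k ih =>
    calc n.choose (s + (k + 1)) ≤ 3 * n.choose (s + k) :=
          choose_succ_le_three_mul (k := s + k) (by omega)
      _ ≤ 3 * (3 ^ k * n.choose s) := by gcongr
      _ = _ := by ring

lemma two_pow_le_succ_mul_choose_half (n : ℕ) : 2 ^ n ≤ (n + 1) * n.choose (n / 2) := by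
  rw [← Nat.sum_range_choose]
  refine (Finset.sum_le_card_nsmul _ _ (n.choose (n / 2)) fun k _ =>
    Nat.choose_le_middle k n).trans ?_
  simp

/-- Binomial coefficients close to the middle are large. -/
lemma exists_two_pow_le_choose_mul_exp {η : ℝ} (hη : 0 < η) :
    ∃ c : ℝ, 0 < c ∧ ∃ N : ℕ, ∀ n ≥ N, ∀ s ≤ n, |(s : ℝ) - n / 2| ≤ c * n →
      (2 : ℝ) ^ n ≤ n.choose s * Real.exp (η * n) := by
  refine ⟨min (η / 4) (1 / 8), by positivity, ⌈8 / η ^ 2⌉₊, fun n hn s hs h => ?_⟩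
  wlog hsn : s ≤ n / 2 generalizing s
  · have h1 := this (n - s) (Nat.sub_le _ _) (by
      rw [Nat.cast_sub hs, ← abs_neg]
      convert h using 2
      ring) (by omega)
    rwa [Nat.choose_symm hs] at h1
  have hn' : 8 / η ^ 2 ≤ n := Nat.ceil_le.1 hn
  have hn0 : (0 : ℝ) ≤ n := Nat.cast_nonneg n
  have hlow := (abs_le.1 h).1
  have hc1 : min (η / 4) (1 / 8) * n ≤ η / 4 * n := by gcongr; exact min_le_left _ _
  have hc2 : min (η / 4) (1 / 8) * n ≤ 1 / 8 * n := by gcongr; exact min_le_right _ _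
  have h4 : n ≤ 4 * s + 3 := by
    have : (n : ℝ) ≤ 4 * s + 3 := by linarith
    exact_mod_cast this
  set k := n / 2 - s with hk
  have hsk : s + k = n / 2 := by omega
  have hkle : (k : ℝ) ≤ η / 4 * n := by
    have h1 : ((s + k : ℕ) : ℝ) ≤ n / 2 := by rw [hsk]; exact Nat.cast_div_le
    push_cast at h1
    linarith
  have hnat : 2 ^ n ≤ (n + 1) * (3 ^ k * n.choose s) :=
    (two_pow_le_succ_mul_choose_half n).trans (by
      gcongr; rw [← hsk]; exact choose_add_le_three_pow_mul h4 k)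
  have h3 : (3 : ℝ) ^ k ≤ Real.exp (η / 2 * n) := by
    have h31 : (3 : ℝ) ≤ Real.exp 2 := by
      have := Real.add_one_le_exp (2 : ℝ)
      linarith
    calc (3 : ℝ) ^ k ≤ Real.exp 2 ^ k := by gcongr
      _ = Real.exp (k * 2) := (Real.exp_nat_mul 2 k).symm
      _ ≤ _ := Real.exp_le_exp.2 (by linarith)
  have hlin : (n : ℝ) + 1 ≤ Real.exp (η / 2 * n) := by
    have h1 := Real.quadratic_le_exp_of_nonneg (x := η / 2 * n) (by positivity)
    have h2 : 8 ≤ n * η ^ 2 := by rwa [div_le_iff₀ (by positivity)] at hn'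
    have h3 : (η / 2 * n) ^ 2 / 2 = n * η ^ 2 * n / 8 := by ring
    have h4 : 8 * (n : ℝ) ≤ n * η ^ 2 * n := by gcongr
    have h5 : 0 ≤ η / 2 * n := by positivity
    linarith
  calc (2 : ℝ) ^ n ≤ (n + 1) * (3 ^ k * n.choose s) := by exact_mod_cast hnat
    _ ≤ Real.exp (η / 2 * n) * (Real.exp (η / 2 * n) * n.choose s) := by gcongr
    _ = n.choose s * Real.exp (η * n) := by
        rw [← mul_assoc, ← Real.exp_add, mul_comm]
        congr 2
        ring

lemma choose_le_card_hw_eq (n s : ℕ) :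
    n.choose s ≤ (Finset.univ.filter fun x : Fin n → Bool => hw x = s).card := by
  have h1 : (Finset.powersetCard s (Finset.univ : Finset (Fin n))).card = n.choose s := by simp
  rw [← h1]
  refine Finset.card_le_card_of_injOn indBool (fun A hA => ?_) fun A _ B _ hAB => ?_
  · have : (Finset.univ.filter fun i => indBool A i = true) = A := by ext; simp [indBool]
    refine Finset.mem_coe.2 (Finset.mem_filter.2 ⟨Finset.mem_univ _, ?_⟩)
    rw [hw, this]
    exact (Finset.mem_powersetCard.1 hA).2
  · ext i
    have := congrFun hAB i
    simpa [indBool] using this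

/-- When `Ψ` meets the middle layers, `D_Ψ` has subexponential density with respect to the uniform
distribution. -/
lemma exists_sum_DPsi_le {η : ℝ} (hη : 0 < η) :
    ∃ c : ℝ, 0 < c ∧ ∃ N : ℕ, ∀ n ≥ N, ∀ Ψ ⊆ Finset.range (n + 1),
      (∃ s ∈ Ψ, |(s : ℝ) - n / 2| ≤ c * n) → ∀ T : Finset (Fin n → Bool),
      ∑ y ∈ T, DPsi n Ψ y ≤ Real.exp (η * n) * 𝔼 y, if y ∈ T then (1 : ℝ) else 0 := by
  obtain ⟨c, hc, N, h⟩ := exists_two_pow_le_choose_mul_exp hη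
  refine ⟨c, hc, N, fun n hn Ψ hΨ ⟨s, hs, hsc⟩ T => ?_⟩
  have hsn : s ≤ n := by have := Finset.mem_range.1 (hΨ hs); omega
  have h1 := h n hn s hsn hsc
  set K := Finset.univ.filter fun x : Fin n → Bool => hw x ∈ Ψ with hK
  have hcard : (n.choose s : ℝ) ≤ K.card := by
    have h2 : n.choose s ≤ K.card := (choose_le_card_hw_eq n s).trans
      (Finset.card_le_card fun x hx => by
        rw [Finset.mem_filter] at hx ⊢
        exact ⟨hx.1, hx.2 ▸ hs⟩)
    exact_mod_cast h2
  have hpos : (0 : ℝ) < K.card :=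
    lt_of_lt_of_le (by exact_mod_cast Nat.choose_pos hsn) hcard
  have hle : ∀ y, DPsi n Ψ y ≤ (K.card : ℝ)⁻¹ := by
    intro y
    simp only [DPsi, unifOn]
    split_ifs
    · exact le_rfl
    · positivity
  calc ∑ y ∈ T, DPsi n Ψ y ≤ ∑ _y ∈ T, (K.card : ℝ)⁻¹ := Finset.sum_le_sum fun y _ => hle y
    _ = (2 ^ n / K.card) * (T.card / 2 ^ n) := by
        rw [Finset.sum_const, nsmul_eq_mul]
        field_simp
    _ ≤ Real.exp (η * n) * (T.card / 2 ^ n) := by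
        gcongr
        rw [div_le_iff₀ hpos, mul_comm]
        exact h1.trans (by gcongr)
    _ = _ := by
        rw [Fintype.expect_eq_sum_div_card]
        simp

end Binomial

section Law

open scoped BigOperators

/-- The distribution of `g x` for uniform `x`. -/
def law {α Ω : Type*} [Fintype α] [DecidableEq Ω] (g : α → Ω) (y : Ω) : ℝ :=
  𝔼 x, if g x = y then (1 : ℝ) else 0

lemma law_nonneg {α Ω : Type*} [Fintype α] [DecidableEq Ω] (g : α → Ω) (y : Ω) : 0 ≤ law g y :=
  Finset.expect_nonneg fun x _ => by split_ifs <;> norm_num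

lemma sum_law {α Ω : Type*} [Fintype α] [DecidableEq Ω] (g : α → Ω) (T : Finset Ω) :
    ∑ y ∈ T, law g y = 𝔼 x, if g x ∈ T then (1 : ℝ) else 0 := by
  simp only [law, Fintype.expect_eq_sum_div_card]
  rw [← Finset.sum_div, Finset.sum_comm]
  simp

lemma sum_univ_law {α Ω : Type*} [Fintype α] [Nonempty α] [Fintype Ω] [DecidableEq Ω]
    (g : α → Ω) : ∑ y, law g y = 1 := by
  rw [sum_law]
  simp [Finset.expect_const]

lemma pushf_unifOn_univ {α Ω : Type} [Fintype α] [DecidableEq α] [DecidableEq Ω] (f : α → Ω)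
    (y : Ω) : pushf f (unifOn Finset.univ) y = law f y := by
  simp only [pushf, unifOn, law, Fintype.expect_eq_sum_div_card, Finset.mem_univ, if_true,
    Finset.card_univ]
  rw [Finset.sum_const, nsmul_eq_mul, Finset.sum_boole, div_eq_mul_inv]

lemma wdZ_law {α : Type*} [Fintype α] {n : ℕ} (g : α → Fin n → Bool) (j : ℤ) :
    wdZ (law g) j = 𝔼 x, if (hw (g x) : ℤ) = j then (1 : ℝ) else 0 := by
  rw [wdZ, sum_law]
  simp

/-- Splitting a uniform mixture along a predicate on the components. -/
lemma exists_mixture {σ Ω : Type*} [Fintype Ω] (𝒜 : Finset σ) (h𝒜 : 𝒜.Nonempty) (bad : σ → Prop)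
    [DecidablePred bad] (p : σ → Ω → ℝ) (hp0 : ∀ A y, 0 ≤ p A y) (hp1 : ∀ A, ∑ y, p A y = 1)
    (Q : Ω → ℝ) (hQ0 : ∀ y, 0 ≤ Q y) (hQ1 : ∑ y, Q y = 1) :
    ∃ E X : Ω → ℝ, (∀ y, 0 ≤ E y) ∧ (∑ y, E y = 1) ∧ (∀ y, 0 ≤ X y) ∧ (∑ y, X y = 1) ∧
      (∀ y, (∑ A ∈ 𝒜, p A y) / 𝒜.card
        = (𝒜.filter bad).card / 𝒜.card * E y + (1 - (𝒜.filter bad).card / 𝒜.card) * X y) ∧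
      (X = Q ∨ ((𝒜.filter fun A => ¬bad A).Nonempty ∧
        ∀ y, X y = (∑ A ∈ 𝒜.filter fun A => ¬bad A, p A y) / (𝒜.filter fun A => ¬bad A).card)) := by
  classical
  have key : ∀ B : Finset σ, ∃ E : Ω → ℝ, (∀ y, 0 ≤ E y) ∧ (∑ y, E y = 1) ∧
      (∀ y, (B.card : ℝ) * E y = ∑ A ∈ B, p A y) ∧
      (E = Q ∨ (B.Nonempty ∧ ∀ y, E y = (∑ A ∈ B, p A y) / B.card)) := by
    intro B
    rcases B.eq_empty_or_nonempty with rfl | hB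
    · exact ⟨Q, hQ0, hQ1, by simp, Or.inl rfl⟩
    · have hc : (0 : ℝ) < B.card := by exact_mod_cast hB.card_pos
      refine ⟨fun y => (∑ A ∈ B, p A y) / B.card,
        fun y => div_nonneg (Finset.sum_nonneg fun A _ => hp0 A y) hc.le, ?_, fun y => ?_,
        Or.inr ⟨hB, fun y => rfl⟩⟩
      · rw [← Finset.sum_div, Finset.sum_comm]
        simp only [hp1, Finset.sum_const, nsmul_eq_mul, mul_one]
        exact div_self hc.ne'
      · field_simp
  obtain ⟨E, hE0, hE1, hE, -⟩ := key (𝒜.filter bad)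
  obtain ⟨X, hX0, hX1, hX, hX'⟩ := key (𝒜.filter fun A => ¬bad A)
  refine ⟨E, X, hE0, hE1, hX0, hX1, fun y => ?_, hX'⟩
  have hc : (0 : ℝ) < 𝒜.card := by exact_mod_cast h𝒜.card_pos
  have hcard : ((𝒜.filter bad).card : ℝ) + (𝒜.filter fun A => ¬bad A).card = 𝒜.card := by
    exact_mod_cast Finset.card_filter_add_card_filter_not (s := 𝒜) bad
  have hsum := Finset.sum_filter_add_sum_filter_not 𝒜 bad fun A => p A y
  rw [← hsum, ← hE y, ← hX y]
  field_simp
  rw [← hcard]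
  ring

lemma sum_biUnion_le_sum {σ Ω : Type*} [DecidableEq Ω] (s : Finset σ) (T : σ → Finset Ω)
    {D : Ω → ℝ} (hD : ∀ y, 0 ≤ D y) : ∑ y ∈ s.biUnion T, D y ≤ ∑ A ∈ s, ∑ y ∈ T A, D y := by
  classical
  induction s using Finset.induction_on with
  | empty => simp
  | insert A s hA ih =>
    rw [Finset.biUnion_insert, Finset.sum_insert hA]
    have h1 := Finset.sum_union_inter (s₁ := T A) (s₂ := s.biUnion T) (f := D)
    have h2 : 0 ≤ ∑ y ∈ T A ∩ s.biUnion T, D y := Finset.sum_nonneg fun y _ => hD y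
    linarith

/-- If each bad component is distinguished from `D` by a test, then the bad components have total
weight controlled by the distance of the mixture from `D`. -/
lemma card_bad_div_le_tvd {σ Ω : Type} [Fintype Ω] [DecidableEq Ω] (𝒜 : Finset σ)
    (h𝒜 : 𝒜.Nonempty) (bad : σ → Prop) [DecidablePred bad] (p : σ → Ω → ℝ)
    (hp0 : ∀ A y, 0 ≤ p A y) (P D : Ω → ℝ) (hP : ∀ y, P y = (∑ A ∈ 𝒜, p A y) / 𝒜.card)
    (hD0 : ∀ y, 0 ≤ D y) {ε : ℝ} (hε : 𝒜.card * ε ≤ 1 / 4) (T : σ → Finset Ω)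
    (hT : ∀ A ∈ 𝒜, bad A → 3 / 4 ≤ ∑ y ∈ T A, p A y)
    (hTD : ∀ A ∈ 𝒜, bad A → ∑ y ∈ T A, D y ≤ ε) :
    ((𝒜.filter bad).card / 𝒜.card : ℝ) ≤ 4 * tvd P D := by
  have hc : (0 : ℝ) < 𝒜.card := by exact_mod_cast h𝒜.card_pos
  set 𝓑 := 𝒜.filter bad with h𝓑
  have hmem : ∀ A ∈ 𝓑, A ∈ 𝒜 ∧ bad A := fun A hA => Finset.mem_filter.1 hA
  set U := 𝓑.biUnion T with hU
  have hPU : 3 / 4 * (𝓑.card / 𝒜.card : ℝ) ≤ ∑ y ∈ U, P y := by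
    simp only [hP]
    rw [← Finset.sum_div, Finset.sum_comm, ← mul_div_assoc]
    gcongr
    calc 3 / 4 * (𝓑.card : ℝ) = ∑ _A ∈ 𝓑, (3 / 4 : ℝ) := by
          rw [Finset.sum_const, nsmul_eq_mul, mul_comm]
      _ ≤ ∑ A ∈ 𝓑, ∑ y ∈ U, p A y := Finset.sum_le_sum fun A hA =>
          (hT A (hmem A hA).1 (hmem A hA).2).trans
            (Finset.sum_le_sum_of_subset_of_nonneg (Finset.subset_biUnion_of_mem T hA)
              fun y _ _ => hp0 A y)
      _ ≤ ∑ A ∈ 𝒜, ∑ y ∈ U, p A y :=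
          Finset.sum_le_sum_of_subset_of_nonneg (Finset.filter_subset _ _)
            fun A _ _ => Finset.sum_nonneg fun y _ => hp0 A y
  have hDU : ∑ y ∈ U, D y ≤ 1 / 4 * (𝓑.card / 𝒜.card : ℝ) := by
    calc ∑ y ∈ U, D y ≤ ∑ A ∈ 𝓑, ∑ y ∈ T A, D y := sum_biUnion_le_sum 𝓑 T hD0
      _ ≤ ∑ _A ∈ 𝓑, ε := Finset.sum_le_sum fun A hA => hTD A (hmem A hA).1 (hmem A hA).2
      _ = 𝓑.card / 𝒜.card * (𝒜.card * ε) := by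
          rw [Finset.sum_const, nsmul_eq_mul]
          field_simp
      _ ≤ 𝓑.card / 𝒜.card * (1 / 4) := by gcongr
      _ = _ := mul_comm _ _
  have htv : ∑ y ∈ U, P y - ∑ y ∈ U, D y ≤ 2 * tvd P D := by
    rw [← Finset.sum_sub_distrib, tvd, mul_div_cancel₀ _ (two_ne_zero)]
    exact (Finset.sum_le_sum fun y _ => le_abs_self _).trans
      (Finset.sum_le_sum_of_subset_of_nonneg (Finset.subset_univ _) fun y _ _ => abs_nonneg _)
  linarith

lemma abs_sub_add_two_mul_le {F : ℤ → ℝ} {B : ℝ} (hF : ∀ j, |F j - F (j + 2)| ≤ B) (k : ℤ) (x : ℤ) :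
    |F x - F (x + 2 * k)| ≤ |(k : ℝ)| * B := by
  have hnat : ∀ (k : ℕ) (x : ℤ), |F x - F (x + 2 * k)| ≤ k * B := by
    intro k
    induction k with
    | zero => intro x; simp
    | succ k ih =>
      intro x
      have h1 := abs_add_le (F x - F (x + 2 * k)) (F (x + 2 * k) - F (x + 2 * k + 2))
      have h2 := ih x
      have h3 := hF (x + 2 * k)
      have e : x + 2 * ((k + 1 : ℕ) : ℤ) = x + 2 * k + 2 := by push_cast; ring
      rw [sub_add_sub_cancel] at h1
      rw [e]
      push_cast
      linarith
  obtain ⟨l, rfl | rfl⟩ := k.eq_nat_or_neg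
  · simpa using hnat l x
  · have := hnat l (x + 2 * -(l : ℤ))
    rw [abs_sub_comm] at this
    simpa using this

/-- A distribution whose weight is uniform on `{0, …, n}`. -/
lemma exists_flat (n : ℕ) : ∃ Q : (Fin n → Bool) → ℝ, (∀ y, 0 ≤ Q y) ∧ (∑ y, Q y = 1) ∧
    ∀ j, |wdZ Q j - wdZ Q (j + 2)| ≤ 1 / (n + 1) := by
  set g : Fin (n + 1) → Fin n → Bool := fun k i => decide (i.val < k.val) with hg
  have hwg : ∀ k, hw (g k) = k := by
    intro k
    have hk : (k : ℕ) ≤ n := Nat.lt_succ_iff.1 k.2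
    simp [hw, hg, Fin.card_filter_val_lt, hk]
  refine ⟨law g, law_nonneg g, sum_univ_law g, fun j => ?_⟩
  have h : ∀ j : ℤ, 0 ≤ wdZ (law g) j ∧ wdZ (law g) j ≤ 1 / (n + 1) := by
    intro j
    rw [wdZ_law, Fintype.expect_eq_sum_div_card, Finset.sum_boole, Fintype.card_fin]
    simp only [hwg]
    refine ⟨by positivity, ?_⟩
    push_cast
    gcongr
    have : (Finset.univ.filter fun k : Fin (n + 1) => ((k : ℕ) : ℤ) = j).card ≤ 1 := by
      refine Finset.card_le_one.2 fun a ha b hb => ?_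
      simp only [Finset.mem_filter, Finset.mem_univ, true_and] at ha hb
      exact Fin.ext (by omega)
    exact_mod_cast this
  rw [abs_le]
  constructor <;> linarith [h j, h (j + 2)]

lemma abs_wdZ_average_sub_le {σ : Type*} {n : ℕ} (𝒢 : Finset σ) (h𝒢 : 𝒢.Nonempty)
    (p : σ → (Fin n → Bool) → ℝ) {B : ℝ} (X : (Fin n → Bool) → ℝ)
    (hX : ∀ y, X y = (∑ A ∈ 𝒢, p A y) / 𝒢.card) (i j : ℤ)
    (hp : ∀ A ∈ 𝒢, |wdZ (p A) i - wdZ (p A) j| ≤ B) : |wdZ X i - wdZ X j| ≤ B := by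
  have hc : (0 : ℝ) < 𝒢.card := by exact_mod_cast h𝒢.card_pos
  have h : ∀ j, wdZ X j = (∑ A ∈ 𝒢, wdZ (p A) j) / 𝒢.card := by
    intro j
    simp only [wdZ, hX]
    rw [← Finset.sum_div, Finset.sum_comm]
  rw [h, h, ← sub_div, ← Finset.sum_sub_distrib, abs_div, abs_of_pos hc, div_le_iff₀ hc]
  calc _ ≤ ∑ A ∈ 𝒢, |wdZ (p A) i - wdZ (p A) j| := Finset.abs_sum_le_sum_abs _ _
    _ ≤ ∑ _A ∈ 𝒢, B := Finset.sum_le_sum hp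
    _ = _ := by rw [Finset.sum_const, nsmul_eq_mul, mul_comm]

end Law

section Restriction

open scoped BigOperators

variable {ι κ : Type} [Fintype ι] [DecidableEq ι] [Fintype κ] [DecidableEq κ]

/-- The function obtained from `f` by fixing the inputs in `S` to the indicator of `A`. -/
def restrictInputs (f : (ι → Bool) → (κ → Bool)) (S A : Finset ι) : (ι → Bool) → (κ → Bool) :=
  fun x => f (S.piecewise (indBool A) x)

lemma dependsOn_restrictInputs {f : (ι → Bool) → (κ → Bool)} {I : κ → Finset ι}
    (hI : ∀ u, DependsOn (fun x => f x u) (I u)) (S A : Finset ι) (u : κ) :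
    DependsOn (fun x => restrictInputs f S A x u) (I u \ S : Finset ι) := by
  intro x y hxy
  refine hI u fun j hj => ?_
  by_cases hjS : j ∈ S
  · simp [hjS]
  · have := hxy j (Finset.mem_coe.2 (Finset.mem_sdiff.2 ⟨Finset.mem_coe.1 hj, hjS⟩))
    simpa [hjS] using this

lemma law_eq_average_restrictInputs (f : (ι → Bool) → (κ → Bool)) (S : Finset ι) (y : κ → Bool) :
    law f y = (∑ A ∈ S.powerset, law (restrictInputs f S A) y) / S.powerset.card := by
  rw [law, expect_eq_sum_restrict S fun x => if f x = y then (1 : ℝ) else 0, Finset.card_powerset]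
  push_cast
  rfl

end Restriction

lemma hw_eq_partialWeight {n : ℕ} (y : Fin n → Bool) : hw y = partialWeight Finset.univ y := by
  rw [hw, partialWeight, Finset.card_filter]

open scoped BigOperators in
/-- A local function with linearly many uniform blocks has smooth output weight. -/
lemma exists_abs_wdZ_law_sub_le (q : ℕ) :
    ∃ c : ℝ, 0 < c ∧ ∀ {m n : ℕ} {g : (Fin m → Bool) → (Fin n → Bool)} {I : Fin n → Finset (Fin m)}
      (_ : ∀ u, DependsOn (fun x => g x u) (I u)) {M : Finset (Fin n)}
      {N : Fin n → Finset (Fin n)} {J : Fin n → Finset (Fin m)} (_ : BlockSystem I M N J)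
      (_ : ∀ v ∈ M, (J v).card ≤ q) (_ : ∀ v ∈ M, (N v).card ≤ q)
      (_ : ∀ v ∈ M, UniformOn g (N v)) (_ : M.Nonempty) (j : ℤ),
      |wdZ (law g) j - wdZ (law g) (j + 2)| ≤ 2 / (c * M.card) := by
  obtain ⟨c, hc, h⟩ := exists_weight_decay q
  refine ⟨c, hc, fun {m n g I} hI {M N J} hB hJ hN hU hM j => ?_⟩
  have hpos : (0 : ℝ) < M.card := by exact_mod_cast hM.card_pos
  rw [wdZ_law, wdZ_law]
  simp only [hw_eq_partialWeight]
  exact abs_mass_sub_mass_le _ (by positivity) (h hI hB hJ hN hU) j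

open scoped BigOperators in
lemma exists_test_of_card_le {ι κ : Type} [Fintype ι] [DecidableEq ι] [Fintype κ] [DecidableEq κ]
    {g : (ι → Bool) → (κ → Bool)} {I : κ → Finset ι}
    (hI : ∀ u, DependsOn (fun x => g x u) (I u)) {M : Finset κ} {N : κ → Finset κ}
    {J : κ → Finset ι} (hB : BlockSystem I M N J) {q : ℕ} (hJ : ∀ v ∈ M, (J v).card ≤ q)
    (hN : ∀ v ∈ M, (N v).card ≤ q) [DecidablePred fun v => UniformOn g (N v)]
    (hM : M.card ≤ 2 * (M.filter fun v => ¬UniformOn g (N v)).card) :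
    ∃ T : Finset (κ → Bool),
      𝔼 y, (if y ∈ T then (1 : ℝ) else 0) ≤ Real.exp (-(((1 / 2) ^ q) ^ 2 * M.card / 32)) ∧
      1 - Real.exp (-(((1 / 2) ^ q) ^ 2 * M.card / 32)) ≤ ∑ y ∈ T, law g y := by
  set K := M.filter fun v => ¬UniformOn g (N v) with hK
  have hKM : K ⊆ M := Finset.filter_subset _ _
  have hB' := hB.mono hKM
  obtain ⟨T, h1, h2⟩ := exists_test hI K N J hB'.inputs_subset hB'.disjoint_inputs
    hB'.disjoint_outputs (fun v hv => hJ v (hKM hv)) (fun v hv => hN v (hKM hv))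
    fun v hv => (Finset.mem_filter.1 hv).2
  set δ : ℝ := (1 / 2) ^ q with hδ
  have hδ0 : 0 < δ := by positivity
  have hδ1 : δ ≤ 1 := pow_le_one₀ (by norm_num) (by norm_num)
  have hexp : (1 - δ ^ 2 / 16) ^ K.card ≤ Real.exp (-(δ ^ 2 * M.card / 32)) := by
    have hM' : (M.card : ℝ) ≤ 2 * K.card := by exact_mod_cast hM
    have h3 : 1 - δ ^ 2 / 16 ≤ Real.exp (-(δ ^ 2 / 16)) := by
      have := Real.add_one_le_exp (-(δ ^ 2 / 16))
      linarith
    have h4 : 0 ≤ 1 - δ ^ 2 / 16 := by nlinarith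
    calc _ ≤ Real.exp (-(δ ^ 2 / 16)) ^ K.card := by gcongr
      _ = Real.exp (K.card * -(δ ^ 2 / 16)) := (Real.exp_nat_mul _ _).symm
      _ ≤ _ := Real.exp_le_exp.2 (by
          have : δ ^ 2 * M.card ≤ δ ^ 2 * (2 * K.card) := by gcongr
          linarith)
  refine ⟨T, h1.trans hexp, ?_⟩
  have hsum : (𝔼 x, if g x ∈ T then (1 : ℝ) else 0) + 𝔼 x, (if g x ∈ T then (0 : ℝ) else 1) = 1 := by
    rw [← Finset.expect_add_distrib, ← Finset.expect_const (s := (Finset.univ : Finset (ι → Bool)))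
      Finset.univ_nonempty (1 : ℝ)]
    refine Finset.expect_congr rfl fun x _ => ?_
    split_ifs <;> simp
  rw [sum_law]
  linarith [h2.trans hexp]

/-- Continuity bound: `f(U^m) = aE + (1-a)X` with `a = O(dTV(f(U^m), D_Ψ))` and the weight
distribution of `X` varying by at most `O_d(|Δ|/n)` over shifts by an even `Δ`. -/
theorem stmt6 :
    ∃ C : ℝ, 0 < C ∧ ∀ d : ℕ, 1 ≤ d →
    ∃ c : ℝ, 0 < c ∧ ∃ Cd : ℝ, 0 < Cd ∧ ∃ N : ℕ, ∀ n : ℕ, N ≤ n → ∀ m : ℕ,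
    ∀ f : (Fin m → Bool) → (Fin n → Bool), IsLocal d f →
    ∀ Ψ : Finset ℕ, Ψ ⊆ Finset.range (n + 1) →
    (∃ s ∈ Ψ, |(s : ℝ) - n / 2| ≤ c * n) →
    ∃ a : ℝ, 0 ≤ a ∧ a ≤ 1 ∧
      a ≤ C * tvd (pushf f (unifOn (Finset.univ : Finset (Fin m → Bool)))) (DPsi n Ψ) ∧
    ∃ E X : (Fin n → Bool) → ℝ,
      (∀ y, 0 ≤ E y) ∧ (∑ y, E y = 1) ∧ (∀ y, 0 ≤ X y) ∧ (∑ y, X y = 1) ∧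
      (∀ y, pushf f (unifOn (Finset.univ : Finset (Fin m → Bool))) y
          = a * E y + (1 - a) * X y) ∧
      ∀ Δ : ℤ, Even Δ → ∀ x : ℕ, x ≤ n →
        |wdZ X (x : ℤ) - wdZ X ((x : ℤ) + Δ)| ≤ Cd * |(Δ : ℝ)| / n := by
  classical
  refine ⟨4, by norm_num, fun d hd => ?_⟩
  obtain ⟨ν, tmax, hG⟩ := exists_blockSystem hd fun t => 96 * 4 ^ (d * (1 + d * t))
  obtain ⟨c₁, hc₁, hsmooth⟩ := exists_abs_wdZ_law_sub_le (d * (1 + d * tmax))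
  set δ : ℝ := (1 / 2) ^ (d * (1 + d * tmax)) with hδ
  have hδ0 : 0 < δ := by positivity
  have hν : (0 : ℝ) < ν + 1 := by positivity
  set η : ℝ := δ ^ 2 / 96 / (ν + 1) with hη
  have hη0 : 0 < η := by positivity
  obtain ⟨c, hc, N₀, hD⟩ := exists_sum_DPsi_le hη0
  refine ⟨c, hc, 1 + 2 * (ν + 1) / c₁, by positivity, max N₀ (⌈2 / η⌉₊ + 1), ?_⟩
  intro n hn m f hf Ψ hΨ hs
  have hnN : N₀ ≤ n := (le_max_left _ _).trans hn
  have hn1 : ⌈2 / η⌉₊ + 1 ≤ n := (le_max_right _ _).trans hn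
  have hn0 : (0 : ℝ) < n := by
    have : 0 < n := by omega
    exact_mod_cast this
  have hηn : 2 ≤ η * n := by
    have h1 : 2 / η ≤ n := Nat.ceil_le.1 (by omega)
    rwa [div_le_iff₀ hη0, mul_comm] at h1
  choose I hId hI using hf
  have hdep : ∀ u, DependsOn (fun x => f x u) (I u) := fun u x y h =>
    hI u x y fun j hj => h j (Finset.mem_coe.2 hj)
  obtain ⟨S, t, M, N, J, ht, hB, hN, hJ, hSM, hnM⟩ := hG I hId
  set q := d * (1 + d * t) with hq
  have hq1 : 1 + d * t ≤ q := Nat.le_mul_of_pos_left _ hd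
  have hN' : ∀ v ∈ M, (N v).card ≤ q := fun v hv => (hN v hv).trans hq1
  have hqmax : q ≤ d * (1 + d * tmax) := by rw [hq]; gcongr
  set γ : ℝ := (1 / 2) ^ q with hγ
  have hδγ : δ ≤ γ := pow_le_pow_of_le_one (by norm_num) (by norm_num) hqmax
  have hnM' : (n : ℝ) ≤ (ν + 1) * M.card := by
    have h1 : (n : ℝ) ≤ ν * M.card := by
      rw [Fintype.card_fin] at hnM
      exact_mod_cast hnM
    have h2 : (0 : ℝ) ≤ M.card := Nat.cast_nonneg _
    linarith
  have hM0 : (0 : ℝ) < M.card := pos_of_mul_pos_right (hn0.trans_le hnM') hν.le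
  set β : ℝ := γ ^ 2 * M.card / 96 with hβ
  have hηβ : η * n ≤ β := by
    calc η * n ≤ η * ((ν + 1) * M.card) := by gcongr
      _ = δ ^ 2 * M.card / 96 := by rw [hη]; field_simp
      _ ≤ β := by rw [hβ]; gcongr
  have hSβ : (S.card : ℝ) ≤ β := by
    have h1 : (S.card : ℝ) * (96 * 4 ^ q) ≤ M.card := by exact_mod_cast hSM
    have h2 : γ ^ 2 * 4 ^ q = 1 := by
      rw [hγ, ← pow_mul, mul_comm q 2, pow_mul, ← mul_pow]
      norm_num
    calc (S.card : ℝ) = γ ^ 2 * (S.card * (96 * 4 ^ q)) / 96 := by linear_combination -S.card * h2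
      _ ≤ β := by rw [hβ]; gcongr
  have hexp : Real.exp (-β) ≤ 1 / 4 := by
    have h1 := Real.quadratic_le_exp_of_nonneg (x := β) (by linarith)
    have h2 : 4 ≤ Real.exp β := by nlinarith
    rw [Real.exp_neg, one_div]
    exact inv_anti₀ (by norm_num) h2
  have h3β : γ ^ 2 * M.card / 32 = 3 * β := by rw [hβ]; ring
  set g := fun A => restrictInputs f S A with hg
  have hgdep : ∀ A u, DependsOn (fun x => g A x u) (I u \ S : Finset (Fin m)) :=
    fun A u => dependsOn_restrictInputs hdep S A u
  set bad : Finset (Fin m) → Prop := fun A =>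
    M.card ≤ 2 * (M.filter fun v => ¬UniformOn (g A) (N v)).card with hbad
  have htest : ∀ A, ∃ T : Finset (Fin n → Bool), bad A →
      ∑ y ∈ T, DPsi n Ψ y ≤ Real.exp (-(2 * β)) ∧ 3 / 4 ≤ ∑ y ∈ T, law (g A) y := by
    intro A
    by_cases hA : bad A
    · obtain ⟨T, h1, h2⟩ := exists_test_of_card_le (hgdep A) hB hJ hN' hA
      rw [h3β] at h1 h2
      refine ⟨T, fun _ => ⟨?_, ?_⟩⟩
      · calc _ ≤ _ := hD n hnN Ψ hΨ hs T
          _ ≤ Real.exp β * Real.exp (-(3 * β)) := by gcongr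
          _ = _ := by rw [← Real.exp_add]; congr 1; ring
      · have : Real.exp (-(3 * β)) ≤ Real.exp (-β) := Real.exp_le_exp.2 (by linarith)
        linarith
    · exact ⟨∅, fun h => absurd h hA⟩
  choose T hT using htest
  obtain ⟨Q, hQ0, hQ1, hQ⟩ := exists_flat n
  have h𝒜 : S.powerset.Nonempty := ⟨∅, Finset.empty_mem_powerset S⟩
  obtain ⟨E, X, hE0, hE1, hX0, hX1, hmix, hX⟩ := exists_mixture S.powerset h𝒜 bad
    (fun A => law (g A)) (fun A => law_nonneg (g A)) (fun A => sum_univ_law (g A)) Q hQ0 hQ1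
  have hP : ∀ y, pushf f (unifOn Finset.univ) y
      = (∑ A ∈ S.powerset, law (g A) y) / S.powerset.card := fun y => by
    rw [pushf_unifOn_univ, law_eq_average_restrictInputs f S]
  have hB2 : ∀ j, |wdZ X j - wdZ X (j + 2)| ≤ 2 * (1 + 2 * (ν + 1) / c₁) / n := by
    have hsplit : 2 * (1 + 2 * ((ν : ℝ) + 1) / c₁) / n = 2 / n + 4 * (ν + 1) / (c₁ * n) := by
      field_simp
      ring
    rcases hX with rfl | ⟨hne, hX⟩
    · intro j
      refine (hQ j).trans ?_
      rw [hsplit]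
      have h1 : 1 / ((n : ℝ) + 1) ≤ 2 / n := by gcongr <;> linarith
      have h2 : 0 ≤ 4 * ((ν : ℝ) + 1) / (c₁ * n) := by positivity
      linarith
    · intro j
      refine abs_wdZ_average_sub_le _ hne _ X hX j (j + 2) fun A hA => ?_
      have hgood : 2 * (M.filter fun v => ¬UniformOn (g A) (N v)).card < M.card :=
        not_le.1 (Finset.mem_filter.1 hA).2
      set K := M.filter fun v => UniformOn (g A) (N v) with hK
      have hKM : K ⊆ M := Finset.filter_subset _ _
      have hcard : K.card + (M.filter fun v => ¬UniformOn (g A) (N v)).card = M.card :=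
        Finset.card_filter_add_card_filter_not _
      have hMK : M.card ≤ 2 * K.card := by omega
      have hMK' : (M.card : ℝ) ≤ 2 * K.card := by exact_mod_cast hMK
      have hKne : K.Nonempty := Finset.card_pos.1 (by
        have : 0 < M.card := by exact_mod_cast hM0
        omega)
      have hK0 : (0 : ℝ) < K.card := by exact_mod_cast hKne.card_pos
      refine (hsmooth (hgdep A) (hB.mono hKM) (fun v hv => (hJ v (hKM hv)).trans hqmax)
        (fun v hv => (hN' v (hKM hv)).trans hqmax) (fun v hv => (Finset.mem_filter.1 hv).2)
        hKne j).trans ?_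
      rw [hsplit]
      have h1 : 0 ≤ 2 / (n : ℝ) := by positivity
      have h2 : 2 / (c₁ * K.card) ≤ 4 * ((ν : ℝ) + 1) / (c₁ * n) := by
        rw [div_le_div_iff₀ (by positivity) (by positivity)]
        have h3 : (n : ℝ) ≤ (ν + 1) * (2 * K.card) := hnM'.trans (by gcongr)
        have h4 : c₁ * n ≤ c₁ * ((ν + 1) * (2 * K.card)) := by gcongr
        linarith
      linarith
  have hDPsi0 : ∀ y, 0 ≤ DPsi n Ψ y := fun y => by
    unfold DPsi unifOn
    split_ifs <;> positivity
  refine ⟨(S.powerset.filter bad).card / S.powerset.card, by positivity, ?_, ?_,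
    E, X, hE0, hE1, hX0, hX1, fun y => (hP y).trans (hmix y), ?_⟩
  · exact div_le_one_of_le₀ (by exact_mod_cast Finset.card_filter_le _ _) (by positivity)
  · refine card_bad_div_le_tvd S.powerset h𝒜 bad (fun A => law (g A))
      (fun A => law_nonneg (g A)) _ _ hP hDPsi0 (ε := Real.exp (-(2 * β))) ?_ T
      (fun A _ hA => (hT A hA).2) (fun A _ hA => (hT A hA).1)
    have h2 : (2 : ℝ) ≤ Real.exp 1 := by
      have := Real.add_one_le_exp (1 : ℝ)
      linarith
    rw [Finset.card_powerset]
    push_cast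
    calc (2 : ℝ) ^ S.card * Real.exp (-(2 * β)) ≤ Real.exp 1 ^ S.card * Real.exp (-(2 * β)) := by
          gcongr
      _ = Real.exp (S.card) * Real.exp (-(2 * β)) := by rw [← Real.exp_nat_mul, mul_one]
      _ ≤ Real.exp β * Real.exp (-(2 * β)) := by gcongr
      _ = Real.exp (-β) := by rw [← Real.exp_add]; congr 1; ring
      _ ≤ 1 / 4 := hexp
  · rintro Δ ⟨k, rfl⟩ x -
    have h := abs_sub_add_two_mul_le hB2 k x
    rw [two_mul] at h
    refine h.trans (le_of_eq ?_)
    have h2 : |((k + k : ℤ) : ℝ)| = 2 * |(k : ℝ)| := by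
      push_cast
      rw [← two_mul, abs_mul, abs_two]
    rw [h2]
    ring
end
end
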